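/- arXiv:1602.02613 — 4 statements merged into one kernel-verified Lean document; each statement's English description precedes it below -/
import Mathlib

section
/- Let T be a tower of type (m_1, m_2) over a rotation, and suppose m_1 < m_2. Then either T is conjugate in 𝔾 to a tower of type (m_1, m_2 − m_1) over a rotation, or T^{−1} is conjugate in 𝔾 to a tower of type (m_2 − m_1, m_1) over a rotation. The analogous result holds if m_1 > m_2. -/
open Set

namespace IETRoots

noncomputable section

/-- The unit interval `[0,1)`, the domain of our interval exchange transformations. -/
def unitI : Set ℝ := Set.Ico 0 1

/-- `T : ℝ → ℝ` is (the extension by the identity of) an interval exchange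
transformation: it fixes the complement of `[0,1)`, maps `[0,1)` bijectively onto
itself, and there is a finite partition of `[0,1)` into half-open intervals on each
of which `T` is a translation.  The group `𝔾` of IETs is the set of such maps under
composition. -/
def IsIET (T : ℝ → ℝ) : Prop :=
  Set.BijOn T unitI unitI ∧ (∀ x, x ∉ unitI → T x = x) ∧
  ∃ (k : ℕ) (β : Fin (k + 1) → ℝ), StrictMono β ∧ β 0 = 0 ∧ β (Fin.last k) = 1 ∧
    ∀ i : Fin k, ∃ c : ℝ, ∀ x ∈ Set.Ico (β i.castSucc) (β i.succ), T x = x + c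

/-- The `ℤ`-orbit `{T^n x : n ∈ ℤ}` of `x` under the bijection `T`. -/
def orbitZ (T : ℝ → ℝ) (x : ℝ) : Set ℝ := {y | ∃ n : ℕ, T^[n] x = y ∨ T^[n] y = x}

/-- `T` is minimal: every orbit is dense in `[0,1)`. -/
def IsMinimal (T : ℝ → ℝ) : Prop := ∀ x ∈ unitI, unitI ⊆ closure (orbitZ T x)

/-- `T` is of rotation type: `T x = x + α (mod 1)` on `[0,1)`. -/
def IsRotationType (T : ℝ → ℝ) : Prop := ∃ α : ℝ, ∀ x ∈ unitI, T x = Int.fract (x + α)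

/-- `T` has an `n`-th root in the group `𝔾` of IETs for some `n ≥ 2`. -/
def HasNontrivialRoot (T : ℝ → ℝ) : Prop :=
  ∃ (S : ℝ → ℝ) (n : ℕ), IsIET S ∧ 2 ≤ n ∧ S^[n] = T

/-- The set `D(T)` of points of `[0,1)` at which `T` is discontinuous
(as a map of `[0,1)`). -/
def DiscSet (T : ℝ → ℝ) : Set ℝ := {x | x ∈ unitI ∧ ¬ ContinuousWithinAt T unitI x}

/-- `β_j = λ_1 + ⋯ + λ_j` (`0`-indexed: the sum of the first `j` lengths). -/
def betaPt {m : ℕ} (lam : Fin m → ℝ) (j : ℕ) : ℝ :=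
  ∑ i ∈ Finset.univ.filter (fun i : Fin m => (i : ℕ) < j), lam i

/-- The interval exchange transformation `T_{(π,λ)}` determined by a permutation
`π ∈ S_m` and a length vector `λ`: on `I_j = [β_{j-1}, β_j)` it is given by
`x ↦ x - ∑_{i<j} λ_i + ∑_{π(i)<π(j)} λ_i`; outside `[0,1)` it is the identity. -/
noncomputable def ietMap {m : ℕ} (π : Equiv.Perm (Fin m)) (lam : Fin m → ℝ) : ℝ → ℝ :=
  fun x =>
    if h : ∃ j : Fin m, x ∈ Set.Ico (betaPt lam (j : ℕ)) (betaPt lam (j : ℕ) + lam j) then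
      x - betaPt lam (h.choose : ℕ) +
        ∑ i ∈ Finset.univ.filter (fun i : Fin m => π i < π h.choose), lam i
    else x

/-- A permutation `π ∈ S_m` is separating if `π(i+1) ≠ π(i) + 1` for `1 ≤ i ≤ m-1`. -/
def Separating {m : ℕ} (π : Equiv.Perm (Fin m)) : Prop :=
  ∀ i j : Fin m, (j : ℕ) = (i : ℕ) + 1 → (π j : ℕ) ≠ (π i : ℕ) + 1

/-- A permutation `π ∈ S_m` is irreducible if `π({1,…,k}) ≠ {1,…,k}` for all `k < m`. -/
def IrreduciblePerm {m : ℕ} (π : Equiv.Perm (Fin m)) : Prop :=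
  ∀ k : ℕ, 1 ≤ k → k < m → ∃ i : Fin m, (i : ℕ) < k ∧ k ≤ (π i : ℕ)

/-- The endpoints `0 = γ_0 < γ_1 < ⋯ < γ_{m-1} < γ_m = 1`, namely the discontinuities
of `T` together with `0` and `1`. -/
def endpointsOf (T : ℝ → ℝ) : Set ℝ := insert 0 (insert 1 (DiscSet T))

/-- The set of lengths `l_j = γ_j - γ_{j-1}` of the intervals of continuity of `T`,
i.e. the gaps between consecutive endpoints. -/
def gapLengths (T : ℝ → ℝ) : Set ℝ :=
  {l | ∃ a ∈ endpointsOf T, ∃ b ∈ endpointsOf T,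
        a < b ∧ (∀ c ∈ endpointsOf T, ¬(a < c ∧ c < b)) ∧ l = b - a}

/-- The rank of `T`: the dimension of the `ℚ`-vector space spanned by the lengths
`l_1, …, l_m`. -/
noncomputable def ietRank (T : ℝ → ℝ) : ℕ :=
  Module.finrank ℚ (Submodule.span ℚ (gapLengths T))

/-- Keane's infinite distinct orbit condition for an `m`-IET `T = T_{(π,λ)}`:
the orbits of `β_1, …, β_{m-1}` are infinite and pairwise disjoint. -/
def SatisfiesIDOC {m : ℕ} (lam : Fin m → ℝ) (T : ℝ → ℝ) : Prop :=
  (∀ j : ℕ, 1 ≤ j → j ≤ m - 1 → (orbitZ T (betaPt lam j)).Infinite) ∧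
  ∀ j j' : ℕ, 1 ≤ j → j ≤ m - 1 → 1 ≤ j' → j' ≤ m - 1 → j ≠ j' →
    orbitZ T (betaPt lam j) ∩ orbitZ T (betaPt lam j') = ∅

/-- A rotation: a `2`-IET with permutation `(21)`, i.e. `x ↦ x + α (mod 1)`
with `α ∈ (0,1)`. -/
def IsRotation (S : ℝ → ℝ) : Prop :=
  (∀ x, x ∉ unitI → S x = x) ∧ ∃ α ∈ Set.Ioo (0 : ℝ) 1, ∀ x ∈ unitI, S x = Int.fract (x + α)

/-- Conjugacy in the group `𝔾` of IETs. -/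
def IsConjugate (T T' : ℝ → ℝ) : Prop := ∃ g : ℝ → ℝ, IsIET g ∧ g ∘ T = T' ∘ g

/-- `T` is a tower of type `(n_1, …, n_k)` over the `k`-IET `S`:  there is a partition
`0 = t_0 < t_1 < ⋯ < t_k = 1` into intervals `I_i` on which `S` is a translation, a
scaling factor `c > 0`, and for each `i` a family of `n_i` pairwise disjoint "levels"
(scaled copies of `I_i`) which together partition `[0,1)`, such that `T` translates each
level of the `i`-th column onto the next one, and maps the top level back to the bottom
levels according to `S` (all after rescaling by `c`). -/
def IsTowerOver {k : ℕ} (T : ℝ → ℝ) (n : Fin k → ℕ) (S : ℝ → ℝ) : Prop :=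
  IsIET T ∧ IsIET S ∧ (∀ i, 0 < n i) ∧
  ∃ (t : Fin (k + 1) → ℝ) (c : ℝ) (a : Fin k → ℕ → ℝ),
    StrictMono t ∧ t 0 = 0 ∧ t (Fin.last k) = 1 ∧ 0 < c ∧
    (∀ i : Fin k, ∃ d : ℝ, ∀ x ∈ Set.Ico (t i.castSucc) (t i.succ), S x = x + d) ∧
    (∀ i : Fin k, ∀ j : ℕ, j < n i →
      Set.Ico (a i j) (a i j + c * (t i.succ - t i.castSucc)) ⊆ unitI) ∧
    (∀ i i' : Fin k, ∀ j j' : ℕ, j < n i → j' < n i' → (i, j) ≠ (i', j') →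
      Disjoint (Set.Ico (a i j) (a i j + c * (t i.succ - t i.castSucc)))
        (Set.Ico (a i' j') (a i' j' + c * (t i'.succ - t i'.castSucc)))) ∧
    (∀ y ∈ unitI, ∃ (i : Fin k) (j : ℕ), j < n i ∧
      y ∈ Set.Ico (a i j) (a i j + c * (t i.succ - t i.castSucc))) ∧
    (∀ i : Fin k, ∀ j : ℕ, j + 1 < n i → ∀ x ∈ Set.Ico (t i.castSucc) (t i.succ),
      T (a i j + c * (x - t i.castSucc)) = a i (j + 1) + c * (x - t i.castSucc)) ∧
    (∀ i : Fin k, ∀ x ∈ Set.Ico (t i.castSucc) (t i.succ), ∀ i' : Fin k,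
      S x ∈ Set.Ico (t i'.castSucc) (t i'.succ) →
      T (a i (n i - 1) + c * (x - t i.castSucc)) = a i' 0 + c * (S x - t i'.castSucc))

/-- The data of the first return map of `T` to `J = [a,b)`: a partition
`a = s_0 < s_1 < ⋯ < s_k = b` of `J`, return times `mt_i ≥ 1` and translation
constants `c_i` such that for `x` in the `i`-th piece the iterates `T^j x`, `0 < j < mt_i`,
avoid `J`, while `T^{mt_i} x = x + c_i ∈ J`.  Thus the first return map `T_J` is the
`k`-IET `x ↦ x + c_i` on the `i`-th piece. -/
def IsFirstReturnSystem (T : ℝ → ℝ) (a b : ℝ) {k : ℕ} (s : Fin (k + 1) → ℝ)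
    (mt : Fin k → ℕ) (c : Fin k → ℝ) : Prop :=
  StrictMono s ∧ s 0 = a ∧ s (Fin.last k) = b ∧
  ∀ i : Fin k, 0 < mt i ∧ ∀ x ∈ Set.Ico (s i.castSucc) (s i.succ),
    (∀ j : ℕ, 0 < j → j < mt i → T^[j] x ∉ Set.Ico a b) ∧
    T^[mt i] x ∈ Set.Ico a b ∧ T^[mt i] x = x + c i

/-- A finite sequence `x_0, …, x_k` is an `S`-chain if `x_0` and `x_k` lie in
`D(S) ∪ {0}` and `S x_i = x_{i+1}`. -/
def IsSChainSeq (S : ℝ → ℝ) {k : ℕ} (x : Fin (k + 1) → ℝ) : Prop :=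
  x 0 ∈ insert (0 : ℝ) (DiscSet S) ∧ x (Fin.last k) ∈ insert (0 : ℝ) (DiscSet S) ∧
  ∀ i : Fin k, S (x i.castSucc) = x i.succ

/-- A set `C ⊆ ℝ` is (the underlying set of) an `S`-chain. -/
def IsSChain (S : ℝ → ℝ) (C : Set ℝ) : Prop :=
  ∃ (k : ℕ) (x : Fin (k + 1) → ℝ), IsSChainSeq S x ∧ C = Set.range x

/-- A maximal `S`-chain: an `S`-chain which is not a proper subset of another `S`-chain. -/
def IsMaximalSChain (S : ℝ → ℝ) (C : Set ℝ) : Prop :=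
  IsSChain S C ∧ ∀ C', IsSChain S C' → C ⊆ C' → C = C'

/-- The open simplex `Δ_m ⊆ ℝ^m`. -/
def simplexSet (m : ℕ) : Set (Fin m → ℝ) := {lam | (∀ i, 0 < lam i) ∧ ∑ i, lam i = 1}

/-- The affine chart identifying (a superset of) `Δ_m` with a subset of `ℝ^{m-1}`:
`λ_i = x_i` for `i < m-1` and `λ_{m-1} = 1 - ∑ x_j`.  Lebesgue measure on `Δ_m`
is the `(m-1)`-dimensional Lebesgue measure carried through this chart. -/
def chartMap (m : ℕ) (x : Fin (m - 1) → ℝ) : Fin m → ℝ := fun i =>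
  if h : (i : ℕ) < m - 1 then x ⟨(i : ℕ), h⟩ else 1 - ∑ j, x j

/-- The permutation `(321) ∈ S_3`, sending `1 ↦ 3`, `2 ↦ 2`, `3 ↦ 1`. -/
def perm321 : Equiv.Perm (Fin 3) :=
  ⟨fun i => i.rev, fun i => i.rev, fun i => Fin.rev_rev i, fun i => Fin.rev_rev i⟩

end


/-- Finite piecewise translation data (unordered). -/
def PW (T : ℝ → ℝ) : Prop :=
  ∃ P : Finset (ℝ × ℝ × ℝ), ∀ x ∈ unitI, ∃ p ∈ P, (p.1 ≤ x ∧ x < p.2.1) ∧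
    ∀ y, p.1 ≤ y → y < p.2.1 → T y = y + p.2.2

lemma exists_piece {k : ℕ} (β : Fin (k + 1) → ℝ) (x : ℝ) (h0 : β 0 ≤ x) (h1 : x < β (Fin.last k)) :
    ∃ i : Fin k, β i.castSucc ≤ x ∧ x < β i.succ := by
  induction k with
  | zero => exact absurd (lt_of_le_of_lt h0 h1) (lt_irrefl _)
  | succ k ih =>
    by_cases h : x < β (Fin.last k).castSucc
    · obtain ⟨i, hi⟩ := ih (fun i => β i.castSucc) h0 h
      exact ⟨i.castSucc, hi.1, hi.2⟩
    · exact ⟨Fin.last k, not_lt.1 h, h1⟩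

lemma IsIET.pw {T : ℝ → ℝ} (h : IsIET T) : PW T := by
  obtain ⟨-, -, k, β, hm, h0, h1, hc⟩ := h
  choose c hc using hc
  classical
  refine ⟨Finset.univ.image (fun i : Fin k => (β i.castSucc, β i.succ, c i)), ?_⟩
  intro x hx
  obtain ⟨i, hi⟩ := exists_piece β x (by rw [h0]; exact hx.1) (by rw [h1]; exact hx.2)
  exact ⟨_, Finset.mem_image_of_mem _ (Finset.mem_univ i), hi, fun y h1 h2 => hc i y ⟨h1, h2⟩⟩

lemma isIET_of_pw {T : ℝ → ℝ} (hb : Set.BijOn T unitI unitI) (ho : ∀ x, x ∉ unitI → T x = x)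
    (h : PW T) : IsIET T := by
  classical
  refine ⟨hb, ho, ?_⟩
  obtain ⟨P, hP⟩ := h
  set F : Finset ℝ := (insert 0 (insert 1 (P.image (fun p => p.2.1)))).filter
    (fun x => 0 ≤ x ∧ x ≤ 1) with hF
  have h0 : (0:ℝ) ∈ F := by simp [hF]
  have h1 : (1:ℝ) ∈ F := by simp [hF]
  have hpos : 0 < F.card := Finset.card_pos.2 ⟨0, h0⟩
  obtain ⟨k, hk⟩ : ∃ k, F.card = k + 1 := ⟨F.card - 1, by omega⟩
  have hF01 : ∀ x ∈ F, 0 ≤ x ∧ x ≤ 1 := fun x hx => (Finset.mem_filter.1 hx).2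
  have hsurj : ∀ x ∈ F, ∃ j, F.orderEmbOfFin hk j = x := by
    intro x hx
    have := Finset.range_orderEmbOfFin F hk
    have hx' : x ∈ Set.range (F.orderEmbOfFin hk) := by rw [this]; exact hx
    exact hx'
  have hmem : ∀ j, F.orderEmbOfFin hk j ∈ F := fun j => Finset.orderEmbOfFin_mem F hk j
  have hmono : StrictMono (F.orderEmbOfFin hk) := (F.orderEmbOfFin hk).strictMono
  refine ⟨k, F.orderEmbOfFin hk, hmono, ?_, ?_, ?_⟩
  · obtain ⟨j, hj⟩ := hsurj 0 h0
    apply le_antisymm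
    · rw [← hj]; exact hmono.monotone (Fin.zero_le j)
    · exact (hF01 _ (hmem _)).1
  · obtain ⟨j, hj⟩ := hsurj 1 h1
    apply le_antisymm
    · exact (hF01 _ (hmem _)).2
    · rw [← hj]; exact hmono.monotone (Fin.le_last j)
  · intro i
    have hlt : F.orderEmbOfFin hk i.castSucc < F.orderEmbOfFin hk i.succ :=
      hmono (Fin.castSucc_lt_succ)
    have hle := (hF01 _ (hmem i.succ)).2
    have hge := (hF01 _ (hmem i.castSucc)).1
    obtain ⟨p, hp, hpx, hpt⟩ := hP (F.orderEmbOfFin hk i.castSucc) ⟨hge, lt_of_lt_of_le hlt hle⟩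
    refine ⟨p.2.2, fun x hx => hpt x (hpx.1.trans hx.1) (lt_of_lt_of_le hx.2 ?_)⟩
    by_contra hcon
    push Not at hcon
    have hpF : p.2.1 ∈ F := by
      rw [hF, Finset.mem_filter]
      refine ⟨?_, by linarith [hpx.2], by linarith⟩
      simp only [Finset.mem_insert, Finset.mem_image]
      exact Or.inr (Or.inr ⟨p, hp, rfl⟩)
    obtain ⟨j, hj⟩ := hsurj _ hpF
    have e1 : i.castSucc < j := hmono.lt_iff_lt.1 (by rw [hj]; exact hpx.2)
    have e2 : j < i.succ := hmono.lt_iff_lt.1 (by rw [hj]; exact hcon)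
    rw [Fin.lt_def] at e1 e2
    simp at e1 e2
    omega

lemma PW.comp {f g : ℝ → ℝ} (hf : PW f) (hg : PW g) (hm : ∀ x ∈ unitI, f x ∈ unitI) :
    PW (g ∘ f) := by
  classical
  obtain ⟨P, hP⟩ := hf
  obtain ⟨Q, hQ⟩ := hg
  refine ⟨(P ×ˢ Q).image (fun z => (max z.1.1 (z.2.1 - z.1.2.2), min z.1.2.1 (z.2.2.1 - z.1.2.2),
    z.1.2.2 + z.2.2.2)), ?_⟩
  intro x hx
  obtain ⟨p, hp, hpx, hpt⟩ := hP x hx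
  obtain ⟨q, hq, hqx, hqt⟩ := hQ (f x) (hm x hx)
  refine ⟨_, Finset.mem_image_of_mem _ (Finset.mk_mem_product hp hq), ?_, ?_⟩
  · rw [hpt x hpx.1 hpx.2] at hqx
    simp only [max_le_iff, lt_min_iff]
    exact ⟨⟨hpx.1, by linarith⟩, hpx.2, by linarith⟩
  · intro y h1 h2
    simp only [max_le_iff, lt_min_iff] at h1 h2
    simp only [Function.comp]
    rw [hpt y h1.1 h2.1, hqt _ (by linarith) (by linarith)]
    ring

lemma PW.inv {f h : ℝ → ℝ} (hf : PW f) (hm : ∀ x ∈ unitI, h x ∈ unitI)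
    (h1 : ∀ x, h (f x) = x) (h2 : ∀ x, f (h x) = x) : PW h := by
  classical
  obtain ⟨P, hP⟩ := hf
  refine ⟨P.image (fun z => (z.1 + z.2.2, z.2.1 + z.2.2, -z.2.2)), ?_⟩
  intro x hx
  obtain ⟨p, hp, hpx, hpt⟩ := hP (h x) (hm x hx)
  have e := hpt _ hpx.1 hpx.2
  rw [h2] at e
  refine ⟨_, Finset.mem_image_of_mem _ hp, ⟨by simp only; linarith, by simp only; linarith⟩, ?_⟩
  intro y hy1 hy2
  simp only at hy1 hy2 ⊢
  have e := hpt (y - p.2.2) (by linarith) (by linarith)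
  rw [sub_add_cancel] at e
  rw [← e, h1, e]; ring

lemma IsIET.maps {T : ℝ → ℝ} (h : IsIET T) : ∀ x ∈ unitI, T x ∈ unitI := fun _ hx => h.1.mapsTo hx

lemma isIET_of_inverse {f h : ℝ → ℝ} (hf : ∀ x ∈ unitI, f x ∈ unitI)
    (hh : ∀ x ∈ unitI, h x ∈ unitI) (ho : ∀ x, x ∉ unitI → f x = x)
    (h1 : ∀ x, h (f x) = x) (h2 : ∀ x, f (h x) = x) (hp : PW f) : IsIET f :=
  isIET_of_pw ⟨fun x hx => hf x hx, fun x _ y _ e => by rw [← h1 x, e, h1],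
    fun x hx => ⟨h x, hh x hx, h2 x⟩⟩ ho hp

lemma IsIET.exists_inv {T : ℝ → ℝ} (hT : IsIET T) :
    ∃ Ti : ℝ → ℝ, IsIET Ti ∧ (∀ x, Ti (T x) = x) ∧ (∀ x, T (Ti x) = x) := by
  have hbij : Function.Bijective T := by
    constructor
    · intro x y e
      by_cases hx : x ∈ unitI <;> by_cases hy : y ∈ unitI
      · exact hT.1.injOn hx hy e
      · exfalso; apply hy; rw [← hT.2.1 y hy, ← e]; exact hT.maps x hx
      · exfalso; apply hx; rw [← hT.2.1 x hx, e]; exact hT.maps y hy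
      · rwa [hT.2.1 x hx, hT.2.1 y hy] at e
    · intro y
      by_cases hy : y ∈ unitI
      · obtain ⟨x, -, hx⟩ := hT.1.surjOn hy
        exact ⟨x, hx⟩
      · exact ⟨y, hT.2.1 y hy⟩
  let e := Equiv.ofBijective T hbij
  have h1 : ∀ x, e.symm (T x) = x := e.symm_apply_apply
  have h2 : ∀ x, T (e.symm x) = x := e.apply_symm_apply
  have hm : ∀ x ∈ unitI, e.symm x ∈ unitI := by
    intro x hx
    by_contra hc
    have := hT.2.1 _ hc
    rw [h2] at this
    exact hc (this ▸ hx)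
  refine ⟨e.symm, isIET_of_inverse hm hT.maps ?_ h2 h1 (hT.pw.inv hm h1 h2), h1, h2⟩
  intro x hx
  conv_lhs => rw [← hT.2.1 x hx]
  exact h1 x

/-- A partition of `[0,1)` into half-open intervals `[a i, a i + l i)`. -/
def Part {ι : Type} (a l : ι → ℝ) : Prop :=
  (∀ i y, a i ≤ y → y < a i + l i → y ∈ unitI) ∧
  (∀ i j y, a i ≤ y → y < a i + l i → a j ≤ y → y < a j + l j → i = j) ∧
  ∀ y ∈ unitI, ∃ i, a i ≤ y ∧ y < a i + l i

lemma Part.sum {ι : Type} [Fintype ι] {a l : ι → ℝ} (h : Part a l) (hl : ∀ i, 0 ≤ l i) :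
    ∑ i, l i = 1 := by
  have hU : (⋃ i, Set.Ico (a i) (a i + l i)) = Set.Ico (0:ℝ) 1 := by
    ext y
    simp only [Set.mem_iUnion]
    constructor
    · rintro ⟨i, hi⟩
      exact h.1 i y hi.1 hi.2
    · intro hy
      exact h.2.2 y hy
  have hd : Pairwise (Function.onFun Disjoint (fun i => Set.Ico (a i) (a i + l i))) := by
    intro i j hij
    rw [Function.onFun, Set.disjoint_left]
    intro y hy hy'
    exact hij (h.2.1 i j y hy.1 hy.2 hy'.1 hy'.2)
  have hv := MeasureTheory.measure_iUnion (μ := MeasureTheory.volume) hd (fun i => measurableSet_Ico)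
  rw [hU, tsum_fintype] at hv
  simp only [Real.volume_Ico, add_sub_cancel_left] at hv
  rw [← ENNReal.ofReal_sum_of_nonneg (fun i _ => hl i)] at hv
  have := (ENNReal.ofReal_eq_ofReal_iff (by norm_num) (Finset.sum_nonneg (fun i _ => hl i))).1 hv
  linarith

open Classical in
/-- Rearrangement of the intervals at `a` to those at `b`. -/
noncomputable def rear {ι : Type} (a b l : ι → ℝ) (y : ℝ) : ℝ :=
  if h : ∃ i, a i ≤ y ∧ y < a i + l i then y + (b h.choose - a h.choose) else y

lemma rear_eq {ι : Type} {a l : ι → ℝ} (b : ι → ℝ) (h : Part a l) (i : ι) (y : ℝ)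
    (h1 : a i ≤ y) (h2 : y < a i + l i) : rear a b l y = y + (b i - a i) := by
  have hex : ∃ i, a i ≤ y ∧ y < a i + l i := ⟨i, h1, h2⟩
  have : hex.choose = i := h.2.1 _ _ y hex.choose_spec.1 hex.choose_spec.2 h1 h2
  rw [rear, dif_pos hex, this]

lemma rear_out {ι : Type} {a l : ι → ℝ} (b : ι → ℝ) (h : Part a l) (y : ℝ)
    (hy : y ∉ unitI) : rear a b l y = y := by
  rw [rear, dif_neg]
  rintro ⟨i, h1, h2⟩
  exact hy (h.1 i y h1 h2)

lemma rear_mem {ι : Type} {a b l : ι → ℝ} (ha : Part a l) (hb : Part b l) (y : ℝ)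
    (hy : y ∈ unitI) : rear a b l y ∈ unitI := by
  obtain ⟨i, h1, h2⟩ := ha.2.2 y hy
  rw [rear_eq b ha i y h1 h2]
  exact hb.1 i _ (by linarith) (by linarith)

lemma rear_rear {ι : Type} {a b l : ι → ℝ} (ha : Part a l) (hb : Part b l) (y : ℝ) :
    rear b a l (rear a b l y) = y := by
  by_cases hy : y ∈ unitI
  · obtain ⟨i, h1, h2⟩ := ha.2.2 y hy
    rw [rear_eq b ha i y h1 h2, rear_eq a hb i _ (by linarith) (by linarith)]
    ring
  · rw [rear_out b ha y hy, rear_out a hb y hy]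

lemma rear_iet {ι : Type} [Fintype ι] {a b l : ι → ℝ} (ha : Part a l) (hb : Part b l) :
    IsIET (rear a b l) := by
  classical
  refine isIET_of_inverse (rear_mem ha hb) (rear_mem hb ha) (rear_out b ha) (rear_rear ha hb)
    (rear_rear hb ha) ⟨Finset.univ.image (fun i => (a i, a i + l i, b i - a i)), ?_⟩
  intro x hx
  obtain ⟨i, hi⟩ := ha.2.2 x hx
  exact ⟨_, Finset.mem_image_of_mem _ (Finset.mem_univ i), hi, fun y h1 h2 => rear_eq b ha i y h1 h2⟩

/-- A tower over a rotation, in unnormalized coordinates: two columns of widths `p`, `q`. -/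
structure Tow (T : ℝ → ℝ) (m n : ℕ) (p q : ℝ) (a b : ℕ → ℝ) : Prop where
  iet : IsIET T
  hm : 0 < m
  hn : 0 < n
  hp : 0 < p
  hq : 0 < q
  part : Part (Sum.elim (fun j : Fin m => a j) (fun j : Fin n => b j))
    (Sum.elim (fun _ => p) (fun _ => q))
  upa : ∀ j, j + 1 < m → ∀ s, 0 ≤ s → s < p → T (a j + s) = a (j + 1) + s
  upb : ∀ j, j + 1 < n → ∀ s, 0 ≤ s → s < q → T (b j + s) = b (j + 1) + s
  taa : ∀ s, 0 ≤ s → s < p → s + q < p → T (a (m - 1) + s) = a 0 + (s + q)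
  tab : ∀ s, 0 ≤ s → s < p → p ≤ s + q → T (a (m - 1) + s) = b 0 + (s + q - p)
  tba : ∀ s, 0 ≤ s → s < q → s < p → T (b (n - 1) + s) = a 0 + s
  tbb : ∀ s, 0 ≤ s → s < q → p ≤ s → T (b (n - 1) + s) = b 0 + (s - p)

lemma Tow.total {T : ℝ → ℝ} {m n : ℕ} {p q : ℝ} {a b : ℕ → ℝ} (h : Tow T m n p q a b) :
    m * p + n * q = 1 := by
  have := h.part.sum (by
    rintro (i | i)
    · exact h.hp.le
    · exact h.hq.le)
  simpa using this

lemma rot_left {S : ℝ → ℝ} {α : ℝ} (hα : α ∈ Set.Ioo (0:ℝ) 1)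
    (h : ∀ x ∈ unitI, S x = Int.fract (x + α)) (x : ℝ) (h0 : 0 ≤ x) (h1 : x < 1 - α) :
    S x = x + α := by
  rw [h x ⟨h0, by linarith [hα.1]⟩, Int.fract_eq_self]
  exact ⟨by linarith [hα.1], by linarith⟩

lemma rot_right {S : ℝ → ℝ} {α : ℝ} (hα : α ∈ Set.Ioo (0:ℝ) 1)
    (h : ∀ x ∈ unitI, S x = Int.fract (x + α)) (x : ℝ) (h0 : 1 - α ≤ x) (h1 : x < 1) :
    S x = x + α - 1 := by
  rw [h x ⟨by linarith [hα.2], h1⟩, Int.fract_eq_iff]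
  exact ⟨by linarith [hα.1], by linarith [hα.2], 1, by push_cast; ring⟩

lemma tow_of_tower {T S : ℝ → ℝ} {m n : ℕ} (hS : IsRotation S) (hT : IsTowerOver T ![m, n] S) :
    ∃ p q a b, Tow T m n p q a b := by
  obtain ⟨-, α, hα, hSα⟩ := hS
  obtain ⟨hI, -, hn, t, c, a, hmono, h0, h1, hc, htr, hsub, hdis, hcov, hup, htop⟩ := hT
  have L := rot_left hα hSα
  have R := rot_right hα hSα
  obtain ⟨hα0, hα1⟩ := hα
  have h1 : t 2 = 1 := h1
  have h01 : t 0 < t 1 := hmono (by decide)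
  have h12 : t 1 < t 2 := hmono (by decide)
  have ht1 : t 1 = 1 - α := by
    apply le_antisymm
    · by_contra hcon
      push Not at hcon
      obtain ⟨d, hd⟩ := htr 0
      simp at hd
      have e1 := hd 0 (by linarith) (by linarith)
      have e2 := hd (1 - α) (by linarith) (by linarith)
      rw [L 0 (by linarith) (by linarith)] at e1
      rw [R (1 - α) (by linarith) (by linarith)] at e2
      linarith
    · by_contra hcon
      push Not at hcon
      obtain ⟨d, hd⟩ := htr 1
      simp at hd
      have hd : ∀ x, t 1 ≤ x → x < t 2 → S x = x + d := hd
      have e1 := hd (t 1) (by linarith) (by linarith)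
      have e2 := hd (1 - α) (by linarith) (by linarith)
      rw [L (t 1) (by linarith) (by linarith)] at e1
      rw [R (1 - α) (by linarith) (by linarith)] at e2
      linarith
  have hp : 0 < c * (1 - α) := mul_pos hc (by linarith)
  have hq : 0 < c * α := mul_pos hc hα0
  have t0c : t (Fin.castSucc (0 : Fin 2)) = 0 := h0
  have t0s : t (Fin.succ (0 : Fin 2)) = 1 - α := ht1
  have t1c : t (Fin.castSucc (1 : Fin 2)) = 1 - α := ht1
  have t1s : t (Fin.succ (1 : Fin 2)) = 1 := h1
  have w1 : (1:ℝ) - (1 - α) = α := by ring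
  have hn0 := hn 0
  have hn1 := hn 1
  have sub0 := hsub 0
  have sub1 := hsub 1
  have up0 := hup 0
  have up1 := hup 1
  have tp00 := fun x hx => htop 0 x hx 0
  have tp01 := fun x hx => htop 0 x hx 1
  have tp10 := fun x hx => htop 1 x hx 0
  have tp11 := fun x hx => htop 1 x hx 1
  have dis00 := hdis 0 0
  have dis01 := hdis 0 1
  have dis11 := hdis 1 1
  simp only [t0c, t0s, t1c, t1s, w1, sub_zero, Matrix.cons_val_zero, Matrix.cons_val_one,
    Set.mem_Ico, Set.disjoint_left] at hn0 hn1 sub0 sub1 up0 up1 tp00 tp01 tp10 tp11 dis00 dis01 dis11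
  have key : ∀ s u : ℝ, 0 ≤ s → s < c * u → 0 ≤ s / c ∧ s / c < u ∧ c * (s / c) = s := by
    intro s u h1 h2
    refine ⟨by positivity, ?_, by field_simp⟩
    rw [div_lt_iff₀ hc]; linarith
  refine ⟨c * (1 - α), c * α, a 0, a 1, hI, hn0, hn1, hp, hq, ⟨?_, ?_, ?_⟩, ?_, ?_, ?_, ?_, ?_, ?_⟩
  · rintro (i | i) y
    · intro h1 h2; exact sub0 i i.2 ⟨h1, h2⟩
    · intro h1 h2; exact sub1 i i.2 ⟨h1, h2⟩
  · rintro (i | i) (j | j) y h1 h2 h3 h4 <;> simp only [Sum.elim_inl, Sum.elim_inr] at h1 h2 h3 h4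
    · by_contra hne
      exact dis00 i j i.2 j.2 (by intro e; apply hne; simp at e; rw [Fin.ext e]) ⟨h1, h2⟩ ⟨h3, h4⟩
    · exact absurd ⟨h3, h4⟩ (dis01 i j i.2 j.2 (by simp) ⟨h1, h2⟩)
    · exact absurd ⟨h1, h2⟩ (dis01 j i j.2 i.2 (by simp) ⟨h3, h4⟩)
    · by_contra hne
      exact dis11 i j i.2 j.2 (by intro e; apply hne; simp at e; rw [Fin.ext e]) ⟨h1, h2⟩ ⟨h3, h4⟩
  · intro y hy
    obtain ⟨i, j, hj, hyj⟩ := hcov y hy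
    fin_cases i
    · refine ⟨Sum.inl ⟨j, hj⟩, ?_⟩
      have e : t (Fin.succ (0 : Fin 2)) - t (Fin.castSucc (0 : Fin 2)) = 1 - α := by
        rw [t0s, t0c]; ring
      have hyj : y ∈ Set.Ico (a 0 j) (a 0 j + c * (t (Fin.succ (0 : Fin 2)) - t (Fin.castSucc (0 : Fin 2)))) := hyj
      rw [e] at hyj
      exact hyj
    · refine ⟨Sum.inr ⟨j, hj⟩, ?_⟩
      have e : t (Fin.succ (1 : Fin 2)) - t (Fin.castSucc (1 : Fin 2)) = α := by
        rw [t1s, t1c]; ring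
      have hyj : y ∈ Set.Ico (a 1 j) (a 1 j + c * (t (Fin.succ (1 : Fin 2)) - t (Fin.castSucc (1 : Fin 2)))) := hyj
      rw [e] at hyj
      exact hyj
  · intro j hj s hs0 hs1
    obtain ⟨k1, k2, k3⟩ := key s _ hs0 hs1
    have := up0 j hj (s / c) ⟨k1, k2⟩
    rwa [k3] at this
  · intro j hj s hs0 hs1
    obtain ⟨k1, k2, k3⟩ := key s _ hs0 hs1
    have := up1 j hj (s / c + (1 - α)) ⟨by linarith, by linarith⟩
    rwa [add_sub_cancel_right, k3] at this
  · intro s hs0 hs1 hs2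
    obtain ⟨k1, k2, k3⟩ := key s _ hs0 hs1
    have h3 : s / c + α < 1 - α := by
      have : c * (s / c + α) < c * (1 - α) := by rw [mul_add, k3]; exact hs2
      exact lt_of_mul_lt_mul_left this hc.le
    have := tp00 (s / c) ⟨k1, k2⟩
    rw [L _ k1 k2, k3, mul_add, k3] at this
    exact this ⟨by linarith, h3⟩
  · intro s hs0 hs1 hs2
    obtain ⟨k1, k2, k3⟩ := key s _ hs0 hs1
    have h3 : 1 - α ≤ s / c + α := by
      have : c * (1 - α) ≤ c * (s / c + α) := by rw [mul_add, k3]; exact hs2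
      exact le_of_mul_le_mul_left this hc
    have := tp01 (s / c) ⟨k1, k2⟩
    rw [L _ k1 k2, k3, mul_sub, mul_add, k3] at this
    exact this ⟨by linarith, by linarith⟩
  · intro s hs0 hs1 hs2
    obtain ⟨k1, k2, k3⟩ := key s _ hs0 hs1
    obtain ⟨-, k4, -⟩ := key s _ hs0 hs2
    have := tp10 (s / c + (1 - α)) ⟨by linarith, by linarith⟩
    rw [R _ (by linarith) (by linarith), add_sub_cancel_right, k3,
      show s / c + (1 - α) + α - 1 = s / c by ring, k3] at this
    exact this ⟨k1, k4⟩
  · intro s hs0 hs1 hs2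
    obtain ⟨k1, k2, k3⟩ := key s _ hs0 hs1
    have k4 : 1 - α ≤ s / c := by
      rw [← k3] at hs2
      exact le_of_mul_le_mul_left hs2 hc
    have := tp11 (s / c + (1 - α)) ⟨by linarith, by linarith⟩
    rw [R _ (by linarith) (by linarith), add_sub_cancel_right, k3,
      show s / c + (1 - α) + α - 1 = s / c by ring, mul_sub, k3] at this
    exact this ⟨k4, by linarith⟩

/-- The standard rotation by `α`. -/
noncomputable def rotn (α x : ℝ) : ℝ :=
  if 0 ≤ x ∧ x < 1 - α then x + α else if 1 - α ≤ x ∧ x < 1 then x + α - 1 else x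

lemma rotn_inv {α : ℝ} (h0 : 0 < α) (h1 : α < 1) (x : ℝ) : rotn (1 - α) (rotn α x) = x := by
  unfold rotn
  split_ifs <;> grind

lemma rotn_mem {α : ℝ} (h0 : 0 < α) (h1 : α < 1) (x : ℝ) (hx : x ∈ unitI) :
    rotn α x ∈ unitI := by
  obtain ⟨hx0, hx1⟩ := hx
  unfold rotn
  split_ifs <;> constructor <;> grind

lemma rotn_rot {α : ℝ} (h0 : 0 < α) (h1 : α < 1) : IsRotation (rotn α) := by
  refine ⟨fun x hx => ?_, α, ⟨h0, h1⟩, fun x hx => ?_⟩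
  · unfold rotn
    rw [if_neg, if_neg]
    · rintro ⟨a, b⟩; exact hx ⟨by linarith, b⟩
    · rintro ⟨a, b⟩; exact hx ⟨a, by linarith⟩
  · obtain ⟨hx0, hx1⟩ := hx
    symm
    unfold rotn
    by_cases h : x < 1 - α
    · rw [if_pos ⟨hx0, h⟩, Int.fract_eq_self]
      exact ⟨by linarith, by linarith⟩
    · rw [if_neg (fun hh => h hh.2), if_pos ⟨not_lt.1 h, hx1⟩, Int.fract_eq_iff]
      exact ⟨by linarith, by linarith, 1, by push_cast; ring⟩

lemma rotn_iet {α : ℝ} (h0 : 0 < α) (h1 : α < 1) : IsIET (rotn α) := by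
  classical
  refine isIET_of_inverse (rotn_mem h0 h1) (rotn_mem (α := 1 - α) (by linarith) (by linarith))
    (rotn_rot h0 h1).1 (rotn_inv h0 h1) ?_ ?_
  · intro x
    have := rotn_inv (α := 1 - α) (by linarith) (by linarith) x
    rwa [sub_sub_cancel] at this
  · refine ⟨{(0, 1 - α, α), (1 - α, 1, α - 1)}, fun x hx => ?_⟩
    obtain ⟨hx0, hx1⟩ := hx
    by_cases h : x < 1 - α
    · refine ⟨(0, 1 - α, α), by simp, ⟨hx0, h⟩, fun y hy0 hy1 => ?_⟩
      simp only at hy0 hy1 ⊢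
      rw [rotn, if_pos ⟨hy0, hy1⟩]
    · refine ⟨(1 - α, 1, α - 1), by simp, ⟨not_lt.1 h, hx1⟩, fun y hy0 hy1 => ?_⟩
      simp only at hy0 hy1 ⊢
      rw [rotn, if_neg (fun hh => absurd hh.2 (not_lt.2 hy0)), if_pos ⟨hy0, hy1⟩]
      ring

lemma Tow.tower {T : ℝ → ℝ} {m n : ℕ} {p q : ℝ} {a b : ℕ → ℝ} (h : Tow T m n p q a b) :
    ∃ R, IsRotation R ∧ IsTowerOver T ![m, n] R := by
  have hp := h.hp
  have hq := h.hq
  have hpq : 0 < p + q := by linarith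
  obtain ⟨α, hα⟩ : ∃ α, α = q / (p + q) := ⟨_, rfl⟩
  have hcα : (p + q) * α = q := by rw [hα]; field_simp
  have hcα' : (p + q) * (1 - α) = p := by rw [mul_sub, hcα]; ring
  have h0 : 0 < α := by rw [hα]; positivity
  have h1 : α < 1 := by rw [hα, div_lt_one hpq]; linarith
  refine ⟨rotn α, rotn_rot h0 h1, h.iet, rotn_iet h0 h1, ?_, ![0, 1 - α, 1], p + q, ![a, b], ?_⟩
  · intro i; fin_cases i
    · exact h.hm
    · exact h.hn
  have L : ∀ x, 0 ≤ x → x < 1 - α → rotn α x = x + α := by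
    intro x hx0 hx1; rw [rotn, if_pos ⟨hx0, hx1⟩]
  have R : ∀ x, 1 - α ≤ x → x < 1 → rotn α x = x + α - 1 := by
    intro x hx0 hx1
    rw [rotn, if_neg (fun hh => absurd hh.2 (not_lt.2 hx0)), if_pos ⟨hx0, hx1⟩]
  have w1 : (1:ℝ) - (1 - α) = α := by ring
  have K1 : ∀ x y : ℝ, x < y → (p + q) * x < (p + q) * y := fun x y h => mul_lt_mul_of_pos_left h hpq
  have K2 : ∀ x y : ℝ, x ≤ y → (p + q) * x ≤ (p + q) * y :=
    fun x y h => mul_le_mul_of_nonneg_left h hpq.le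
  obtain ⟨P1, P2, P3⟩ := h.part
  refine ⟨?_, rfl, rfl, hpq, ?_, ?_, ?_, ?_, ?_, ?_⟩
  · rw [Fin.strictMono_iff_lt_succ]
    intro i; fin_cases i
    · show (0:ℝ) < 1 - α
      linarith
    · show 1 - α < (1:ℝ)
      linarith
  · intro i; fin_cases i
    · exact ⟨α, fun x hx => L x hx.1 hx.2⟩
    · exact ⟨α - 1, fun x hx => by rw [R x hx.1 hx.2]; ring⟩
  · intro i j hj; fin_cases i
    · show Set.Ico (a j) (a j + (p + q) * (1 - α - 0)) ⊆ unitI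
      rw [sub_zero, hcα']
      exact fun y hy => P1 (Sum.inl ⟨j, hj⟩) y hy.1 hy.2
    · show Set.Ico (b j) (b j + (p + q) * (1 - (1 - α))) ⊆ unitI
      rw [w1, hcα]
      exact fun y hy => P1 (Sum.inr ⟨j, hj⟩) y hy.1 hy.2
  · intro i i' j j' hj hj' hne
    rw [Set.disjoint_left]
    intro y
    fin_cases i <;> fin_cases i'
    · show y ∈ Set.Ico (a j) (a j + (p + q) * (1 - α - 0)) →
        y ∉ Set.Ico (a j') (a j' + (p + q) * (1 - α - 0))
      rw [sub_zero, hcα']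
      intro e1 e2
      have := P2 (Sum.inl ⟨j, hj⟩) (Sum.inl ⟨j', hj'⟩) y e1.1 e1.2 e2.1 e2.2
      have := congrArg (Sum.elim (fun z : Fin m => (z:ℕ)) (fun z : Fin n => (z:ℕ))) this
      simp only [Sum.elim_inl, Sum.elim_inr] at this
      exact hne (by rw [this])
    · show y ∈ Set.Ico (a j) (a j + (p + q) * (1 - α - 0)) →
        y ∉ Set.Ico (b j') (b j' + (p + q) * (1 - (1 - α)))
      rw [sub_zero, hcα', w1, hcα]
      intro e1 e2
      have := P2 (Sum.inl ⟨j, hj⟩) (Sum.inr ⟨j', hj'⟩) y e1.1 e1.2 e2.1 e2.2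
      simp at this
    · show y ∈ Set.Ico (b j) (b j + (p + q) * (1 - (1 - α))) →
        y ∉ Set.Ico (a j') (a j' + (p + q) * (1 - α - 0))
      rw [sub_zero, hcα', w1, hcα]
      intro e1 e2
      have := P2 (Sum.inr ⟨j, hj⟩) (Sum.inl ⟨j', hj'⟩) y e1.1 e1.2 e2.1 e2.2
      simp at this
    · show y ∈ Set.Ico (b j) (b j + (p + q) * (1 - (1 - α))) →
        y ∉ Set.Ico (b j') (b j' + (p + q) * (1 - (1 - α)))
      rw [w1, hcα]
      intro e1 e2
      have := P2 (Sum.inr ⟨j, hj⟩) (Sum.inr ⟨j', hj'⟩) y e1.1 e1.2 e2.1 e2.2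
      have := congrArg (Sum.elim (fun z : Fin m => (z:ℕ)) (fun z : Fin n => (z:ℕ))) this
      simp only [Sum.elim_inl, Sum.elim_inr] at this
      exact hne (by rw [this])
  · intro y hy
    obtain ⟨i | i, h1, h2⟩ := P3 y hy
    · refine ⟨0, i, i.2, ?_⟩
      show y ∈ Set.Ico (a i) (a i + (p + q) * (1 - α - 0))
      rw [sub_zero, hcα']
      exact ⟨h1, h2⟩
    · refine ⟨1, i, i.2, ?_⟩
      show y ∈ Set.Ico (b i) (b i + (p + q) * (1 - (1 - α)))
      rw [w1, hcα]
      exact ⟨h1, h2⟩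
  · intro i j hj x hx; fin_cases i
    · have hx0 : 0 ≤ x := hx.1
      have hx1 : x < 1 - α := hx.2
      show T (a j + (p + q) * (x - 0)) = a (j + 1) + (p + q) * (x - 0)
      rw [sub_zero]
      exact h.upa j hj _ (by positivity) (by linarith [K1 _ _ hx1])
    · have hx0 : 1 - α ≤ x := hx.1
      have hx1 : x < 1 := hx.2
      show T (b j + (p + q) * (x - (1 - α))) = b (j + 1) + (p + q) * (x - (1 - α))
      exact h.upb j hj _ (by linarith [K2 _ _ hx0]) (by linarith [K1 _ _ hx1])
  · intro i x hx i' hx'; fin_cases i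
    · have hx0 : 0 ≤ x := hx.1
      have hx1 : x < 1 - α := hx.2
      have e := L x hx0 hx1
      have := K1 _ _ hx1
      have : 0 ≤ (p + q) * x := by positivity
      fin_cases i'
      · have hx2 : rotn α x < 1 - α := hx'.2
        rw [e] at hx2
        have := K1 _ _ hx2
        show T (a (m - 1) + (p + q) * (x - 0)) = a 0 + (p + q) * (rotn α x - 0)
        rw [sub_zero, h.taa _ (by linarith) (by linarith) (by linarith), e, sub_zero, mul_add, hcα]
      · have hx2 : 1 - α ≤ rotn α x := hx'.1
        rw [e] at hx2
        have := K2 _ _ hx2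
        show T (a (m - 1) + (p + q) * (x - 0)) = b 0 + (p + q) * (rotn α x - (1 - α))
        rw [sub_zero, h.tab _ (by linarith) (by linarith) (by linarith), e, mul_sub, hcα',
          mul_add, hcα]
    · have hx0 : 1 - α ≤ x := hx.1
      have hx1 : x < 1 := hx.2
      have e := R x hx0 hx1
      have := K1 _ _ hx1
      have := K2 _ _ hx0
      fin_cases i'
      · have hx2 : rotn α x < 1 - α := hx'.2
        rw [e] at hx2
        have := K1 _ _ hx2
        show T (b (n - 1) + (p + q) * (x - (1 - α))) = a 0 + (p + q) * (rotn α x - 0)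
        rw [h.tba _ (by linarith) (by linarith) (by linarith), e]
        ring
      · have hx2 : 1 - α ≤ rotn α x := hx'.1
        rw [e] at hx2
        have := K2 _ _ hx2
        show T (b (n - 1) + (p + q) * (x - (1 - α))) = b 0 + (p + q) * (rotn α x - (1 - α))
        rw [h.tbb _ (by linarith) (by linarith) (by linarith), e]
        linear_combination hcα'

lemma Tow.inv {T Ti : ℝ → ℝ} {m n : ℕ} {p q : ℝ} {a b : ℕ → ℝ} (h : Tow T m n p q a b)
    (hi : IsIET Ti) (h1 : ∀ x, Ti (T x) = x) :
    Tow Ti n m q p (fun j => b (n - 1 - j)) (fun j => a (m - 1 - j)) := by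
  have hm := h.hm
  have hn := h.hn
  have key : ∀ x y, T x = y → Ti y = x := by rintro x _ rfl; exact h1 x
  obtain ⟨P1, P2, P3⟩ := h.part
  refine ⟨hi, h.hn, h.hm, h.hq, h.hp, ⟨?_, ?_, ?_⟩, ?_, ?_, ?_, ?_, ?_, ?_⟩
  · rintro (i | i) y
    · exact P1 (Sum.inr ⟨n - 1 - i, by omega⟩) y
    · exact P1 (Sum.inl ⟨m - 1 - i, by omega⟩) y
  · rintro (i | i) (j | j) y e1 e2 e3 e4
    · have := P2 (Sum.inr ⟨n - 1 - i, by omega⟩) (Sum.inr ⟨n - 1 - j, by omega⟩) y e1 e2 e3 e4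
      simp at this
      rw [show i = j by ext; omega]
    · have := P2 (Sum.inr ⟨n - 1 - i, by omega⟩) (Sum.inl ⟨m - 1 - j, by omega⟩) y e1 e2 e3 e4
      simp at this
    · have := P2 (Sum.inl ⟨m - 1 - i, by omega⟩) (Sum.inr ⟨n - 1 - j, by omega⟩) y e1 e2 e3 e4
      simp at this
    · have := P2 (Sum.inl ⟨m - 1 - i, by omega⟩) (Sum.inl ⟨m - 1 - j, by omega⟩) y e1 e2 e3 e4
      simp at this
      rw [show i = j by ext; omega]
  · intro y hy
    obtain ⟨i | i, e1, e2⟩ := P3 y hy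
    · refine ⟨Sum.inr ⟨m - 1 - i, by omega⟩, ?_⟩
      simp only [Sum.elim_inl, Sum.elim_inr] at e1 e2 ⊢
      rw [show m - 1 - (m - 1 - (i:ℕ)) = i by omega]
      exact ⟨e1, e2⟩
    · refine ⟨Sum.inl ⟨n - 1 - i, by omega⟩, ?_⟩
      simp only [Sum.elim_inl, Sum.elim_inr] at e1 e2 ⊢
      rw [show n - 1 - (n - 1 - (i:ℕ)) = i by omega]
      exact ⟨e1, e2⟩
  · intro j hj s hs0 hs1
    apply key
    have := h.upb (n - 1 - (j + 1)) (by omega) s hs0 hs1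
    rwa [show n - 1 - (j + 1) + 1 = n - 1 - j by omega] at this
  · intro j hj s hs0 hs1
    apply key
    have := h.upa (m - 1 - (j + 1)) (by omega) s hs0 hs1
    rwa [show m - 1 - (j + 1) + 1 = m - 1 - j by omega] at this
  · intro s hs0 hs1 hs2
    apply key
    simp only [Nat.sub_self, Nat.sub_zero]
    rw [h.tbb _ (by linarith [h.hp]) hs2 (by linarith)]
    ring
  · intro s hs0 hs1 hs2
    apply key
    simp only [Nat.sub_self, Nat.sub_zero]
    rw [h.tab _ (by linarith [h.hp]) (by linarith) (by linarith)]
    ring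
  · intro s hs0 hs1 hs2
    apply key
    simp only [Nat.sub_self, Nat.sub_zero]
    rw [h.tba _ hs0 hs2 hs1]
  · intro s hs0 hs1 hs2
    apply key
    simp only [Nat.sub_self, Nat.sub_zero]
    rw [h.taa _ (by linarith) (by linarith [h.hq]) (by linarith)]
    ring

lemma level_unique {w y : ℝ} (hw : 0 < w) {i j : ℕ} (h1 : w * i ≤ y) (h2 : y < w * i + w)
    (h3 : w * j ≤ y) (h4 : y < w * j + w) : i = j := by
  have a1 : w * (i:ℝ) < w * ((j + 1 : ℕ) : ℝ) := by push_cast; linarith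
  have a2 : w * (j:ℝ) < w * ((i + 1 : ℕ) : ℝ) := by push_cast; linarith
  have b1 := Nat.cast_lt.1 (lt_of_mul_lt_mul_left a1 hw.le)
  have b2 := Nat.cast_lt.1 (lt_of_mul_lt_mul_left a2 hw.le)
  omega

lemma level_exists {w y : ℝ} (hw : 0 < w) (n : ℕ) (h1 : 0 ≤ y) (h2 : y < w * n) :
    ∃ j, j < n ∧ w * j ≤ y ∧ y < w * j + w := by
  refine ⟨⌊y / w⌋₊, ?_, ?_, ?_⟩
  · rw [Nat.floor_lt (by positivity), div_lt_iff₀ hw]; linarith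
  · have := Nat.floor_le (a := y / w) (by positivity)
    rw [le_div_iff₀ hw] at this; linarith
  · have := Nat.lt_floor_add_one (y / w)
    rw [div_lt_iff₀ hw] at this; linarith

lemma level_le {w : ℝ} (hw : 0 < w) {j n : ℕ} (h : j < n) : w * j + w ≤ w * n := by
  have : ((j + 1 : ℕ) : ℝ) ≤ n := Nat.cast_le.2 h
  push_cast at this
  nlinarith

/-- The standard layout of a tower. -/
lemma part_std {m n : ℕ} {p q : ℝ} (hp : 0 < p) (hq : 0 < q) (ht : p * m + q * n = 1) :
    Part (Sum.elim (fun j : Fin m => p * (j:ℕ)) (fun j : Fin n => p * m + q * (j:ℕ)))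
      (Sum.elim (fun _ => p) (fun _ => q)) := by
  have hpm : 0 ≤ p * m := by positivity
  have hqn : 0 ≤ q * n := by positivity
  refine ⟨?_, ?_, ?_⟩
  · rintro (i | i) y h1 h2 <;> simp only [Sum.elim_inl, Sum.elim_inr] at h1 h2
    · have := level_le hp i.2
      have : 0 ≤ p * (i:ℕ) := by positivity
      exact ⟨by linarith, by linarith⟩
    · have := level_le hq i.2
      have : 0 ≤ q * (i:ℕ) := by positivity
      exact ⟨by linarith, by linarith⟩
  · rintro (i | i) (j | j) y h1 h2 h3 h4 <;> simp only [Sum.elim_inl, Sum.elim_inr] at h1 h2 h3 h4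
    · exact congrArg Sum.inl (Fin.ext (level_unique hp h1 h2 h3 h4))
    · have := level_le hp i.2
      have : 0 ≤ q * (j:ℕ) := by positivity
      linarith
    · have := level_le hp j.2
      have : 0 ≤ q * (i:ℕ) := by positivity
      linarith
    · exact congrArg Sum.inr (Fin.ext (level_unique (y := y - p * m) hq (by linarith)
        (by linarith) (by linarith) (by linarith)))
  · rintro y ⟨hy0, hy1⟩
    by_cases h : y < p * m
    · obtain ⟨j, hj, h1, h2⟩ := level_exists hp m hy0 h
      exact ⟨Sum.inl ⟨j, hj⟩, h1, h2⟩
    · obtain ⟨j, hj, h1, h2⟩ := level_exists (y := y - p * m) hq n (by linarith) (by linarith)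
      exact ⟨Sum.inr ⟨j, hj⟩, by simp only [Sum.elim_inr]; linarith,
        by simp only [Sum.elim_inr]; linarith⟩

lemma Tow.reduce {T : ℝ → ℝ} {m n : ℕ} {p q : ℝ} {a b : ℕ → ℝ} (h : Tow T m n p q a b)
    (hmn : m < n) : ∃ T' a' b', Tow T' m (n - m) (p + q) q a' b' ∧ IsConjugate T T' := by
  have hp := h.hp
  have hq := h.hq
  have hm := h.hm
  have hpq : 0 < p + q := by linarith
  have htot := h.total
  obtain ⟨k, rfl⟩ : ∃ k, n = m + k := ⟨n - m, by omega⟩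
  rw [Nat.add_sub_cancel_left]
  have hk : 0 < k := by omega
  push_cast at htot
  have hstd := part_std (m := m) (n := k) hpq hq (by linarith)
  obtain ⟨Q1, Q2, Q3⟩ := hstd
  -- refined layout
  let B2 : ℕ → ℝ := fun j => if j < m then (p + q) * j + p else (p + q) * m + q * ((j - m : ℕ) : ℝ)
  let B : Fin m ⊕ Fin (m + k) → ℝ := Sum.elim (fun j => (p + q) * (j:ℕ)) (fun j => B2 j)
  have hB2 : ∀ j, j < m → B2 j = (p + q) * j + p := fun j hj => if_pos hj
  have hB2' : ∀ j, B2 (m + j) = (p + q) * m + q * j := by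
    intro j
    simp only [B2]
    rw [if_neg (by omega), Nat.add_sub_cancel_left]
  have hB : Part B (Sum.elim (fun _ => p) (fun _ => q)) := by
    -- classification of the refined levels
    have cl : ∀ i y, B i ≤ y → y < B i + Sum.elim (fun _ : Fin m => p) (fun _ : Fin (m + k) => q) i →
        (∃ j : Fin m, i = Sum.inl j ∧ (p + q) * (j:ℕ) ≤ y ∧ y < (p + q) * (j:ℕ) + p) ∨
        (∃ j : Fin m, i = Sum.inr ⟨j, by omega⟩ ∧ (p + q) * (j:ℕ) + p ≤ y ∧
          y < (p + q) * (j:ℕ) + (p + q)) ∨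
        (∃ j : Fin k, i = Sum.inr ⟨m + j, by omega⟩ ∧ (p + q) * m + q * (j:ℕ) ≤ y ∧
          y < (p + q) * m + q * (j:ℕ) + q) := by
      rintro (i | ⟨i, hi⟩) y h1 h2 <;> simp only [B, Sum.elim_inl, Sum.elim_inr] at h1 h2
      · exact Or.inl ⟨i, rfl, h1, h2⟩
      · by_cases him : i < m
        · rw [hB2 i him] at h1 h2
          exact Or.inr (Or.inl ⟨⟨i, him⟩, rfl, h1, by simp only; linarith⟩)
        · obtain ⟨r, rfl⟩ : ∃ r, i = m + r := ⟨i - m, by omega⟩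
          rw [hB2' r] at h1 h2
          exact Or.inr (Or.inr ⟨⟨r, by omega⟩, rfl, h1, h2⟩)
    have Qa : ∀ (i j : Fin m) y, (p + q) * (i:ℕ) ≤ y → y < (p + q) * (i:ℕ) + (p + q) →
        (p + q) * (j:ℕ) ≤ y → y < (p + q) * (j:ℕ) + (p + q) → i = j := fun i j y h1 h2 h3 h4 =>
      Fin.ext (level_unique hpq h1 h2 h3 h4)
    have Qc : ∀ (i : Fin m) (j : Fin k) y, y < (p + q) * (i:ℕ) + (p + q) →
        (p + q) * m + q * (j:ℕ) ≤ y → False := fun i j y h1 h2 => by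
      have := level_le hpq i.2
      have : 0 ≤ q * (j:ℕ) := by positivity
      linarith
    refine ⟨?_, ?_, ?_⟩
    · intro i y h1 h2
      rcases cl i y h1 h2 with ⟨j, -, h3, h4⟩ | ⟨j, -, h3, h4⟩ | ⟨j, -, h3, h4⟩
      · exact Q1 (Sum.inl j) y h3 (by simp only [Sum.elim_inl]; linarith)
      · exact Q1 (Sum.inl j) y (by simp only [Sum.elim_inl]; linarith) h4
      · exact Q1 (Sum.inr j) y h3 h4
    · intro i i' y h1 h2 h1' h2'
      rcases cl i y h1 h2 with ⟨j, rfl, h3, h4⟩ | ⟨j, rfl, h3, h4⟩ | ⟨j, rfl, h3, h4⟩ <;>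
      rcases cl i' y h1' h2' with ⟨j', rfl, h5, h6⟩ | ⟨j', rfl, h5, h6⟩ | ⟨j', rfl, h5, h6⟩
      · rw [Qa j j' y (by linarith) (by linarith) (by linarith) (by linarith)]
      · have := Qa j j' y (by linarith) (by linarith) (by linarith) (by linarith)
        subst this; linarith
      · exact (Qc j j' y (by linarith) h5).elim
      · have := Qa j j' y (by linarith) (by linarith) (by linarith) (by linarith)
        subst this; linarith
      · rw [Qa j j' y (by linarith) (by linarith) (by linarith) (by linarith)]
      · exact (Qc j j' y (by linarith) h5).elim
      · exact (Qc j' j y (by linarith) h3).elim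
      · exact (Qc j' j y (by linarith) h3).elim
      · have := Q2 (Sum.inr j) (Sum.inr j') y h3 h4 h5 h6
        simp only [Sum.inr.injEq] at this
        rw [this]
    · intro y hy
      obtain ⟨j | j, h1, h2⟩ := Q3 y hy <;> simp only [Sum.elim_inl, Sum.elim_inr] at h1 h2
      · by_cases hy' : y < (p + q) * (j:ℕ) + p
        · exact ⟨Sum.inl j, h1, hy'⟩
        · refine ⟨Sum.inr ⟨j, by omega⟩, ?_⟩
          simp only [B, Sum.elim_inr]
          rw [hB2 j j.2]
          exact ⟨by linarith, by linarith⟩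
      · refine ⟨Sum.inr ⟨m + j, by omega⟩, ?_⟩
        simp only [B, Sum.elim_inr]
        rw [hB2' j]
        exact ⟨h1, h2⟩
  have hA := h.part
  set A : Fin m ⊕ Fin (m + k) → ℝ := Sum.elim (fun j : Fin m => a j) (fun j : Fin (m + k) => b j)
    with hAdef
  set l : Fin m ⊕ Fin (m + k) → ℝ := Sum.elim (fun _ => p) (fun _ => q) with hl
  set g := rear A B l with hg
  set f := rear B A l with hf
  have hgI : IsIET g := rear_iet hA hB
  have hfI : IsIET f := rear_iet hB hA
  have hfg : ∀ x, f (g x) = x := rear_rear hA hB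
  have hgf : ∀ x, g (f x) = x := rear_rear hB hA
  have ga : ∀ j, j < m → ∀ s, 0 ≤ s → s < p → g (a j + s) = (p + q) * j + s := by
    intro j hj s hs0 hs1
    have := rear_eq B hA (Sum.inl ⟨j, hj⟩) (a j + s) (by simp [hAdef, hs0])
      (by simp [hAdef, hl, hs1])
    rw [hg, this]
    simp only [hAdef, B, Sum.elim_inl]; ring
  have gb1 : ∀ j, j < m → ∀ s, 0 ≤ s → s < q → g (b j + s) = (p + q) * j + (p + s) := by
    intro j hj s hs0 hs1
    have := rear_eq B hA (Sum.inr ⟨j, by omega⟩) (b j + s) (by simp [hAdef, hs0])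
      (by simp [hAdef, hl, hs1])
    rw [hg, this]
    simp only [hAdef, B, Sum.elim_inr]
    rw [hB2 j hj]; ring
  have gb2 : ∀ j, j < k → ∀ s, 0 ≤ s → s < q →
      g (b (m + j) + s) = (p + q) * m + q * j + s := by
    intro j hj s hs0 hs1
    have := rear_eq B hA (Sum.inr ⟨m + j, by omega⟩) (b (m + j) + s) (by simp [hAdef, hs0])
      (by simp [hAdef, hl, hs1])
    rw [hg, this]
    simp only [hAdef, B, Sum.elim_inr]
    rw [hB2' j]; ring
  have fkey : ∀ x y, g x = y → f y = x := by rintro x _ rfl; exact hfg x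
  refine ⟨g ∘ T ∘ f, fun j => (p + q) * j, fun j => (p + q) * m + q * j, ?_, g, hgI, ?_⟩
  swap
  · funext x
    simp only [Function.comp, hfg]
  obtain ⟨Ti, hTi, hTi1, hTi2⟩ := h.iet.exists_inv
  have hT'I : IsIET (g ∘ T ∘ f) := by
    refine isIET_of_inverse (h := g ∘ Ti ∘ f) ?_ ?_ ?_ ?_ ?_ ?_
    · exact fun x hx => hgI.maps _ (h.iet.maps _ (hfI.maps x hx))
    · exact fun x hx => hgI.maps _ (hTi.maps _ (hfI.maps x hx))
    · intro x hx
      simp only [Function.comp]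
      rw [hfI.2.1 x hx, h.iet.2.1 x hx, hgI.2.1 x hx]
    · intro x; simp only [Function.comp, hfg, hTi1, hgf]
    · intro x; simp only [Function.comp, hfg, hTi2, hgf]
    · exact (hfI.pw.comp h.iet.pw hfI.maps).comp hgI.pw
        (fun x hx => h.iet.maps _ (hfI.maps x hx))
  have step : ∀ x y z w, g x = y → T x = z → g z = w → (g ∘ T ∘ f) y = w := by
    rintro x _ _ _ rfl rfl rfl
    simp only [Function.comp, hfg]
  refine ⟨hT'I, hm, hk, hpq, hq, ⟨Q1, Q2, Q3⟩, ?_, ?_, ?_, ?_, ?_, ?_⟩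
  · intro j hj s hs0 hs1
    by_cases hs : s < p
    · exact step _ _ _ _ (ga j (by omega) s hs0 hs) (h.upa j hj s hs0 hs)
        (ga (j + 1) hj s hs0 hs)
    · have hs' : p + (s - p) = s := by ring
      have e1 := gb1 j (by omega) (s - p) (by linarith) (by linarith)
      have e2 := gb1 (j + 1) (by omega) (s - p) (by linarith) (by linarith)
      rw [hs'] at e1 e2
      exact step _ _ _ _ e1 (h.upb j (by omega) (s - p) (by linarith) (by linarith)) e2
  · intro j hj s hs0 hs1
    exact step _ _ _ _ (gb2 j (by omega) s hs0 hs1) (h.upb (m + j) (by omega) s hs0 hs1)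
      (gb2 (j + 1) hj s hs0 hs1)
  · intro s hs0 hs1 hs2
    have hs : s < p := by linarith
    have e1 := ga (m - 1) (by omega) s hs0 hs
    by_cases hsq : s + q < p
    · exact step _ _ _ _ e1 (h.taa s hs0 hs hsq) (ga 0 hm _ (by linarith) hsq)
    · have e3 := gb1 0 hm (s + q - p) (by linarith) (by linarith)
      rw [show p + (s + q - p) = s + q by ring] at e3
      exact step _ _ _ _ e1 (h.tab s hs0 hs (by linarith)) e3
  · intro s hs0 hs1 hs2
    have e1 := gb1 (m - 1) (by omega) (s - p) (by linarith) (by linarith)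
    rw [show p + (s - p) = s by ring] at e1
    have e2 := h.upb (m - 1) (by omega) (s - p) (by linarith) (by linarith)
    rw [show m - 1 + 1 = m + 0 by omega] at e2
    have e3 := gb2 0 hk (s - p) (by linarith) (by linarith)
    rw [show s + q - (p + q) = s - p by ring]
    exact step _ _ _ _ e1 e2 e3
  · intro s hs0 hs1 hs2
    have e1 := gb2 (k - 1) (by omega) s hs0 hs1
    rw [show m + (k - 1) = m + k - 1 by omega] at e1
    by_cases hs : s < p
    · exact step _ _ _ _ e1 (h.tba s hs0 hs1 hs) (ga 0 hm s hs0 hs)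
    · have e3 := gb1 0 hm (s - p) (by linarith) (by linarith)
      rw [show p + (s - p) = s by ring] at e3
      exact step _ _ _ _ e1 (h.tbb s hs0 hs1 (by linarith)) e3
  · intro s hs0 hs1 hs2
    linarith

theorem stmt10 (T S : ℝ → ℝ) (m1 m2 : ℕ)
    (hS : IsRotation S) (hT : IsTowerOver T ![m1, m2] S) :
    (m1 < m2 →
      (∃ (R T' : ℝ → ℝ), IsRotation R ∧
        IsTowerOver T' ![m1, m2 - m1] R ∧ IsConjugate T T') ∨
      (∃ (Ti R T' : ℝ → ℝ), (∀ x, Ti (T x) = x) ∧ (∀ x, T (Ti x) = x) ∧ IsRotation R ∧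
        IsTowerOver T' ![m2 - m1, m1] R ∧ IsConjugate Ti T')) ∧
    (m2 < m1 →
      (∃ (R T' : ℝ → ℝ), IsRotation R ∧
        IsTowerOver T' ![m1 - m2, m2] R ∧ IsConjugate T T') ∨
      (∃ (Ti R T' : ℝ → ℝ), (∀ x, Ti (T x) = x) ∧ (∀ x, T (Ti x) = x) ∧ IsRotation R ∧
        IsTowerOver T' ![m2, m1 - m2] R ∧ IsConjugate Ti T')) := by
  obtain ⟨p, q, a, b, h⟩ := tow_of_tower hS hT
  refine ⟨fun hlt => Or.inl ?_, fun hlt => Or.inr ?_⟩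
  · obtain ⟨T', a', b', h', hc⟩ := h.reduce hlt
    obtain ⟨R, hR, hR'⟩ := h'.tower
    exact ⟨R, T', hR, hR', hc⟩
  · obtain ⟨Ti, hTi, h1, h2⟩ := h.iet.exists_inv
    obtain ⟨T', a', b', h', hc⟩ := (h.inv hTi h1).reduce hlt
    obtain ⟨R, hR, hR'⟩ := h'.tower
    exact ⟨Ti, R, T', h1, h2, hR, hR', hc⟩

end IETRoots
end

section
/- Let T be a tower of type (m_1, m_2) over a rotation and let d be the greatest common divisor of m_1 and m_2. Then T is conjugate in 𝔾 to a tower of constant height d over a rotation. -/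
open Set

namespace IETRoots

/-! ### Tiling -/

/-- The L-shaped fundamental domain. -/
def InD (m1 m2 : ℤ) (l1 l2 : ℝ) (x : ℝ) (n : ℤ) : Prop :=
  (0 ≤ x ∧ x < l1 ∧ 0 ≤ n ∧ n < m1) ∨ (l1 ≤ x ∧ x < l1 + l2 ∧ 0 ≤ n ∧ n < m2)

lemma tile_aux (N : ℕ) : ∀ (m1 m2 : ℤ) (l1 l2 : ℝ), 0 < m1 → 0 < m2 → 0 < l1 → 0 < l2 →
    m1 + m2 ≤ N →
    (∀ x n, ∃ p q : ℤ, InD m1 m2 l1 l2 (x + p * l2 - q * l1) (n - p * m1 - q * m2)) ∧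
    (∀ x n x' n', ∀ p q : ℤ, InD m1 m2 l1 l2 x n → InD m1 m2 l1 l2 x' n' →
      x' = x + p * l2 - q * l1 → n' = n - p * m1 - q * m2 → x' = x ∧ n' = n) := by
  induction N with
  | zero => intro m1 m2 l1 l2 h1 h2 _ _ h; exfalso; push_cast at h; omega
  | succ N ih =>
    intro m1 m2 l1 l2 h1 h2 hl1 hl2 hN
    rcases lt_trichotomy m1 m2 with hlt | heq | hgt
    · obtain ⟨hE, hU⟩ := ih m1 (m2 - m1) (l1 + l2) l2 h1 (by omega) (by linarith) hl2
        (by push_cast at hN; omega)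
      constructor
      · intro x n
        obtain ⟨p, q, h⟩ := hE x n
        rcases h with ⟨a, b, c, e⟩ | ⟨a, b, c, e⟩
        · refine ⟨p - q, q, ?_⟩
          unfold InD
          push_cast
          have e1 : x + (p - q : ℝ) * l2 - q * l1 = x + p * l2 - q * (l1 + l2) := by ring
          have e2 : n - (p - q) * m1 - q * m2 = n - p * m1 - q * (m2 - m1) := by ring
          rw [e1, e2]
          by_cases hx : x + p * l2 - q * (l1 + l2) < l1
          · left; exact ⟨a, hx, c, e⟩
          · right; exact ⟨not_lt.1 hx, b, c, by omega⟩
        · refine ⟨p - q - 1, q, ?_⟩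
          unfold InD
          push_cast
          have e1 : x + (p - q - 1 : ℝ) * l2 - q * l1 = x + p * l2 - q * (l1 + l2) - l2 := by ring
          have e2 : n - (p - q - 1) * m1 - q * m2 = n - p * m1 - q * (m2 - m1) + m1 := by ring
          rw [e1, e2]
          right; exact ⟨by linarith, by linarith, by omega, by omega⟩
      · -- the cut and paste map
        have key : ∀ x n, InD m1 m2 l1 l2 x n → ∃ r : ℤ, (r = 0 ∧ n < m1 ∨ r = 1 ∧ m1 ≤ n) ∧
            InD m1 (m2 - m1) (l1 + l2) l2 (x + r * l2) (n - r * m1) := by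
          intro x n h
          by_cases hn : n < m1
          · refine ⟨0, Or.inl ⟨rfl, hn⟩, Or.inl ?_⟩
            push_cast
            rcases h with ⟨a, b, c, e⟩ | ⟨a, b, c, e⟩ <;>
              exact ⟨by linarith, by linarith, by omega, by omega⟩
          · refine ⟨1, Or.inr ⟨rfl, by omega⟩, Or.inr ?_⟩
            push_cast
            rcases h with ⟨a, b, c, e⟩ | ⟨a, b, c, e⟩
            · omega
            · exact ⟨by linarith, by linarith, by omega, by omega⟩
        intro x n x' n' p q h h' hx hn
        obtain ⟨r, hr, hD⟩ := key x n h
        obtain ⟨r', hr', hD'⟩ := key x' n' h'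
        obtain ⟨e1, e2⟩ := hU _ _ _ _ (p + q + r' - r) q hD hD'
          (by rw [hx]; push_cast; ring) (by rw [hn]; ring)
        rcases hr with ⟨rfl, hr⟩ | ⟨rfl, hr⟩ <;> rcases hr' with ⟨rfl, hr'⟩ | ⟨rfl, hr'⟩
        · push_cast at e1; exact ⟨by linarith, by omega⟩
        · exfalso
          push_cast at e1
          rcases h with ⟨a, b, c, e⟩ | ⟨a, b, c, e⟩ <;> rcases h' with ⟨a', b', c', e'⟩ | ⟨a', b', c', e'⟩
          all_goals first | omega | linarith
        · exfalso
          push_cast at e1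
          rcases h with ⟨a, b, c, e⟩ | ⟨a, b, c, e⟩ <;> rcases h' with ⟨a', b', c', e'⟩ | ⟨a', b', c', e'⟩
          all_goals first | omega | linarith
        · push_cast at e1; exact ⟨by linarith, by omega⟩
    · subst heq
      constructor
      · intro x n
        set r := n / m1 with hr
        set q := ⌊(x + r * l2) / (l1 + l2)⌋ with hq
        have hL : 0 < l1 + l2 := by linarith
        have f1 : (q : ℝ) * (l1 + l2) ≤ x + r * l2 := by
          rw [← le_div_iff₀ hL]; exact Int.floor_le _
        have f2 : x + r * l2 < ((q : ℝ) + 1) * (l1 + l2) := by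
          rw [← div_lt_iff₀ hL]; exact Int.lt_floor_add_one _
        have g1 := Int.emod_nonneg n h1.ne'
        have g2 := Int.emod_lt_of_pos n h1
        have g3 : n - (r - q) * m1 - q * m1 = n % m1 := by
          have := Int.emod_add_mul_ediv n m1
          rw [← hr] at this
          linear_combination (-1) * this
        refine ⟨r - q, q, ?_⟩
        unfold InD
        rw [g3]
        push_cast
        have e1 : x + (r - q : ℝ) * l2 - q * l1 = x + r * l2 - q * (l1 + l2) := by ring
        rw [e1]
        by_cases hx : x + r * l2 - q * (l1 + l2) < l1
        · left; exact ⟨by linarith, hx, g1, g2⟩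
        · right; exact ⟨not_lt.1 hx, by linarith, g1, g2⟩
      · intro x n x' n' p q h h' hx hn
        have hb : ∀ x n, InD m1 m1 l1 l2 x n → 0 ≤ x ∧ x < l1 + l2 ∧ 0 ≤ n ∧ n < m1 := by
          intro x n h
          rcases h with ⟨a, b, c, e⟩ | ⟨a, b, c, e⟩ <;>
            exact ⟨by linarith, by linarith, by omega, by omega⟩
        obtain ⟨a, b, c, e⟩ := hb _ _ h
        obtain ⟨a', b', c', e'⟩ := hb _ _ h'
        have hpq : p + q = 0 := by
          have e0 : n' = n - (p + q) * m1 := by rw [hn]; ring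
          have : -1 < p + q := by nlinarith
          have : p + q < 1 := by nlinarith
          omega
        have hq : q = -p := by omega
        subst hq
        have hL : 0 < l1 + l2 := by linarith
        have hx' : x' = x + p * (l1 + l2) := by rw [hx]; push_cast; ring
        have hp : p = 0 := by
          have i1 : (-1 : ℝ) < p := by nlinarith
          have i2 : (p : ℝ) < 1 := by nlinarith
          have i3 : -1 < p := by exact_mod_cast i1
          have i4 : p < 1 := by exact_mod_cast i2
          omega
        subst hp
        exact ⟨by simpa using hx, by simpa using hn⟩
    · obtain ⟨hE, hU⟩ := ih (m1 - m2) m2 l1 (l1 + l2) (by omega) h2 hl1 (by linarith)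
        (by push_cast at hN; omega)
      constructor
      · intro x n
        obtain ⟨p, q, h⟩ := hE (x + l1) n
        rcases h with ⟨a, b, c, e⟩ | ⟨a, b, c, e⟩
        · refine ⟨p, q - p - 1, ?_⟩
          unfold InD
          push_cast
          have e1 : x + (p : ℝ) * l2 - (q - p - 1) * l1 = x + l1 + p * (l1 + l2) - q * l1 := by ring
          have e2 : n - p * m1 - (q - p - 1) * m2 = n - p * (m1 - m2) - q * m2 + m2 := by ring
          rw [e1, e2]
          left; exact ⟨by linarith, by linarith, by omega, by omega⟩
        · refine ⟨p, q - p, ?_⟩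
          unfold InD
          push_cast
          have e1 : x + (p : ℝ) * l2 - (q - p) * l1 = x + l1 + p * (l1 + l2) - q * l1 - l1 := by ring
          have e2 : n - p * m1 - (q - p) * m2 = n - p * (m1 - m2) - q * m2 := by ring
          rw [e1, e2]
          by_cases hx : x + l1 + p * (l1 + l2) - q * l1 - l1 < l1
          · left; exact ⟨by linarith, hx, c, by omega⟩
          · right; exact ⟨not_lt.1 hx, by linarith, c, by omega⟩
      · have key : ∀ x n, InD m1 m2 l1 l2 x n → ∃ r : ℤ, (r = 0 ∧ n < m2 ∨ r = 1 ∧ m2 ≤ n) ∧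
            InD (m1 - m2) m2 l1 (l1 + l2) (x + l1 - r * l1) (n - r * m2) := by
          intro x n h
          by_cases hn : n < m2
          · refine ⟨0, Or.inl ⟨rfl, hn⟩, Or.inr ?_⟩
            push_cast
            rcases h with ⟨a, b, c, e⟩ | ⟨a, b, c, e⟩ <;>
              exact ⟨by linarith, by linarith, by omega, by omega⟩
          · refine ⟨1, Or.inr ⟨rfl, by omega⟩, Or.inl ?_⟩
            push_cast
            rcases h with ⟨a, b, c, e⟩ | ⟨a, b, c, e⟩
            · exact ⟨by linarith, by linarith, by omega, by omega⟩
            · omega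
        intro x n x' n' p q h h' hx hn
        obtain ⟨r, hr, hD⟩ := key x n h
        obtain ⟨r', hr', hD'⟩ := key x' n' h'
        obtain ⟨e1, e2⟩ := hU _ _ _ _ p (p + q + r' - r) hD hD'
          (by rw [hx]; push_cast; ring) (by rw [hn]; ring)
        rcases hr with ⟨rfl, hr⟩ | ⟨rfl, hr⟩ <;> rcases hr' with ⟨rfl, hr'⟩ | ⟨rfl, hr'⟩
        · push_cast at e1; exact ⟨by linarith, by omega⟩
        · exfalso
          push_cast at e1
          rcases h with ⟨a, b, c, e⟩ | ⟨a, b, c, e⟩ <;> rcases h' with ⟨a', b', c', e'⟩ | ⟨a', b', c', e'⟩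
          all_goals first | omega | linarith
        · exfalso
          push_cast at e1
          rcases h with ⟨a, b, c, e⟩ | ⟨a, b, c, e⟩ <;> rcases h' with ⟨a', b', c', e'⟩ | ⟨a', b', c', e'⟩
          all_goals first | omega | linarith
        · push_cast at e1; exact ⟨by linarith, by omega⟩

/-! ### Finite covers by translation pieces give IETs -/

lemma pieces_of_cover (f : ℝ → ℝ) (P : Finset (ℝ × ℝ))
    (hcov : ∀ x ∈ unitI, ∃ p ∈ P, x ∈ Set.Ico p.1 p.2)
    (htr : ∀ p ∈ P, ∃ c : ℝ, ∀ x ∈ unitI, x ∈ Set.Ico p.1 p.2 → f x = x + c) :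
    ∃ (k : ℕ) (β : Fin (k + 1) → ℝ), StrictMono β ∧ β 0 = 0 ∧ β (Fin.last k) = 1 ∧
      ∀ i : Fin k, ∃ c : ℝ, ∀ x ∈ Set.Ico (β i.castSucc) (β i.succ), f x = x + c := by
  classical
  set F : Finset ℝ := (insert 0 (insert 1 (P.image Prod.fst ∪ P.image Prod.snd))).filter
    (fun x => 0 ≤ x ∧ x ≤ 1) with hF
  have h0 : (0 : ℝ) ∈ F := by simp [hF]
  have h1 : (1 : ℝ) ∈ F := by simp [hF]
  have hpos : 0 < F.card := Finset.card_pos.2 ⟨0, h0⟩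
  obtain ⟨k, hk⟩ : ∃ k, F.card = k + 1 := ⟨F.card - 1, by omega⟩
  set β := F.orderEmbOfFin hk with hβ
  have hrange : ∀ x ∈ F, ∃ i, β i = x := by
    intro x hx
    have := Finset.range_orderEmbOfFin F hk
    have h : x ∈ Set.range (F.orderEmbOfFin hk) := by rw [this]; exact hx
    exact h
  have hmem : ∀ i, β i ∈ F := fun i => Finset.orderEmbOfFin_mem F hk i
  have hb : ∀ i, 0 ≤ β i ∧ β i ≤ 1 := fun i => (Finset.mem_filter.1 (hmem i)).2
  have hmono : StrictMono β := β.strictMono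
  refine ⟨k, β, hmono, ?_, ?_, ?_⟩
  · obtain ⟨i, hi⟩ := hrange 0 h0
    have := hmono.monotone (Fin.zero_le i)
    exact le_antisymm (by rw [← hi]; exact this) (hb 0).1
  · obtain ⟨i, hi⟩ := hrange 1 h1
    have := hmono.monotone (Fin.le_last i)
    exact le_antisymm (hb _).2 (by rw [← hi]; exact this)
  · intro i
    have hlt : β i.castSucc < β i.succ := hmono (Fin.castSucc_lt_succ)
    have hsub : ∀ x ∈ Set.Ico (β i.castSucc) (β i.succ), x ∈ unitI := fun x hx =>
      ⟨le_trans (hb _).1 hx.1, lt_of_lt_of_le hx.2 (hb _).2⟩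
    obtain ⟨p, hp, hpx⟩ := hcov (β i.castSucc) (hsub _ ⟨le_rfl, hlt⟩)
    obtain ⟨c, hc⟩ := htr p hp
    refine ⟨c, fun x hx => hc x (hsub x hx) ⟨hpx.1.trans hx.1, ?_⟩⟩
    by_contra hcon
    push Not at hcon
    have hpF : p.2 ∈ F := by
      rw [hF, Finset.mem_filter]
      refine ⟨?_, (hb i.castSucc).1.trans hpx.2.le, hcon.trans (hsub x hx).2.le⟩
      simp only [Finset.mem_insert, Finset.mem_union, Finset.mem_image]
      exact Or.inr (Or.inr (Or.inr ⟨p, hp, rfl⟩))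
    obtain ⟨j, hj⟩ := hrange _ hpF
    have i1 : i.castSucc < j := by rw [← hmono.lt_iff_lt, hj]; exact hpx.2
    have i2 : j < i.succ := by
      rw [← hmono.lt_iff_lt, hj]; exact lt_of_le_of_lt hcon hx.2
    rw [Fin.lt_def] at i1 i2
    simp at i1 i2
    omega

/-! ### The model three interval exchange -/

/-- Three interval exchange with parameters. -/
noncomputable def rot3 (δ ε : ℝ) (y : ℝ) : ℝ :=
  if 0 ≤ y ∧ y < 1 then
    (if y < 1 - δ then y + δ else if y < 1 - ε then y - 1 + δ + ε else y - 1 + ε) else y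

lemma rot3_isIET (δ ε : ℝ) (h0 : 0 < ε) (h1 : ε < δ) (h2 : δ ≤ 1) : IsIET (rot3 δ ε) := by
  refine ⟨⟨?_, ?_, ?_⟩, ?_, ?_⟩
  · rintro y ⟨a, b⟩
    have hab : 0 ≤ y ∧ y < 1 := ⟨a, b⟩
    unfold rot3 unitI
    rw [if_pos hab]
    split_ifs <;> constructor <;> linarith
  · rintro y ⟨a, b⟩ z ⟨a', b'⟩ h
    have hab : 0 ≤ y ∧ y < 1 := ⟨a, b⟩
    have hab' : 0 ≤ z ∧ z < 1 := ⟨a', b'⟩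
    unfold rot3 at h
    rw [if_pos hab, if_pos hab'] at h
    split_ifs at h <;> linarith
  · rintro z ⟨a, b⟩
    by_cases c1 : z < ε
    · refine ⟨z + 1 - ε, ⟨by linarith, by linarith⟩, ?_⟩
      unfold rot3
      rw [if_pos ⟨by linarith, by linarith⟩, if_neg (by linarith), if_neg (by linarith)]; ring
    · by_cases c2 : z < δ
      · refine ⟨z + 1 - δ - ε, ⟨by linarith, by linarith⟩, ?_⟩
        unfold rot3
        rw [if_pos ⟨by linarith, by linarith⟩, if_neg (by linarith), if_pos (by linarith)]; ring
      · refine ⟨z - δ, ⟨by linarith, by linarith⟩, ?_⟩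
        unfold rot3
        rw [if_pos ⟨by linarith, by linarith⟩, if_pos (by linarith)]; ring
  · intro x hx
    unfold rot3
    exact if_neg hx
  · apply pieces_of_cover _ {((0 : ℝ), 1 - δ), (1 - δ, 1 - ε), (1 - ε, 1)}
    · rintro x ⟨a, b⟩
      simp only [Finset.mem_insert, Finset.mem_singleton]
      by_cases c1 : x < 1 - δ
      · exact ⟨_, Or.inl rfl, a, c1⟩
      · by_cases c2 : x < 1 - ε
        · exact ⟨_, Or.inr (Or.inl rfl), not_lt.1 c1, c2⟩
        · exact ⟨_, Or.inr (Or.inr rfl), not_lt.1 c2, b⟩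
    · intro p hp
      simp only [Finset.mem_insert, Finset.mem_singleton] at hp
      rcases hp with rfl | rfl | rfl
      · refine ⟨δ, fun x hx h => ?_⟩
        unfold rot3; rw [if_pos (show 0 ≤ x ∧ x < 1 from hx), if_pos h.2]
      · refine ⟨- 1 + δ + ε, fun x hx h => ?_⟩
        unfold rot3; rw [if_pos (show 0 ≤ x ∧ x < 1 from hx), if_neg (not_lt.2 h.1), if_pos h.2]; ring
      · refine ⟨- 1 + ε, fun x hx h => ?_⟩
        have : 1 - ε ≤ x := h.1
        unfold rot3; rw [if_pos (show 0 ≤ x ∧ x < 1 from hx), if_neg (by linarith), if_neg (by linarith)]; ring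

lemma rot3_one_eq (α x : ℝ) (h0 : 0 < α) (h1 : α < 1) (hx : x ∈ unitI) :
    rot3 1 α x = Int.fract (x + α) := by
  obtain ⟨a, b⟩ := hx
  unfold rot3
  rw [if_pos ⟨a, b⟩, if_neg (by linarith)]
  symm
  rw [Int.fract_eq_iff]
  split_ifs with h
  · exact ⟨by linarith, by linarith, 0, by push_cast; ring⟩
  · exact ⟨by linarith, by linarith, 1, by push_cast; ring⟩

lemma rot3_isRotation (α : ℝ) (h0 : 0 < α) (h1 : α < 1) : IsRotation (rot3 1 α) := by
  refine ⟨fun x hx => if_neg hx, α, ⟨h0, h1⟩, fun x hx => rot3_one_eq α x h0 h1 hx⟩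

lemma rot3_tower (α : ℝ) (h0 : 0 < α) (h1 : α < 1) (d : ℕ) (hd : 0 < d) :
    IsTowerOver (rot3 (1 / d) (α / d)) ![d, d] (rot3 1 α) := by
  have hdR : (0 : ℝ) < d := by exact_mod_cast hd
  have hd1 : (1 : ℝ) ≤ d := by exact_mod_cast hd
  have hn : ∀ i, (![d, d] : Fin 2 → ℕ) i = d := by intro i; fin_cases i <;> rfl
  refine ⟨rot3_isIET _ _ (by positivity) (by gcongr) (by rw [div_le_one hdR]; exact hd1),
    rot3_isIET _ _ h0 h1 le_rfl, fun i => by rw [hn]; exact hd,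
    ![0, 1 - α, 1], 1 / d, fun i j => (j + (![0, 1 - α, 1] : Fin 3 → ℝ) i.castSucc) / d, ?_⟩
  set t : Fin 3 → ℝ := ![0, 1 - α, 1] with ht
  have ht0 : t 0 = 0 := rfl
  have ht1 : t 1 = 1 - α := rfl
  have ht2 : t 2 = 1 := rfl
  have hlev : ∀ (i : Fin 2) (j : ℕ) (y : ℝ), y ∈ Set.Ico ((j + t i.castSucc) / d)
      ((j + t i.castSucc) / d + 1 / d * (t i.succ - t i.castSucc)) ↔
      (j + t i.castSucc ≤ d * y ∧ d * y < j + t i.succ) := by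
    intro i j y
    rw [Set.mem_Ico, div_le_iff₀ hdR]
    have : (j + t i.castSucc) / d + 1 / d * (t i.succ - t i.castSucc) = (j + t i.succ) / d := by
      field_simp; ring
    rw [this, lt_div_iff₀ hdR, mul_comm y]
  have htb : ∀ i : Fin 2, 0 ≤ t i.castSucc ∧ t i.castSucc < t i.succ ∧ t i.succ ≤ 1 := by
    intro i
    fin_cases i
    · change 0 ≤ (0 : ℝ) ∧ 0 < 1 - α ∧ 1 - α ≤ 1
      exact ⟨le_rfl, by linarith, by linarith⟩
    · change 0 ≤ 1 - α ∧ 1 - α < 1 ∧ (1 : ℝ) ≤ 1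
      exact ⟨by linarith, by linarith, le_rfl⟩
  have hdisj : ∀ (i i' : Fin 2) (x : ℝ), t i.castSucc ≤ x → x < t i.succ →
      t i'.castSucc ≤ x → x < t i'.succ → i = i' := by
    intro i i' x a b a' b'
    fin_cases i <;> fin_cases i'
    · rfl
    · change x < 1 - α at b
      change 1 - α ≤ x at a'
      linarith
    · change 1 - α ≤ x at a
      change x < 1 - α at b'
      linarith
    · rfl
  refine ⟨?_, rfl, rfl, by positivity, ?_, ?_, ?_, ?_, ?_, ?_⟩
  · rw [Fin.strictMono_iff_lt_succ]
    intro i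
    exact (htb i).2.1
  · intro i
    fin_cases i
    · refine ⟨α, fun x hx => ?_⟩
      change 0 ≤ x ∧ x < 1 - α at hx
      unfold rot3
      rw [if_pos ⟨hx.1, by linarith⟩, if_neg (by linarith), if_pos hx.2]; ring
    · refine ⟨α - 1, fun x hx => ?_⟩
      change 1 - α ≤ x ∧ x < 1 at hx
      unfold rot3
      rw [if_pos ⟨by linarith, hx.2⟩, if_neg (by linarith), if_neg (by linarith)]; ring
  · intro i j hj y hy
    rw [hn] at hj
    rw [hlev] at hy
    have hj1 : (j : ℝ) + 1 ≤ d := by exact_mod_cast hj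
    have hj0 : (0 : ℝ) ≤ j := by positivity
    obtain ⟨b0, b1, b2⟩ := htb i
    constructor
    · by_contra hc
      push Not at hc
      have := mul_neg_of_pos_of_neg hdR hc
      linarith
    · by_contra hc
      push Not at hc
      have : (d : ℝ) * 1 ≤ d * y := by gcongr
      linarith
  · intro i i' j j' hj hj' hne
    rw [Set.disjoint_left]
    intro y hy hy'
    rw [hlev] at hy hy'
    apply hne
    obtain ⟨b0, b1, b2⟩ := htb i
    obtain ⟨b0', b1', b2'⟩ := htb i'
    have k1 : (j : ℝ) < j' + 1 := by linarith [hy.1, hy'.2]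
    have k2 : (j' : ℝ) < j + 1 := by linarith [hy'.1, hy.2]
    have k3 : j < j' + 1 := by exact_mod_cast k1
    have k4 : j' < j + 1 := by exact_mod_cast k2
    have hjj : j = j' := by omega
    subst hjj
    rw [hdisj i i' (d * y - j) (by linarith [hy.1]) (by linarith [hy.2]) (by linarith [hy'.1])
      (by linarith [hy'.2])]
  · rintro y ⟨ya, yb⟩
    have hy0 : 0 ≤ d * y := by positivity
    have f1 := Nat.floor_le hy0
    have f2 := Nat.lt_floor_add_one (d * y)
    have f3 : ⌊d * y⌋₊ < d := by
      rw [Nat.floor_lt hy0]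
      nlinarith
    by_cases hc : d * y - ⌊d * y⌋₊ < 1 - α
    · refine ⟨0, ⌊d * y⌋₊, by rw [hn]; exact f3, ?_⟩
      rw [hlev]
      change _ + (0 : ℝ) ≤ _ ∧ _ < _ + (1 - α)
      exact ⟨by linarith, by linarith⟩
    · refine ⟨1, ⌊d * y⌋₊, by rw [hn]; exact f3, ?_⟩
      rw [hlev]
      change _ + (1 - α) ≤ _ ∧ _ < _ + (1 : ℝ)
      exact ⟨by linarith, by linarith⟩
  · intro i j hj x hx
    rw [hn] at hj
    obtain ⟨b0, b1, b2⟩ := htb i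
    have hj1 : (j : ℝ) + 2 ≤ d := by exact_mod_cast hj
    have hj0 : (0 : ℝ) ≤ j := by positivity
    have e : (j + t i.castSucc) / d + 1 / d * (x - t i.castSucc) = (j + x) / d := by
      field_simp; ring
    have e' : (((j + 1 : ℕ) : ℝ) + t i.castSucc) / d + 1 / d * (x - t i.castSucc)
        = (j + x) / d + 1 / d := by
      push_cast; field_simp; ring
    rw [e, e']
    have hx0 : 0 ≤ x := b0.trans hx.1
    have hx1 : x < 1 := lt_of_lt_of_le hx.2 b2
    unfold rot3
    rw [if_pos, if_pos]
    · rw [lt_sub_iff_add_lt, ← add_div, div_lt_one hdR]; linarith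
    · exact ⟨by positivity, by rw [div_lt_one hdR]; linarith⟩
  · intro i x hx i' hS
    obtain ⟨b0, b1, b2⟩ := htb i
    have hx0 : 0 ≤ x := b0.trans hx.1
    have hx1 : x < 1 := lt_of_lt_of_le hx.2 b2
    rw [hn]
    have e : (((d - 1 : ℕ) : ℝ) + t i.castSucc) / d + 1 / d * (x - t i.castSucc)
        = 1 + (x - 1) / d := by
      rw [Nat.cast_sub hd]; push_cast; field_simp; ring
    have e' : (((0 : ℕ) : ℝ) + t i'.castSucc) / d + 1 / d * (rot3 1 α x - t i'.castSucc)
        = rot3 1 α x / d := by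
      push_cast; field_simp; ring
    rw [e, e']
    have q1 : -1 ≤ (x - 1) / d := by rw [le_div_iff₀ hdR]; linarith
    have q2 : (x - 1) / d < 0 := div_neg_of_neg_of_pos (by linarith) hdR
    have q3 : -(1 / d) ≤ (x - 1) / d := by rw [← neg_div]; gcongr; linarith
    have r1 : ¬ (1 + (x - 1) / d < 1 - 1 / (d : ℝ)) := by linarith
    have r2 : 0 ≤ 1 + (x - 1) / d ∧ 1 + (x - 1) / d < 1 := ⟨by linarith, by linarith⟩
    have r3 : ¬ (x < 1 - 1) := by linarith
    have r4 : 0 ≤ x ∧ x < 1 := ⟨hx0, hx1⟩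
    unfold rot3
    rw [if_pos r2, if_neg r1, if_pos r4, if_neg r3]
    by_cases hc : x < 1 - α
    · have q4 : (x - 1) / d < -(α / d) := by rw [← neg_div]; gcongr; linarith
      have r5 : 1 + (x - 1) / d < 1 - α / (d : ℝ) := by linarith
      rw [if_pos r5, if_pos hc]; field_simp; ring
    · have q4 : -(α / d) ≤ (x - 1) / d := by rw [← neg_div]; gcongr; linarith
      have r5 : ¬ (1 + (x - 1) / d < 1 - α / (d : ℝ)) := by linarith
      rw [if_neg r5, if_neg hc]; field_simp; ring

/-! ### The map to the model -/

/-- Map from the plane to the unit interval. -/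
noncomputable def Psi (d : ℕ) (s α x : ℝ) (n : ℤ) : ℝ :=
  (((n % (d : ℤ) : ℤ) : ℝ) + Int.fract (s * x + ((n / (d : ℤ) : ℤ) : ℝ) * α)) / d

lemma Psi_mem (d : ℕ) (hd : 0 < d) (s α x : ℝ) (n : ℤ) : Psi d s α x n ∈ unitI := by
  have hdR : (0 : ℝ) < d := by exact_mod_cast hd
  have hdZ : (0 : ℤ) < d := by exact_mod_cast hd
  have g1 := Int.emod_nonneg n hdZ.ne'
  have g2 : n % (d : ℤ) + 1 ≤ d := Int.emod_lt_of_pos n hdZ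
  have g1' : (0 : ℝ) ≤ ((n % (d : ℤ) : ℤ) : ℝ) := by exact_mod_cast g1
  have g2' : ((n % (d : ℤ) : ℤ) : ℝ) + 1 ≤ d := by exact_mod_cast g2
  have f1 := Int.fract_nonneg (s * x + ((n / (d : ℤ) : ℤ) : ℝ) * α)
  have f2 := Int.fract_lt_one (s * x + ((n / (d : ℤ) : ℤ) : ℝ) * α)
  unfold Psi
  constructor
  · positivity
  · rw [div_lt_one hdR]; linarith

lemma Psi_eq (d : ℕ) (hd : 0 < d) (s α x : ℝ) (r j : ℤ) (h0 : 0 ≤ j) (h1 : j < d) :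
    Psi d s α x (j + d * r) = (j + Int.fract (s * x + r * α)) / d := by
  have hdZ : (0 : ℤ) < d := by exact_mod_cast hd
  unfold Psi
  rw [Int.add_mul_emod_self_left, Int.emod_eq_of_lt h0 h1, Int.add_mul_ediv_left _ _ hdZ.ne',
    Int.ediv_eq_zero_of_lt h0 h1, zero_add]

lemma exists_split (d : ℕ) (hd : 0 < d) (n : ℤ) : ∃ r j : ℤ, 0 ≤ j ∧ j < d ∧ n = j + d * r := by
  have hdZ : (0 : ℤ) < d := by exact_mod_cast hd
  exact ⟨n / d, n % d, Int.emod_nonneg n hdZ.ne', Int.emod_lt_of_pos n hdZ,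
    (Int.emod_add_mul_ediv n d).symm⟩

lemma Psi_step (d : ℕ) (hd : 0 < d) (s α x : ℝ) (h0 : 0 < α) (h1 : α < 1) (n : ℤ) :
    rot3 (1 / d) (α / d) (Psi d s α x n) = Psi d s α x (n + 1) := by
  have hdR : (0 : ℝ) < d := by exact_mod_cast hd
  have hm := Psi_mem d hd s α x n
  obtain ⟨r, j, hj0, hj1, rfl⟩ := exists_split d hd n
  have hm' : 0 ≤ Psi d s α x (j + d * r) ∧ Psi d s α x (j + d * r) < 1 := hm
  unfold rot3
  rw [if_pos hm', Psi_eq d hd s α x r j hj0 hj1]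
  set f := Int.fract (s * x + r * α) with hf
  have f1 : 0 ≤ f := Int.fract_nonneg _
  have f2 : f < 1 := Int.fract_lt_one _
  have hfa : Int.fract (s * x + (r + 1 : ℤ) * α) = Int.fract (f + α) := by
    rw [Int.fract_eq_fract]
    refine ⟨⌊s * x + r * α⌋, ?_⟩
    have := Int.floor_add_fract (s * x + r * α)
    rw [← hf] at this
    push_cast
    linear_combination (-1) * this
  by_cases hj : j + 1 < d
  · have hjZ : j + 2 ≤ d := by omega
    have hjR : (j : ℝ) + 2 ≤ d := by exact_mod_cast hjZ
    have r1 : (j + f) / d < 1 - 1 / (d : ℝ) := by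
      rw [lt_sub_iff_add_lt, ← add_div, div_lt_one hdR]; linarith
    rw [if_pos r1, show j + d * r + 1 = (j + 1) + d * r by ring,
      Psi_eq d hd s α x r (j + 1) (by omega) hj, ← hf]
    push_cast
    field_simp; ring
  · have hj : j = d - 1 := by omega
    subst hj
    rw [show (d : ℤ) - 1 + d * r + 1 = 0 + d * (r + 1) by ring,
      Psi_eq d hd s α x (r + 1) 0 le_rfl (by exact_mod_cast hd), hfa]
    push_cast
    have e : ((d : ℝ) - 1 + f) / d = 1 - (1 - f) / d := by field_simp; ring
    rw [e]
    have r1 : ¬ (1 - (1 - f) / d < 1 - 1 / (d : ℝ)) := by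
      have : (1 - f) / d ≤ 1 / d := by gcongr; linarith
      linarith
    rw [if_neg r1]
    by_cases hc : f < 1 - α
    · have r2 : 1 - (1 - f) / d < 1 - α / (d : ℝ) := by
        have : α / d < (1 - f) / d := by gcongr; linarith
        linarith
      rw [if_pos r2, Int.fract_eq_self.2 ⟨by linarith, by linarith⟩]
      field_simp; ring
    · have r2 : ¬ (1 - (1 - f) / d < 1 - α / (d : ℝ)) := by
        have : (1 - f) / d ≤ α / d := by gcongr; linarith
        linarith
      have hfr : Int.fract (f + α) = f + α - 1 := by
        rw [Int.fract_eq_iff]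
        exact ⟨by linarith, by linarith, 1, by push_cast; ring⟩
      rw [if_neg r2, hfr]
      field_simp; ring

lemma Psi_eq_iff (d : ℕ) (hd : 0 < d) (s α x x' : ℝ) (n n' : ℤ) :
    Psi d s α x n = Psi d s α x' n' ↔
      ∃ e k : ℤ, n' = n + d * e ∧ s * (x' - x) + e * α = k := by
  have hdR : (0 : ℝ) < d := by exact_mod_cast hd
  obtain ⟨r, j, hj0, hj1, rfl⟩ := exists_split d hd n
  obtain ⟨r', j', hj0', hj1', rfl⟩ := exists_split d hd n'
  rw [Psi_eq d hd s α x r j hj0 hj1, Psi_eq d hd s α x' r' j' hj0' hj1', div_left_inj' hdR.ne']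
  have f1 := Int.fract_nonneg (s * x + r * α)
  have f2 := Int.fract_lt_one (s * x + r * α)
  have f1' := Int.fract_nonneg (s * x' + r' * α)
  have f2' := Int.fract_lt_one (s * x' + r' * α)
  constructor
  · intro h
    have k1 : (j : ℝ) < j' + 1 := by linarith
    have k2 : (j' : ℝ) < j + 1 := by linarith
    have k3 : j < j' + 1 := by exact_mod_cast k1
    have k4 : j' < j + 1 := by exact_mod_cast k2
    have hjj : j = j' := by omega
    subst hjj
    have h' : Int.fract (s * x' + r' * α) = Int.fract (s * x + r * α) := by linarith
    rw [Int.fract_eq_fract] at h'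
    obtain ⟨z, hz⟩ := h'
    refine ⟨r' - r, z, by ring, ?_⟩
    push_cast
    linear_combination hz
  · rintro ⟨e, k, h1, h2⟩
    have hdZ : (0 : ℤ) < d := by exact_mod_cast hd
    have h3 : j' - j = d * (r + e - r') := by linear_combination h1
    have h4 : r + e - r' < 1 := by
      by_contra hc
      push Not at hc
      nlinarith
    have h5 : -1 < r + e - r' := by
      by_contra hc
      push Not at hc
      nlinarith
    have h6 : r' = r + e := by omega
    subst h6
    have h7 : j' = j := by
      have : j' - j = 0 := by rw [h3]; ring
      omega
    subst h7
    congr 1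
    rw [Int.fract_eq_fract]
    refine ⟨-k, ?_⟩
    push_cast
    linear_combination (-1) * h2

lemma Psi_surj (d : ℕ) (hd : 0 < d) (s α : ℝ) (hs : 0 < s) (y : ℝ) (hy : y ∈ unitI) :
    ∃ x n, Psi d s α x n = y := by
  have hdR : (0 : ℝ) < d := by exact_mod_cast hd
  obtain ⟨ya, yb⟩ := hy
  have h0 : 0 ≤ ⌊d * y⌋ := Int.floor_nonneg.2 (by positivity)
  have h1 : ⌊d * y⌋ < d := by
    rw [Int.floor_lt]; push_cast; nlinarith
  refine ⟨Int.fract (d * y) / s, ⌊d * y⌋ + d * 0, ?_⟩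
  rw [Psi_eq d hd _ _ _ _ _ h0 h1]
  have : s * (Int.fract (d * y) / s) + ((0 : ℤ) : ℝ) * α = Int.fract (d * y) := by
    push_cast; field_simp; ring
  rw [this, Int.fract_fract, Int.floor_add_fract]
  field_simp

lemma Psi_lattice (d a b : ℕ) (hd : 0 < d) (u w z : ℤ) (l1 l2 s α : ℝ)
    (hs : 0 < s) (hL : s * (a * l1 + b * l2) = 1) (huw : (a : ℤ) * u + b * w = 1)
    (hα : α = u * (s * l2) - w * (s * l1) + z) (x x' : ℝ) (n n' : ℤ) :
    Psi d s α x n = Psi d s α x' n' ↔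
      ∃ p q : ℤ, x' = x + p * l2 - q * l1 ∧
        n' = n - p * ((d * a : ℕ) : ℤ) - q * ((d * b : ℕ) : ℤ) := by
  have huwR : (a : ℝ) * u + b * w = 1 := by exact_mod_cast huw
  rw [Psi_eq_iff d hd]
  constructor
  · rintro ⟨e, k, h1, h2⟩
    refine ⟨(k - e * z) * b - e * u, -(k - e * z) * a - e * w, ?_, ?_⟩
    · apply mul_left_cancel₀ hs.ne'
      push_cast
      rw [hα] at h2
      linear_combination h2 - (k - e * z) * hL
    · push_cast
      linear_combination h1 - d * e * huw
  · rintro ⟨p, q, h1, h2⟩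
    refine ⟨-(p * a + q * b), p * w - q * u - (p * a + q * b) * z, ?_, ?_⟩
    · rw [h2]; push_cast; ring
    · rw [h1, hα]; push_cast
      linear_combination (p * w - q * u) * hL - (p * s * l2 - q * s * l1) * huwR

lemma main_abs (T : ℝ → ℝ) (d a b : ℕ) (hd : 0 < d) (ha : 0 < a) (hb : 0 < b) (u w z : ℤ)
    (l1 l2 c α : ℝ) (hl1 : 0 < l1) (hl2 : 0 < l2) (hc : 0 < c)
    (hL : c * d * (a * l1 + b * l2) = 1) (huw : (a : ℤ) * u + b * w = 1)
    (hα : α = u * (c * d * l2) - w * (c * d * l1) + z) (hα0 : 0 < α) (hα1 : α < 1)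
    (A1 A2 : ℤ → ℝ) (e : ℝ → ℤ → ℝ)
    (he : ∀ x n, e x n = if x < l1 then A1 n + c * x else A2 n + c * x)
    (he1 : ∀ x n, InD (d * a : ℕ) (d * b : ℕ) l1 l2 x n → e x n ∈ unitI)
    (he2 : ∀ y ∈ unitI, ∃ x n, InD (d * a : ℕ) (d * b : ℕ) l1 l2 x n ∧ e x n = y)
    (he3 : ∀ x n x' n', InD (d * a : ℕ) (d * b : ℕ) l1 l2 x n →
      InD (d * a : ℕ) (d * b : ℕ) l1 l2 x' n' → e x n = e x' n' → x = x' ∧ n = n')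
    (hTid : ∀ x, x ∉ unitI → T x = x)
    (hT : ∀ x n, InD (d * a : ℕ) (d * b : ℕ) l1 l2 x n → ∃ (p q : ℤ) (x' : ℝ) (n' : ℤ),
      x' = x + p * l2 - q * l1 ∧
      n' = n + 1 - p * ((d * a : ℕ) : ℤ) - q * ((d * b : ℕ) : ℤ) ∧
      InD (d * a : ℕ) (d * b : ℕ) l1 l2 x' n' ∧ T (e x n) = e x' n') :
    IsConjugate T (rot3 (1 / d) (α / d)) := by
  classical
  have hdR : (0 : ℝ) < d := by exact_mod_cast hd
  have hs : 0 < c * d := by positivity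
  have hm1 : 0 < ((d * a : ℕ) : ℤ) := by exact_mod_cast Nat.mul_pos hd ha
  have hm2 : 0 < ((d * b : ℕ) : ℤ) := by exact_mod_cast Nat.mul_pos hd hb
  have hlat := Psi_lattice d a b hd u w z l1 l2 (c * d) α hs hL huw hα
  obtain ⟨hE, hU⟩ := tile_aux (d * a + d * b) ((d * a : ℕ) : ℤ) ((d * b : ℕ) : ℤ) l1 l2 hm1 hm2
    hl1 hl2 (by push_cast; exact le_rfl)
  choose! X N hXN using he2
  set g : ℝ → ℝ := fun y => if y ∈ unitI then Psi d (c * d) α (X y) (N y) else y with hg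
  have hge : ∀ x n, InD (d * a : ℕ) (d * b : ℕ) l1 l2 x n → g (e x n) = Psi d (c * d) α x n := by
    intro x n h
    have hm := he1 x n h
    simp only [hg]
    rw [if_pos hm]
    obtain ⟨h1, h2⟩ := hXN _ hm
    obtain ⟨h3, h4⟩ := he3 _ _ _ _ h1 h h2
    rw [h3, h4]
  have hid : ∀ y, y ∉ unitI → g y = y := fun y hy => if_neg hy
  have hrid : ∀ y, y ∉ unitI → rot3 (1 / d) (α / d) y = y := fun y hy => if_neg hy
  refine ⟨g, ⟨⟨?_, ?_, ?_⟩, hid, ?_⟩, ?_⟩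
  · intro y hy
    obtain ⟨h1, h2⟩ := hXN y hy
    rw [← h2, hge _ _ h1]
    exact Psi_mem d hd _ _ _ _
  · intro y hy y' hy' h
    obtain ⟨h1, h2⟩ := hXN y hy
    obtain ⟨h1', h2'⟩ := hXN y' hy'
    rw [← h2, ← h2', hge _ _ h1, hge _ _ h1', hlat] at h
    obtain ⟨p, q, e1, e2⟩ := h
    obtain ⟨e3, e4⟩ := hU _ _ _ _ p q h1 h1' e1 e2
    rw [← h2, ← h2', e3, e4]
  · intro y hy
    obtain ⟨x, n, hxn⟩ := Psi_surj d hd (c * d) α hs y hy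
    obtain ⟨p, q, h⟩ := hE x n
    refine ⟨e _ _, he1 _ _ h, ?_⟩
    rw [hge _ _ h, ← hxn]
    exact ((hlat _ _ _ _).2 ⟨p, q, rfl, rfl⟩).symm
  · -- pieces
    set B : ℤ := ⌈c * d * (l1 + l2) + ((d * a : ℕ) + (d * b : ℕ) : ℝ) * α⌉ with hB
    set pc : ℝ → ℝ → (ℤ → ℝ) → ℤ × ℤ → ℝ × ℝ := fun lo hi A nk =>
      (A nk.1 + c * max lo ((nk.2 - (nk.1 / (d : ℤ) : ℤ) * α) / (c * d)),
       A nk.1 + c * min hi ((nk.2 + 1 - (nk.1 / (d : ℤ) : ℤ) * α) / (c * d))) with hpc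
    have hpcmem : ∀ lo hi A n k x, A n + c * x ∈ Set.Ico (pc lo hi A (n, k)).1 (pc lo hi A (n, k)).2 ↔
        (lo ≤ x ∧ x < hi) ∧ ⌊c * d * x + (n / (d : ℤ) : ℤ) * α⌋ = k := by
      intro lo hi A n k x
      simp only [hpc, Set.mem_Ico, add_le_add_iff_left, add_lt_add_iff_left,
        mul_le_mul_iff_right₀ hc, mul_lt_mul_iff_right₀ hc, max_le_iff, lt_min_iff,
        div_le_iff₀ hs, lt_div_iff₀ hs, Int.floor_eq_iff]
      constructor
      · rintro ⟨⟨i1, i2⟩, i3, i4⟩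
        exact ⟨⟨i1, i3⟩, by linarith, by linarith⟩
      · rintro ⟨⟨i1, i3⟩, i2, i4⟩
        exact ⟨⟨i1, by linarith⟩, i3, by linarith⟩
    have hfl : ∀ x n, InD (d * a : ℕ) (d * b : ℕ) l1 l2 x n →
        ⌊c * d * x + (n / (d : ℤ) : ℤ) * α⌋ ∈ Finset.Icc 0 B := by
      intro x n h
      have hb : 0 ≤ x ∧ x < l1 + l2 ∧ 0 ≤ n ∧ n < ((d * a : ℕ) : ℤ) + ((d * b : ℕ) : ℤ) := by
        rcases h with ⟨i1, i2, i3, i4⟩ | ⟨i1, i2, i3, i4⟩ <;>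
          exact ⟨by linarith, by linarith, by omega, by omega⟩
      obtain ⟨i1, i2, i3, i4⟩ := hb
      have hdZ : (0 : ℤ) < d := by exact_mod_cast hd
      have j1 : 0 ≤ n / (d : ℤ) := Int.ediv_nonneg i3 hdZ.le
      have j2 : n / (d : ℤ) ≤ n := Int.ediv_le_self _ i3
      have j3 : (0 : ℝ) ≤ ((n / (d : ℤ) : ℤ) : ℝ) := by exact_mod_cast j1
      have j4 : ((n / (d : ℤ) : ℤ) : ℝ) ≤ (d * a : ℕ) + (d * b : ℕ) := by
        have : n / (d : ℤ) ≤ ((d * a : ℕ) : ℤ) + ((d * b : ℕ) : ℤ) := by omega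
        exact_mod_cast this
      rw [Finset.mem_Icc]
      constructor
      · exact Int.floor_nonneg.2 (by positivity)
      · have : (⌊c * d * x + (n / (d : ℤ) : ℤ) * α⌋ : ℝ) ≤ (B : ℝ) := by
          refine (Int.floor_le _).trans (le_trans ?_ (Int.le_ceil _))
          gcongr
        exact_mod_cast this
    have hPsi : ∀ x n k, ⌊c * d * x + (n / (d : ℤ) : ℤ) * α⌋ = k →
        Psi d (c * d) α x n = c * x + ((n % (d : ℤ) : ℤ) + (n / (d : ℤ) : ℤ) * α - k) / d := by
      intro x n k hk
      unfold Psi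
      rw [Int.fract, hk]
      field_simp; ring
    apply pieces_of_cover g
      ((Finset.Ico (0 : ℤ) (d * a : ℕ) ×ˢ Finset.Icc 0 B).image (pc 0 l1 A1) ∪
       (Finset.Ico (0 : ℤ) (d * b : ℕ) ×ˢ Finset.Icc 0 B).image (pc l1 (l1 + l2) A2))
    · intro y hy
      obtain ⟨h1, h2⟩ := hXN y hy
      have hf := hfl _ _ h1
      rw [he] at h2
      rcases h1 with ⟨i1, i2, i3, i4⟩ | ⟨i1, i2, i3, i4⟩
      · rw [if_pos i2] at h2
        refine ⟨pc 0 l1 A1 (N y, _), Finset.mem_union_left _ (Finset.mem_image_of_mem _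
          (Finset.mem_product.2 ⟨Finset.mem_Ico.2 ⟨i3, i4⟩, hf⟩)), ?_⟩
        have := (hpcmem 0 l1 A1 (N y) _ (X y)).2 ⟨⟨i1, i2⟩, rfl⟩
        rw [h2] at this
        exact this
      · rw [if_neg (not_lt.2 i1)] at h2
        refine ⟨pc l1 (l1 + l2) A2 (N y, _), Finset.mem_union_right _ (Finset.mem_image_of_mem _
          (Finset.mem_product.2 ⟨Finset.mem_Ico.2 ⟨i3, i4⟩, hf⟩)), ?_⟩
        have := (hpcmem l1 (l1 + l2) A2 (N y) _ (X y)).2 ⟨⟨i1, i2⟩, rfl⟩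
        rw [h2] at this
        exact this
    · intro p hp
      rw [Finset.mem_union, Finset.mem_image, Finset.mem_image] at hp
      rcases hp with ⟨⟨n, k⟩, hnk, rfl⟩ | ⟨⟨n, k⟩, hnk, rfl⟩
      · obtain ⟨hn, hk⟩ := Finset.mem_product.1 hnk
        obtain ⟨hn0, hn1⟩ := Finset.mem_Ico.1 hn
        refine ⟨((n % (d : ℤ) : ℤ) + (n / (d : ℤ) : ℤ) * α - k) / d - A1 n, fun y hy hyp => ?_⟩
        obtain ⟨x, rfl⟩ : ∃ x, y = A1 n + c * x := ⟨(y - A1 n) / c, by field_simp; ring⟩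
        obtain ⟨⟨i1, i2⟩, i3⟩ := (hpcmem _ _ _ _ _ _).1 hyp
        have := hge x n (Or.inl ⟨i1, i2, hn0, hn1⟩)
        rw [he, if_pos i2, hPsi x n k i3] at this
        rw [this]; ring
      · obtain ⟨hn, hk⟩ := Finset.mem_product.1 hnk
        obtain ⟨hn0, hn1⟩ := Finset.mem_Ico.1 hn
        refine ⟨((n % (d : ℤ) : ℤ) + (n / (d : ℤ) : ℤ) * α - k) / d - A2 n, fun y hy hyp => ?_⟩
        obtain ⟨x, rfl⟩ : ∃ x, y = A2 n + c * x := ⟨(y - A2 n) / c, by field_simp; ring⟩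
        obtain ⟨⟨i1, i2⟩, i3⟩ := (hpcmem _ _ _ _ _ _).1 hyp
        have := hge x n (Or.inr ⟨i1, i2, hn0, hn1⟩)
        rw [he, if_neg (not_lt.2 i1), hPsi x n k i3] at this
        rw [this]; ring
  · funext y
    simp only [Function.comp]
    by_cases hy : y ∈ unitI
    · obtain ⟨h1, h2⟩ := hXN y hy
      obtain ⟨p, q, x', n', e1, e2, h3, h4⟩ := hT _ _ h1
      rw [← h2, h4, hge _ _ h1, hge _ _ h3, Psi_step d hd _ _ _ hα0 hα1]
      exact ((hlat _ _ _ _).2 ⟨p, q, e1, e2⟩).symm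
    · rw [hTid y hy, hid y hy, hrid y hy]

lemma total_length {k : ℕ} (n : Fin k → ℕ) (a : Fin k → ℕ → ℝ) (l : Fin k → ℝ)
    (hl : ∀ i, 0 ≤ l i)
    (hsub : ∀ i : Fin k, ∀ j : ℕ, j < n i → Set.Ico (a i j) (a i j + l i) ⊆ unitI)
    (hdisj : ∀ i i' : Fin k, ∀ j j' : ℕ, j < n i → j' < n i' → (i, j) ≠ (i', j') →
      Disjoint (Set.Ico (a i j) (a i j + l i)) (Set.Ico (a i' j') (a i' j' + l i')))
    (hcov : ∀ y ∈ unitI, ∃ (i : Fin k) (j : ℕ), j < n i ∧ y ∈ Set.Ico (a i j) (a i j + l i)) :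
    ∑ i, (n i : ℝ) * l i = 1 := by
  have hU : unitI = ⋃ p : (Σ i : Fin k, Fin (n i)),
      Set.Ico (a p.1 p.2) (a p.1 p.2 + l p.1) := by
    ext y
    rw [Set.mem_iUnion]
    constructor
    · intro hy
      obtain ⟨i, j, hj, h⟩ := hcov y hy
      exact ⟨⟨i, ⟨j, hj⟩⟩, h⟩
    · rintro ⟨⟨i, j⟩, h⟩
      exact hsub i j j.2 h
  have hv : MeasureTheory.volume unitI = ENNReal.ofReal 1 := by
    unfold unitI
    rw [Real.volume_Ico]; norm_num
  rw [hU, MeasureTheory.measure_iUnion, tsum_fintype] at hv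
  · simp only [Real.volume_Ico, add_sub_cancel_left] at hv
    rw [← ENNReal.ofReal_sum_of_nonneg (fun p _ => hl p.1), ENNReal.ofReal_eq_ofReal_iff
      (Finset.sum_nonneg fun p _ => hl p.1) zero_le_one, Fintype.sum_sigma] at hv
    simpa using hv
  · rintro ⟨i, j⟩ ⟨i', j'⟩ hne
    apply hdisj i i' j j' j.2 j'.2
    intro h
    apply hne
    rw [Prod.mk.injEq] at h
    obtain ⟨rfl, h⟩ := h
    rw [Fin.ext h]
  · intro p
    exact measurableSet_Ico

lemma break_point (S : ℝ → ℝ) (α t1 d0 d1 : ℝ) (h0 : 0 < α) (h1 : α < 1)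
    (hS : ∀ x ∈ unitI, S x = Int.fract (x + α)) (ht0 : 0 < t1) (ht1 : t1 < 1)
    (hd0 : ∀ x ∈ Set.Ico 0 t1, S x = x + d0) (hd1 : ∀ x ∈ Set.Ico t1 1, S x = x + d1) :
    t1 = 1 - α := by
  have hsm : ∀ x, 0 ≤ x → x < 1 - α → S x = x + α := by
    intro x hx hx'
    rw [hS x ⟨hx, by linarith⟩, Int.fract_eq_self.2 ⟨by linarith, by linarith⟩]
  have hz : S (1 - α) = 0 := by
    rw [hS _ ⟨by linarith, by linarith⟩]; simp
  rcases lt_trichotomy t1 (1 - α) with h | h | h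
  · have e1 := hsm t1 ht0.le h
    have e2 := hd1 t1 ⟨le_rfl, ht1⟩
    have e3 := hd1 (1 - α) ⟨h.le, by linarith⟩
    linarith
  · exact h
  · have e1 := hsm 0 le_rfl (by linarith)
    have e2 := hd0 0 ⟨le_rfl, ht0⟩
    have e3 := hd0 (1 - α) ⟨by linarith, h⟩
    linarith

lemma exists_angle (a b : ℕ) (ha : 0 < a) (hb : 0 < b) (hab : Nat.Coprime a b) (μ1 μ2 : ℝ)
    (h1 : 0 < μ1) (h2 : 0 < μ2) (hL : a * μ1 + b * μ2 = 1) :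
    ∃ (u w z : ℤ) (α : ℝ), (a : ℤ) * u + b * w = 1 ∧ α = u * μ2 - w * μ1 + z ∧ 0 < α ∧ α < 1 := by
  obtain ⟨u, w, huw⟩ := Nat.isCoprime_iff_coprime.2 hab
  have huw' : (a : ℤ) * u + b * w = 1 := by linear_combination huw
  have huwR : (a : ℝ) * u + b * w = 1 := by exact_mod_cast huw'
  refine ⟨u, w, -⌊u * μ2 - w * μ1⌋, Int.fract (u * μ2 - w * μ1), huw', ?_, ?_,
    Int.fract_lt_one _⟩
  · rw [Int.fract]; push_cast; ring
  · rw [Int.fract_pos]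
    intro h
    set k := ⌊u * μ2 - w * μ1⌋ with hk
    have e2 : μ2 = ((a * k + w : ℤ) : ℝ) := by
      push_cast
      rw [← h]
      linear_combination (-μ2) * huwR + w * hL
    have e1 : μ1 = ((u - b * k : ℤ) : ℝ) := by
      push_cast
      rw [← h]
      linear_combination (-μ1) * huwR + u * hL
    have p2 : (1 : ℝ) ≤ μ2 := by
      rw [e2] at h2 ⊢
      have : 0 < a * k + w := by exact_mod_cast h2
      exact_mod_cast this
    have p1 : (1 : ℝ) ≤ μ1 := by
      rw [e1] at h1 ⊢
      have : 0 < u - b * k := by exact_mod_cast h1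
      exact_mod_cast this
    have ha' : (1 : ℝ) ≤ a := by exact_mod_cast ha
    have hb' : (1 : ℝ) ≤ b := by exact_mod_cast hb
    nlinarith


theorem stmt11 (T S : ℝ → ℝ) (m1 m2 : ℕ)
    (hS : IsRotation S) (hT : IsTowerOver T ![m1, m2] S)
    (d : ℕ) (hd : d = Nat.gcd m1 m2) :
    ∃ (R T' : ℝ → ℝ), IsRotation R ∧ IsTowerOver T' ![d, d] R ∧ IsConjugate T T' := by
  obtain ⟨hSid, α, ⟨hα0, hα1⟩, hSα⟩ := hS
  obtain ⟨⟨_, hTid, _⟩, _, hpos, t, c, A, htm, ht0, htl, hc, htr, hsub, hdisj, hcov, hup, htop⟩ := hT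
  have hm1 : 0 < m1 := hpos 0
  have hm2 : 0 < m2 := hpos 1
  have ht2 : t 2 = 1 := htl
  have hlt1 : 0 < t 1 := by rw [← ht0]; exact htm (by decide)
  have hlt2 : t 1 < 1 := by rw [← ht2]; exact htm (by decide)
  obtain ⟨d0, hd0⟩ := htr 0
  obtain ⟨d1, hd1⟩ := htr 1
  change ∀ x ∈ Set.Ico (t 0) (t 1), S x = x + d0 at hd0
  change ∀ x ∈ Set.Ico (t 1) (t 2), S x = x + d1 at hd1
  rw [ht0] at hd0
  rw [ht2] at hd1
  have ht1 : t 1 = 1 - α := break_point S α (t 1) d0 d1 hα0 hα1 hSα hlt1 hlt2 hd0 hd1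
  clear hd0 hd1 d0 d1 htr
  have hl1 : 0 < 1 - α := by linarith
  have htot := total_length (![m1, m2]) A (fun i => c * (t i.succ - t i.castSucc))
    (fun i => mul_nonneg hc.le (sub_nonneg.2 (htm (Fin.castSucc_lt_succ)).le)) hsub hdisj hcov
  rw [Fin.sum_univ_two] at htot
  change (m1 : ℝ) * (c * (t 1 - t 0)) + (m2 : ℝ) * (c * (t 2 - t 1)) = 1 at htot
  rw [ht0, ht1, ht2] at htot
  -- restate the tower data in coordinates
  have hsub0 : ∀ j < m1, Set.Ico (A 0 j) (A 0 j + c * (t 1 - t 0)) ⊆ unitI := hsub 0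
  have hsub1 : ∀ j < m2, Set.Ico (A 1 j) (A 1 j + c * (t 2 - t 1)) ⊆ unitI := hsub 1
  have hd00 : ∀ j j', j < m1 → j' < m1 → ((0 : Fin 2), j) ≠ (0, j') →
    Disjoint (Set.Ico (A 0 j) (A 0 j + c * (t 1 - t 0)))
      (Set.Ico (A 0 j') (A 0 j' + c * (t 1 - t 0))) := hdisj 0 0
  have hd11 : ∀ j j', j < m2 → j' < m2 → ((1 : Fin 2), j) ≠ (1, j') →
    Disjoint (Set.Ico (A 1 j) (A 1 j + c * (t 2 - t 1)))
      (Set.Ico (A 1 j') (A 1 j' + c * (t 2 - t 1))) := hdisj 1 1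
  have hd01 : ∀ j j', j < m1 → j' < m2 → ((0 : Fin 2), j) ≠ (1, j') →
    Disjoint (Set.Ico (A 0 j) (A 0 j + c * (t 1 - t 0)))
      (Set.Ico (A 1 j') (A 1 j' + c * (t 2 - t 1))) := hdisj 0 1
  have hup0 : ∀ j, j + 1 < m1 → ∀ x ∈ Set.Ico (t 0) (t 1),
      T (A 0 j + c * (x - t 0)) = A 0 (j + 1) + c * (x - t 0) := hup 0
  have hup1 : ∀ j, j + 1 < m2 → ∀ x ∈ Set.Ico (t 1) (t 2),
      T (A 1 j + c * (x - t 1)) = A 1 (j + 1) + c * (x - t 1) := hup 1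
  have htop00 : ∀ x ∈ Set.Ico (t 0) (t 1), S x ∈ Set.Ico (t 0) (t 1) →
      T (A 0 (m1 - 1) + c * (x - t 0)) = A 0 0 + c * (S x - t 0) := fun x hx => htop 0 x hx 0
  have htop01 : ∀ x ∈ Set.Ico (t 0) (t 1), S x ∈ Set.Ico (t 1) (t 2) →
      T (A 0 (m1 - 1) + c * (x - t 0)) = A 1 0 + c * (S x - t 1) := fun x hx => htop 0 x hx 1
  have htop10 : ∀ x ∈ Set.Ico (t 1) (t 2), S x ∈ Set.Ico (t 0) (t 1) →
      T (A 1 (m2 - 1) + c * (x - t 1)) = A 0 0 + c * (S x - t 0) := fun x hx => htop 1 x hx 0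
  have htop11 : ∀ x ∈ Set.Ico (t 1) (t 2), S x ∈ Set.Ico (t 1) (t 2) →
      T (A 1 (m2 - 1) + c * (x - t 1)) = A 1 0 + c * (S x - t 1) := fun x hx => htop 1 x hx 1
  have hcov' : ∀ y ∈ unitI, (∃ j, j < m1 ∧ y ∈ Set.Ico (A 0 j) (A 0 j + c * (t 1 - t 0))) ∨
      (∃ j, j < m2 ∧ y ∈ Set.Ico (A 1 j) (A 1 j + c * (t 2 - t 1))) := by
    intro y hy
    obtain ⟨i, j, hj, h⟩ := hcov y hy
    fin_cases i
    · exact Or.inl ⟨j, hj, h⟩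
    · exact Or.inr ⟨j, hj, h⟩
  clear hsub hdisj hup htop hcov
  rw [ht0, ht1] at hsub0 hd00 hup0 htop00
  rw [ht1, ht2] at hsub1 hd11 hup1 htop11
  rw [ht0, ht1, ht2] at hd01 htop01 htop10
  simp only [ht0, ht1, ht2] at hcov'
  have e0 : c * (1 - α - 0) = c * (1 - α) := by ring
  have e1 : c * (1 - (1 - α)) = c * α := by ring
  simp only [e0, e1] at hsub0 hsub1 hd00 hd01 hd11 hcov'
  clear hpos htl ht0 ht1 ht2 hlt1 hlt2 htm t
  have hSlow : ∀ x, 0 ≤ x → x < 1 - α → S x = x + α := by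
    intro x hx hx'
    rw [hSα x ⟨hx, by linarith⟩, Int.fract_eq_self.2 ⟨by linarith, by linarith⟩]
  have hShigh : ∀ x, 1 - α ≤ x → x < 1 → S x = x + α - 1 := by
    intro x hx hx'
    rw [hSα x ⟨by linarith, by linarith⟩, Int.fract_eq_iff]
    exact ⟨by linarith, by linarith, 1, by push_cast; ring⟩
  -- arithmetic
  obtain ⟨a, b, hab, ea, eb⟩ := Nat.exists_coprime m1 m2
  rw [← hd, mul_comm] at ea eb
  have hdpos : 0 < d := by rw [hd]; exact Nat.gcd_pos_of_pos_left _ hm1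
  have ha : 0 < a := Nat.pos_of_ne_zero (by rintro rfl; simp at ea; omega)
  have hb : 0 < b := Nat.pos_of_ne_zero (by rintro rfl; simp at eb; omega)
  have hdR : (0 : ℝ) < d := by exact_mod_cast hdpos
  clear hd
  subst ea eb
  have hL : c * d * (a * (1 - α) + b * α) = 1 := by
    push_cast at htot
    linear_combination htot
  obtain ⟨u, w, z, α', huw, hα', hα'0, hα'1⟩ := exists_angle a b ha hb hab
    (c * d * (1 - α)) (c * d * α) (by positivity) (by positivity) (by linear_combination hL)
  refine ⟨rot3 1 α', rot3 (1 / d) (α' / d), rot3_isRotation α' hα'0 hα'1,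
    rot3_tower α' hα'0 hα'1 d hdpos, ?_⟩
  set e : ℝ → ℤ → ℝ := fun x n => if x < 1 - α then A 0 n.toNat + c * x else
    (A 1 n.toNat - c * (1 - α)) + c * x with he
  have elow : ∀ x n, x < 1 - α → e x n = A 0 n.toNat + c * x := fun x n h => if_pos h
  have ehigh : ∀ x n, 1 - α ≤ x → e x n = A 1 n.toNat + c * (x - (1 - α)) := by
    intro x n h
    simp only [he]
    rw [if_neg (not_lt.2 h)]; ring
  have mlow : ∀ x n, 0 ≤ x → x < 1 - α →
      e x n ∈ Set.Ico (A 0 n.toNat) (A 0 n.toNat + c * (1 - α)) := by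
    intro x n h h'
    rw [elow x n h']
    constructor
    · have := mul_nonneg hc.le h
      linarith
    · have := mul_lt_mul_of_pos_left h' hc
      linarith
  have mhigh : ∀ x n, 1 - α ≤ x → x < 1 - α + α →
      e x n ∈ Set.Ico (A 1 n.toNat) (A 1 n.toNat + c * α) := by
    intro x n h h'
    rw [ehigh x n h]
    constructor
    · have := mul_nonneg hc.le (sub_nonneg.2 h)
      linarith
    · have : c * (x - (1 - α)) < c * α := mul_lt_mul_of_pos_left (by linarith) hc
      linarith
  refine main_abs T d a b hdpos ha hb u w z (1 - α) α c α' hl1 hα0 hc hL huw hα' hα'0 hα'1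
    (fun n => A 0 n.toNat) (fun n => A 1 n.toNat - c * (1 - α)) e (fun x n => rfl)
    ?_ ?_ ?_ hTid ?_
  · rintro x n (⟨i1, i2, i3, i4⟩ | ⟨i1, i2, i3, i4⟩)
    · exact hsub0 n.toNat (by omega) (mlow x n i1 i2)
    · exact hsub1 n.toNat (by omega) (mhigh x n i1 i2)
  · intro y hy
    rcases hcov' y hy with ⟨j, hj, h1, h2⟩ | ⟨j, hj, h1, h2⟩
    · have k1 : 0 ≤ (y - A 0 j) / c := div_nonneg (by linarith) hc.le
      have k2 : (y - A 0 j) / c < 1 - α := by rw [div_lt_iff₀ hc]; linarith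
      refine ⟨(y - A 0 j) / c, j, Or.inl ⟨k1, k2, by omega, by exact_mod_cast hj⟩, ?_⟩
      rw [elow _ _ k2, Int.toNat_natCast]
      field_simp; ring
    · have k1 : 0 ≤ (y - A 1 j) / c := div_nonneg (by linarith) hc.le
      have k2 : (y - A 1 j) / c < α := by rw [div_lt_iff₀ hc]; linarith
      refine ⟨1 - α + (y - A 1 j) / c, j,
        Or.inr ⟨by linarith, by linarith, by omega, by exact_mod_cast hj⟩, ?_⟩
      rw [ehigh _ _ (by linarith), Int.toNat_natCast]
      field_simp; ring
  · rintro x n x' n' (⟨i1, i2, i3, i4⟩ | ⟨i1, i2, i3, i4⟩) (⟨j1, j2, j3, j4⟩ | ⟨j1, j2, j3, j4⟩) h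
    · have hn : n = n' := by
        by_contra hne
        exact Set.disjoint_left.1 (hd00 n.toNat n'.toNat (by omega) (by omega)
          (by rw [Ne, Prod.mk.injEq]; omega)) (mlow x n i1 i2) (h ▸ mlow x' n' j1 j2)
      subst hn
      rw [elow x n i2, elow x' n j2] at h
      exact ⟨mul_left_cancel₀ hc.ne' (by linarith), rfl⟩
    · exfalso
      exact Set.disjoint_left.1 (hd01 n.toNat n'.toNat (by omega) (by omega)
          (by simp)) (mlow x n i1 i2) (h ▸ mhigh x' n' j1 j2)
    · exfalso
      exact Set.disjoint_left.1 (hd01 n'.toNat n.toNat (by omega) (by omega)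
          (by simp)) (mlow x' n' j1 j2) (h ▸ mhigh x n i1 i2)
    · have hn : n = n' := by
        by_contra hne
        exact Set.disjoint_left.1 (hd11 n.toNat n'.toNat (by omega) (by omega)
          (by rw [Ne, Prod.mk.injEq]; omega)) (mhigh x n i1 i2) (h ▸ mhigh x' n' j1 j2)
      subst hn
      rw [ehigh x n i1, ehigh x' n j1] at h
      have := mul_left_cancel₀ hc.ne' (show c * (x - (1 - α)) = c * (x' - (1 - α)) by linarith)
      exact ⟨by linarith, rfl⟩
  · rintro x n (⟨i1, i2, i3, i4⟩ | ⟨i1, i2, i3, i4⟩)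
    · by_cases hn : n + 1 < ((d * a : ℕ) : ℤ)
      · refine ⟨0, 0, x, n + 1, by push_cast; ring, by ring,
          Or.inl ⟨i1, i2, by omega, hn⟩, ?_⟩
        have := hup0 n.toNat (by omega) x ⟨i1, i2⟩
        rw [elow x n i2, elow x _ i2, show (n + 1).toNat = n.toNat + 1 by omega]
        rw [sub_zero] at this
        exact this
      · have hn' : n.toNat = d * a - 1 := by omega
        have hSx := hSlow x i1 i2
        rw [elow x n i2, hn']
        by_cases hx : x + α < 1 - α
        · refine ⟨1, 0, x + α, 0, by push_cast; ring, by omega,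
            Or.inl ⟨by linarith, hx, le_rfl, by omega⟩, ?_⟩
          have := htop00 x ⟨i1, i2⟩ (by rw [hSx]; exact ⟨by linarith, hx⟩)
          rw [sub_zero, sub_zero, hSx] at this
          rw [this, elow _ _ hx]; rfl
        · refine ⟨1, 0, x + α, 0, by push_cast; ring, by omega,
            Or.inr ⟨by linarith, by linarith, le_rfl, by omega⟩, ?_⟩
          have := htop01 x ⟨i1, i2⟩ (by rw [hSx]; exact ⟨by linarith, by linarith⟩)
          rw [sub_zero, hSx] at this
          rw [this, ehigh _ _ (by linarith)]; rfl
    · have i2' : x < 1 := by linarith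
      by_cases hn : n + 1 < ((d * b : ℕ) : ℤ)
      · refine ⟨0, 0, x, n + 1, by push_cast; ring, by ring,
          Or.inr ⟨i1, i2, by omega, hn⟩, ?_⟩
        have := hup1 n.toNat (by omega) x ⟨i1, i2'⟩
        rw [ehigh x n i1, ehigh x _ i1, show (n + 1).toNat = n.toNat + 1 by omega]
        exact this
      · have hn' : n.toNat = d * b - 1 := by omega
        have hSx := hShigh x i1 i2'
        rw [ehigh x n i1, hn']
        by_cases hx : x + α - 1 < 1 - α
        · refine ⟨0, 1, x + α - 1, 0, by push_cast; ring, by omega,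
            Or.inl ⟨by linarith, hx, le_rfl, by omega⟩, ?_⟩
          have := htop10 x ⟨i1, i2'⟩ (by rw [hSx]; exact ⟨by linarith, hx⟩)
          rw [sub_zero, hSx] at this
          rw [this, elow _ _ hx]; rfl
        · refine ⟨0, 1, x + α - 1, 0, by push_cast; ring, by omega,
            Or.inr ⟨by linarith, by linarith, le_rfl, by omega⟩, ?_⟩
          have := htop11 x ⟨i1, i2'⟩ (by rw [hSx]; exact ⟨by linarith, by linarith⟩)
          rw [hSx] at this
          rw [this, ehigh _ _ (by linarith)]; rfl

end IETRoots
end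

section
/- Let T be a tower of type (m_1, m_2) over a rotation. If m_1 and m_2 are relatively prime, then T is conjugate in 𝔾 to a rotation. -/
open Set

namespace IETRoots

/-- The points of the tower in base coordinates. -/
def Dom (α : ℝ) (m1 m2 : ℕ) (x : ℝ) (j : ℕ) : Prop :=
  (0 ≤ x ∧ x < 1 - α ∧ j < m1) ∨ (1 - α ≤ x ∧ x < 1 ∧ j < m2)

lemma dom_no_pos (α : ℝ) (m1 m2 : ℕ) (h0 : 0 < α) (h1 : α < 1) (x x' : ℝ) (j j' : ℕ)
    (hx : Dom α m1 m2 x j) (hx' : Dom α m1 m2 x' j') (u v : ℤ) (hu : 0 ≤ u)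
    (hxx : x' - x = u * α + v * (α - 1)) (hjj : (j' : ℤ) - j = - m1 * u - m2 * v) :
    u = 0 ∧ v ≤ 0 := by
  have hx0 : 0 ≤ x ∧ x < 1 := by
    rcases hx with h | h <;> constructor <;> linarith [h.1, h.2.1]
  have hx0' : 0 ≤ x' ∧ x' < 1 := by
    rcases hx' with h | h <;> constructor <;> linarith [h.1, h.2.1]
  rcases hu.eq_or_lt with hu | hu
  · subst hu
    refine ⟨rfl, ?_⟩
    by_contra hv
    have hv1 : 1 ≤ v := by omega
    have hvr : (1 : ℝ) ≤ v := by exact_mod_cast hv1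
    rcases hx with h | h
    · simp only [Int.cast_zero] at hxx
      nlinarith [h.2.1]
    · have := h.2.2
      have h2 : (j : ℤ) < m2 := by exact_mod_cast this
      nlinarith [Int.natCast_nonneg j', Int.natCast_nonneg m2]
  · exfalso
    have hu1 : 1 ≤ u := hu
    have hur : (1 : ℝ) ≤ u := by exact_mod_cast hu1
    rcases lt_trichotomy v 0 with hv | hv | hv
    · have hvr : (v : ℝ) ≤ -1 := by
        have : v ≤ -1 := by omega
        exact_mod_cast this
      nlinarith
    · subst hv
      rcases hx with h | h
      · have h2 : (j : ℤ) < m1 := by exact_mod_cast h.2.2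
        nlinarith [Int.natCast_nonneg j', Int.natCast_nonneg m1]
      · simp only [Int.cast_zero] at hxx
        nlinarith [h.1]
    · have h3 : (j : ℤ) < m1 + m2 := by
        rcases hx with h | h
        · have := h.2.2
          omega
        · have := h.2.2
          omega
      nlinarith [Int.natCast_nonneg j', Int.natCast_nonneg m1, Int.natCast_nonneg m2]

lemma dom_inj (α c θ : ℝ) (m1 m2 : ℕ) (p q : ℤ) (h0 : 0 < α) (h1 : α < 1) (hc : 0 < c)
    (e1 : m1 * θ = c * α + p) (e2 : m2 * θ = c * α - c + q)
    (hdet : (m1 : ℤ) * q - m2 * p = 1) (x x' : ℝ) (j j' : ℕ)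
    (hx : Dom α m1 m2 x j) (hx' : Dom α m1 m2 x' j')
    (h : Int.fract (c * x + j * θ) = Int.fract (c * x' + j' * θ)) : x = x' ∧ j = j' := by
  obtain ⟨k, hk⟩ := Int.fract_eq_fract.1 h.symm
  -- `k = -p u - q v`, `n = - m1 u - m2 v`
  set n : ℤ := (j' : ℤ) - j with hn
  have hnr : (n : ℝ) = (j' : ℝ) - j := by simp [hn]
  obtain ⟨u, hu⟩ : ∃ u : ℤ, u = m2 * k - q * n := ⟨_, rfl⟩
  obtain ⟨v, hv⟩ : ∃ v : ℤ, v = p * n - m1 * k := ⟨_, rfl⟩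
  have hnn : n = - m1 * u - m2 * v := by
    rw [hu, hv]; linear_combination (-n) * hdet
  have hkk : k = - p * u - q * v := by
    rw [hu, hv]; linear_combination (-k) * hdet
  have hxx : x' - x = u * α + v * (α - 1) := by
    have hnn' : (n : ℝ) = - m1 * u - m2 * v := by exact_mod_cast hnn
    have hkk' : (k : ℝ) = - p * u - q * v := by exact_mod_cast hkk
    have : c * (x' - x) = c * (u * α + v * (α - 1)) := by
      linear_combination hk + θ * hnr - θ * hnn' + hkk' + (u : ℝ) * e1 + (v : ℝ) * e2
    exact mul_left_cancel₀ hc.ne' this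
  have hboth : u = 0 ∧ v = 0 := by
    rcases le_total 0 u with hu0 | hu0
    · have A := dom_no_pos α m1 m2 h0 h1 x x' j j' hx hx' u v hu0 hxx hnn
      have B := dom_no_pos α m1 m2 h0 h1 x' x j' j hx' hx (-u) (-v) (by omega)
        (by push_cast; linarith) (by linarith)
      omega
    · have B := dom_no_pos α m1 m2 h0 h1 x' x j' j hx' hx (-u) (-v) (by omega)
        (by push_cast; linarith) (by linarith)
      have A := dom_no_pos α m1 m2 h0 h1 x x' j j' hx hx' u v (by omega) hxx hnn
      omega
  obtain ⟨rfl, rfl⟩ := hboth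
  rw [← hu, ← hv] at *
  constructor
  · simp at hxx; linarith
  · simp at hnn; omega

lemma dom_up (α c θ : ℝ) (m1 m2 : ℕ) (p q : ℤ)
    (hm1 : 0 < m1) (hm2 : 0 < m2)
    (e1 : m1 * θ = c * α + p) (e2 : m2 * θ = c * α - c + q) (y : ℝ) (h1 : α < 1) (h0 : 0 < α) :
    ∀ (N : ℕ) (x : ℝ) (j : ℤ), -(N : ℤ) ≤ j → 0 ≤ x → x < 1 →
      Int.fract (c * x + j * θ) = y →
      ∃ (x : ℝ) (j : ℕ), 0 ≤ x ∧ x < 1 ∧ Int.fract (c * x + j * θ) = y := by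
  intro N
  induction N with
  | zero =>
    intro x j hj hx hx1 h
    lift j to ℕ using (by simpa using hj)
    exact ⟨x, j, hx, hx1, by exact_mod_cast h⟩
  | succ N ih =>
    intro x j hj hx hx1 h
    push_cast at hj
    by_cases hxa : α ≤ x
    · refine ih (x - α) (j + m1) (by omega) (by linarith) (by linarith) ?_
      rw [← h, Int.fract_eq_fract]
      refine ⟨p, ?_⟩
      push_cast
      linear_combination e1
    · push Not at hxa
      refine ih (x + 1 - α) (j + m2) (by omega) (by linarith) (by linarith) ?_
      rw [← h, Int.fract_eq_fract]
      refine ⟨q, ?_⟩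
      push_cast
      linear_combination e2

lemma dom_down (α c θ : ℝ) (m1 m2 : ℕ) (p q : ℤ)
    (hm1 : 0 < m1) (hm2 : 0 < m2)
    (e1 : m1 * θ = c * α + p) (e2 : m2 * θ = c * α - c + q) (y : ℝ) (h1 : α < 1) (h0 : 0 < α) :
    ∀ (N : ℕ) (x : ℝ) (j : ℕ), j ≤ N → 0 ≤ x → x < 1 →
      Int.fract (c * x + j * θ) = y →
      ∃ (x : ℝ) (j : ℕ), Dom α m1 m2 x j ∧ Int.fract (c * x + j * θ) = y := by
  intro N
  induction N with
  | zero =>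
    intro x j hj hx hx1 h
    refine ⟨x, j, ?_, h⟩
    rcases lt_or_ge x (1 - α) with hxa | hxa
    · exact Or.inl ⟨hx, hxa, by omega⟩
    · exact Or.inr ⟨hxa, hx1, by omega⟩
  | succ N ih =>
    intro x j hj hx hx1 h
    rcases lt_or_ge x (1 - α) with hxa | hxa
    · by_cases hjm : j < m1
      · exact ⟨x, j, Or.inl ⟨hx, hxa, hjm⟩, h⟩
      · refine ih (x + α) (j - m1) (by omega) (by linarith) (by linarith) ?_
        rw [← h, Int.fract_eq_fract]
        refine ⟨-p, ?_⟩
        rw [Nat.cast_sub (by omega)]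
        push_cast
        linear_combination -e1
    · by_cases hjm : j < m2
      · exact ⟨x, j, Or.inr ⟨hxa, hx1, hjm⟩, h⟩
      · refine ih (x + α - 1) (j - m2) (by omega) (by linarith) (by linarith) ?_
        rw [← h, Int.fract_eq_fract]
        refine ⟨-q, ?_⟩
        rw [Nat.cast_sub (by omega)]
        push_cast
        linear_combination -e2

lemma dom_surj (α c θ : ℝ) (m1 m2 : ℕ) (p q : ℤ) (hm1 : 0 < m1) (hm2 : 0 < m2)
    (h0 : 0 < α) (h1 : α < 1) (hc : 0 < c)
    (e1 : m1 * θ = c * α + p) (e2 : m2 * θ = c * α - c + q) (y : ℝ) (hy : y ∈ unitI) :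
    ∃ (x : ℝ) (j : ℕ), Dom α m1 m2 x j ∧ Int.fract (c * x + j * θ) = y := by
  have hyf : Int.fract y = y := Int.fract_eq_self.2 hy
  set k : ℤ := ⌊y / c⌋ with hk
  have hstart : Int.fract (c * Int.fract (y / c) + ((k * (m1 - m2) : ℤ) : ℝ) * θ) = y := by
    conv_rhs => rw [← hyf]
    rw [Int.fract_eq_fract]
    refine ⟨k * (p - q), ?_⟩
    have : c * Int.fract (y / c) = y - c * k := by
      rw [Int.fract, mul_sub, mul_div_cancel₀ _ hc.ne']
    rw [this]
    push_cast
    linear_combination (k : ℝ) * e1 - (k : ℝ) * e2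
  obtain ⟨x, j, hx, hx1, h⟩ := dom_up α c θ m1 m2 p q hm1 hm2 e1 e2 y h1 h0
    (k * (m1 - m2)).natAbs (Int.fract (y / c)) (k * (m1 - m2)) (by omega)
    (Int.fract_nonneg _) (Int.fract_lt_one _) hstart
  exact dom_down α c θ m1 m2 p q hm1 hm2 e1 e2 y h1 h0 j x j le_rfl hx hx1 h

lemma iet_of_pieces {ι : Type*} [Fintype ι] (g : ℝ → ℝ) (hbij : Set.BijOn g unitI unitI)
    (hid : ∀ x, x ∉ unitI → g x = x) (l r κ : ι → ℝ)
    (hcov : ∀ y ∈ unitI, ∃ i, y ∈ Set.Ico (l i) (r i))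
    (hg : ∀ i, ∀ y ∈ Set.Ico (l i) (r i), y ∈ unitI → g y = Int.fract (y + κ i)) :
    IsIET g := by
  classical
  refine ⟨hbij, hid, ?_⟩
  set F : Finset ℝ := (insert 0 (insert 1 (Finset.univ.image r ∪
    Finset.univ.image (fun i => Int.fract (-κ i))))).filter (fun x => 0 ≤ x ∧ x ≤ 1) with hF
  have h0F : (0 : ℝ) ∈ F := by simp [hF]
  have h1F : (1 : ℝ) ∈ F := by simp [hF]
  have hFb : ∀ x ∈ F, 0 ≤ x ∧ x ≤ 1 := fun x hx => (Finset.mem_filter.1 hx).2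
  have hpos : 0 < F.card := Finset.card_pos.2 ⟨0, h0F⟩
  obtain ⟨k, hk⟩ : ∃ k, F.card = k + 1 := ⟨F.card - 1, by omega⟩
  have hmem : ∀ i, F.orderEmbOfFin hk i ∈ F := fun i => Finset.orderEmbOfFin_mem F hk i
  have hsurj : ∀ x ∈ F, ∃ i, F.orderEmbOfFin hk i = x := by
    intro x hx
    have : x ∈ Set.range (F.orderEmbOfFin hk) := by
      rw [Finset.range_orderEmbOfFin]; exact hx
    exact this
  refine ⟨k, fun i => F.orderEmbOfFin hk i, (F.orderEmbOfFin hk).strictMono, ?_, ?_, ?_⟩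
  · obtain ⟨i, hi⟩ := hsurj 0 h0F
    apply le_antisymm
    · rw [← hi]; exact (F.orderEmbOfFin hk).monotone (Fin.zero_le i)
    · exact (hFb _ (hmem _)).1
  · obtain ⟨i, hi⟩ := hsurj 1 h1F
    apply le_antisymm
    · exact (hFb _ (hmem _)).2
    · conv_lhs => rw [← hi]
      exact (F.orderEmbOfFin hk).monotone (Fin.le_last i)
  · intro i
    set u := F.orderEmbOfFin hk i.castSucc with hu
    set v := F.orderEmbOfFin hk i.succ with hv
    have huv : u < v := (F.orderEmbOfFin hk).strictMono (Fin.castSucc_lt_succ)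
    have hgap : ∀ w ∈ F, w ≤ u ∨ v ≤ w := by
      intro w hw
      obtain ⟨s, rfl⟩ := hsurj w hw
      rcases le_or_gt s i.castSucc with h | h
      · exact Or.inl ((F.orderEmbOfFin hk).monotone h)
      · exact Or.inr ((F.orderEmbOfFin hk).monotone (Fin.castSucc_lt_iff_succ_le.1 h))
    have hu0 : 0 ≤ u := (hFb _ (hmem _)).1
    have hv1 : v ≤ 1 := (hFb _ (hmem _)).2
    obtain ⟨s, hs⟩ := hcov u ⟨hu0, by linarith⟩
    have hvr : v ≤ r s := by
      by_cases hr : r s ≤ 1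
      · have : r s ∈ F := by
          simp only [hF, Finset.mem_filter]
          refine ⟨?_, by linarith [hs.2], hr⟩
          simp
        rcases hgap _ this with h | h
        · linarith [hs.2]
        · exact h
      · linarith
    set w := Int.fract (-κ s) with hw
    have hw0 : 0 ≤ w := Int.fract_nonneg _
    have hw1 : w < 1 := Int.fract_lt_one _
    have hwF : w ∈ F := by
      simp only [hF, Finset.mem_filter]
      refine ⟨?_, hw0, hw1.le⟩
      simp [hw]
    have hκ : κ s = - w - ⌊-κ s⌋ := by rw [hw, Int.fract]; ring
    have key : ∀ y ∈ Set.Ico u v, g y = Int.fract (y - w) := by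
      intro y hy
      rw [hg s y ⟨hs.1.trans hy.1, lt_of_lt_of_le hy.2 hvr⟩ ⟨hu0.trans hy.1, by linarith [hy.2]⟩,
        Int.fract_eq_fract]
      exact ⟨-⌊-κ s⌋, by push_cast; linarith⟩
    rcases hgap w hwF with h | h
    · refine ⟨-w, fun y hy => ?_⟩
      rw [key y hy, ← sub_eq_add_neg]
      exact Int.fract_eq_self.2 ⟨by linarith [hy.1], by linarith [hy.2]⟩
    · refine ⟨1 - w, fun y hy => ?_⟩
      rw [key y hy, ← Int.fract_add_one, Int.fract_eq_self.2 ⟨by linarith [hy.1], by linarith [hy.2]⟩]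
      ring

lemma rot_break (S : ℝ → ℝ) (α t : ℝ) (h0 : 0 < α) (h1 : α < 1) (ht0 : 0 < t) (ht1 : t < 1)
    (hS : ∀ x ∈ unitI, S x = Int.fract (x + α))
    (d : ℝ) (hd : ∀ x ∈ Set.Ico 0 t, S x = x + d)
    (d' : ℝ) (hd' : ∀ x ∈ Set.Ico t 1, S x = x + d') : t = 1 - α := by
  have hz : S (1 - α) = 0 := by
    rw [hS _ ⟨by linarith, by linarith⟩]; simp
  have hd0 : d = α := by
    have A := hd 0 ⟨le_rfl, ht0⟩
    rw [hS 0 ⟨le_rfl, by norm_num⟩, zero_add, zero_add,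
      Int.fract_eq_self.2 ⟨h0.le, h1⟩] at A
    exact A.symm
  rcases lt_trichotomy t (1 - α) with h | h | h
  · have A := hd' t ⟨le_rfl, ht1⟩
    rw [hS t ⟨ht0.le, ht1⟩, Int.fract_eq_self.2 ⟨by linarith, by linarith⟩] at A
    have B := hd' (1 - α) ⟨h.le, by linarith⟩
    linarith
  · exact h
  · have A := hd (1 - α) ⟨by linarith, h⟩
    linarith

lemma tower_volume (l : Fin 2 → ℝ) (hl : ∀ i, 0 ≤ l i) (n : Fin 2 → ℕ) (a : Fin 2 → ℕ → ℝ)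
    (hsub : ∀ i, ∀ j, j < n i → Set.Ico (a i j) (a i j + l i) ⊆ unitI)
    (hdisj : ∀ i i' : Fin 2, ∀ j j' : ℕ, j < n i → j' < n i' → (i, j) ≠ (i', j') →
      Disjoint (Set.Ico (a i j) (a i j + l i)) (Set.Ico (a i' j') (a i' j' + l i')))
    (hcov : ∀ y ∈ unitI, ∃ (i : Fin 2) (j : ℕ), j < n i ∧ y ∈ Set.Ico (a i j) (a i j + l i)) :
    n 0 * l 0 + n 1 * l 1 = 1 := by
  have hU : unitI = ⋃ s : (Σ i : Fin 2, Fin (n i)),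
      Set.Ico (a s.1 s.2) (a s.1 s.2 + l s.1) := by
    ext y
    simp only [Set.mem_iUnion]
    constructor
    · intro hy
      obtain ⟨i, j, hj, h⟩ := hcov y hy
      exact ⟨⟨i, j, hj⟩, h⟩
    · rintro ⟨⟨i, j⟩, h⟩
      exact hsub i j j.2 h
  have hv : MeasureTheory.volume unitI = ENNReal.ofReal (n 0 * l 0 + n 1 * l 1) := by
    rw [hU, MeasureTheory.measure_iUnion]
    · rw [tsum_fintype, Fintype.sum_sigma]
      simp only [Real.volume_Ico, add_sub_cancel_left, Finset.sum_const, Finset.card_univ,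
        Fintype.card_fin, Fin.sum_univ_two, nsmul_eq_mul]
      rw [ENNReal.ofReal_add (mul_nonneg (Nat.cast_nonneg _) (hl 0))
        (mul_nonneg (Nat.cast_nonneg _) (hl 1)), ENNReal.ofReal_mul (Nat.cast_nonneg _),
        ENNReal.ofReal_mul (Nat.cast_nonneg _), ENNReal.ofReal_natCast, ENNReal.ofReal_natCast]
    · rintro ⟨i, j⟩ ⟨i', j'⟩ hne
      refine hdisj i i' j j' j.2 j'.2 ?_
      intro h
      apply hne
      obtain ⟨rfl, h2⟩ := Prod.mk.inj h
      rw [Fin.ext h2]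
    · intro s
      exact measurableSet_Ico
  rw [unitI, Real.volume_Ico] at hv
  have hnn : 0 ≤ (n 0 : ℝ) * l 0 + n 1 * l 1 :=
    add_nonneg (mul_nonneg (Nat.cast_nonneg _) (hl 0)) (mul_nonneg (Nat.cast_nonneg _) (hl 1))
  have := (ENNReal.ofReal_eq_ofReal_iff (by norm_num) hnn).1 hv
  linarith

theorem stmt12 (T S : ℝ → ℝ) (m1 m2 : ℕ)
    (hS : IsRotation S) (hT : IsTowerOver T ![m1, m2] S)
    (hcop : Nat.Coprime m1 m2) :
    ∃ R : ℝ → ℝ, IsRotation R ∧ IsConjugate T R := by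
  classical
  obtain ⟨-, α, ⟨h0, h1⟩, hSα⟩ := hS
  obtain ⟨hTI, hSI, hn, t, c, a, htm, ht0, ht2, hc, htr, hsub, hdisj, hcov, hup, htop⟩ := hT
  set n : Fin 2 → ℕ := ![m1, m2] with hndef
  have hn0 : n 0 = m1 := rfl
  have hn1 : n 1 = m2 := rfl
  have hm1 : 0 < m1 := hn 0
  have hm2 : 0 < m2 := hn 1
  -- the break point
  have hb0 : t (Fin.castSucc (0 : Fin 2)) = 0 := ht0
  have he1 : t (Fin.succ (1 : Fin 2)) = 1 := ht2
  have ht1 : t 1 = 1 - α := by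
    obtain ⟨d, hd⟩ := htr 0
    obtain ⟨d', hd'⟩ := htr 1
    rw [hb0] at hd
    rw [he1] at hd'
    have A : t 0 < t 1 := htm (by decide)
    have B : t 1 < t (Fin.last 2) := htm (by decide)
    rw [ht0] at A
    rw [ht2] at B
    exact rot_break S α (t 1) h0 h1 A B hSα d hd d' hd'
  have he0 : t (Fin.succ (0 : Fin 2)) = 1 - α := ht1
  have hb1 : t (Fin.castSucc (1 : Fin 2)) = 1 - α := ht1
  obtain ⟨b, hb⟩ : ∃ b : Fin 2 → ℝ, ∀ i, t i.castSucc = b i := ⟨_, fun _ => rfl⟩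
  obtain ⟨e, he⟩ : ∃ e : Fin 2 → ℝ, ∀ i, t i.succ = e i := ⟨_, fun _ => rfl⟩
  simp only [hb, he] at *
  have hvol := tower_volume (fun i => c * (e i - b i))
    (by
      intro i
      fin_cases i
      · simp only [Fin.zero_eta, he0, hb0]; nlinarith
      · simp only [Fin.mk_one, he1, hb1]; nlinarith) n a hsub hdisj hcov
  simp only [he0, hb0, he1, hb1, hn0, hn1] at hvol
  -- the angle
  obtain ⟨p, q, hdet⟩ : ∃ p q : ℤ, (m1 : ℤ) * q - m2 * p = 1 := by
    have := Nat.isCoprime_iff_coprime.2 hcop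
    obtain ⟨A, B, hAB⟩ := this
    exact ⟨-B, A, by linarith⟩
  have hdetr : (m1 : ℝ) * q - m2 * p = 1 := by exact_mod_cast hdet
  have hm1r : (1 : ℝ) ≤ m1 := by exact_mod_cast hm1
  have hm2r : (1 : ℝ) ≤ m2 := by exact_mod_cast hm2
  obtain ⟨θ, e1⟩ : ∃ θ : ℝ, m1 * θ = c * α + p :=
    ⟨(c * α + p) / m1, mul_div_cancel₀ _ (by positivity)⟩
  have e2 : m2 * θ = c * α - c + q := by
    have : (m1 : ℝ) * (m2 * θ) = m1 * (c * α - c + q) := by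
      linear_combination (m2 : ℝ) * e1 + hvol - hdetr
    exact mul_left_cancel₀ (by positivity) this
  have hca : c * α < 1 := by
    have A : 0 < c * (1 - α) := mul_pos hc (by linarith)
    have B : 0 < c * α := mul_pos hc h0
    nlinarith
  have hθ : Int.fract θ ≠ 0 := by
    intro h
    obtain ⟨z, hz⟩ := Int.fract_eq_zero_iff.1 h
    have A : c * α = ((m1 * z - p : ℤ) : ℝ) := by push_cast; rw [hz]; linarith
    have B : 0 < c * α := mul_pos hc h0
    rw [A] at B hca
    have B' : 0 < (m1 * z - p : ℤ) := by exact_mod_cast B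
    have C' : (m1 * z - p : ℤ) < 1 := by exact_mod_cast hca
    omega
  set R : ℝ → ℝ := fun x => if x ∈ unitI then Int.fract (x + θ) else x with hR
  refine ⟨R, ⟨fun x hx => by simp [hR, hx], Int.fract θ,
    ⟨lt_of_le_of_ne (Int.fract_nonneg _) hθ.symm, Int.fract_lt_one _⟩, fun x hx => ?_⟩, ?_⟩
  · simp only [hR, hx, if_true]
    rw [Int.fract_eq_fract]
    exact ⟨⌊θ⌋, by rw [Int.fract]; ring⟩
  -- the conjugacy
  have hcov' : ∀ y : ℝ, ∃ s : Fin 2 × ℕ, y ∈ unitI → s.2 < n s.1 ∧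
      y ∈ Set.Ico (a s.1 s.2) (a s.1 s.2 + c * (e s.1 - b s.1)) := by
    intro y
    by_cases hy : y ∈ unitI
    · obtain ⟨i, j, hj, h⟩ := hcov y hy
      exact ⟨(i, j), fun _ => ⟨hj, h⟩⟩
    · exact ⟨(0, 0), fun h => absurd h hy⟩
  choose lev hlev using hcov'
  obtain ⟨κ, hκ⟩ : ∃ κ : Fin 2 → ℕ → ℝ, ∀ i j, κ i j = c * b i - a i j + j * θ :=
    ⟨_, fun _ _ => rfl⟩
  set g : ℝ → ℝ := fun y =>
    if y ∈ unitI then Int.fract (y + κ (lev y).1 (lev y).2) else y with hgdef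
  have hg : ∀ i j, j < n i → ∀ y ∈ Set.Ico (a i j) (a i j + c * (e i - b i)),
      g y = Int.fract (y + κ i j) := by
    intro i j hj y hy
    have hyU := hsub i j hj hy
    have hs : lev y = (i, j) := by
      by_contra hne
      obtain ⟨A, B⟩ := hlev y hyU
      exact Set.disjoint_left.1 (hdisj _ _ _ _ A hj hne) B hy
    simp only [hgdef, hyU, if_true, hs]
  have hlevmem : ∀ i j x, x ∈ Set.Ico (b i) (e i) →
      a i j + c * (x - b i) ∈ Set.Ico (a i j) (a i j + c * (e i - b i)) := by
    intro i j x hx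
    have A : 0 ≤ c * (x - b i) := mul_nonneg hc.le (by linarith [hx.1])
    have B : c * (x - b i) < c * (e i - b i) := mul_lt_mul_of_pos_left (by linarith [hx.2]) hc
    exact ⟨by linarith, by linarith⟩
  have hgx : ∀ i j x, j < n i → x ∈ Set.Ico (b i) (e i) →
      g (a i j + c * (x - b i)) = Int.fract (c * x + j * θ) := by
    intro i j x hj hx
    rw [hg i j hj _ (hlevmem i j x hx), hκ]
    congr 1
    ring
  have hcoord : ∀ y ∈ unitI, ∃ i j x, j < n i ∧ x ∈ Set.Ico (b i) (e i) ∧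
      y = a i j + c * (x - b i) := by
    intro y hy
    obtain ⟨i, j, hj, h⟩ := hcov y hy
    refine ⟨i, j, b i + (y - a i j) / c, hj, ⟨?_, ?_⟩, ?_⟩
    · have : 0 ≤ (y - a i j) / c := div_nonneg (by linarith [h.1]) hc.le
      linarith
    · have : (y - a i j) / c < e i - b i := by
        rw [div_lt_iff₀ hc]; linarith [h.2]
      linarith
    · field_simp
      ring
  have hdom : ∀ i j x, j < n i → x ∈ Set.Ico (b i) (e i) → Dom α m1 m2 x j := by
    intro i j x hj hx
    fin_cases i
    · simp only [Fin.zero_eta, he0, hb0, hn0] at hx hj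
      exact Or.inl ⟨hx.1, hx.2, hj⟩
    · simp only [Fin.mk_one, he1, hb1, hn1] at hx hj
      exact Or.inr ⟨hx.1, hx.2, hj⟩
  have hdom' : ∀ j x, Dom α m1 m2 x j → ∃ i, j < n i ∧ x ∈ Set.Ico (b i) (e i) := by
    rintro j x (h | h)
    · exact ⟨0, h.2.2, by rw [hb0, he0]; exact ⟨h.1, h.2.1⟩⟩
    · exact ⟨1, h.2.2, by rw [hb1, he1]; exact ⟨h.1, h.2.1⟩⟩
  have hIuniq : ∀ i i' x, x ∈ Set.Ico (b i) (e i) → x ∈ Set.Ico (b i') (e i') → i = i' := by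
    intro i i' x hx hx'
    have aux : x ∈ Set.Ico (b 0) (e 0) → x ∈ Set.Ico (b 1) (e 1) → False := by
      intro A B
      rw [he0] at A
      rw [hb1] at B
      linarith [A.2, B.1]
    fin_cases i <;> fin_cases i'
    · rfl
    · exact (aux hx hx').elim
    · exact (aux hx' hx).elim
    · rfl
  have hmaps : ∀ y ∈ unitI, g y ∈ unitI := by
    intro y hy
    simp only [hgdef, hy, if_true]
    exact ⟨Int.fract_nonneg _, Int.fract_lt_one _⟩
  have hgI : IsIET g := by
    refine iet_of_pieces (ι := Σ i : Fin 2, Fin (n i)) g ⟨hmaps, ?_, ?_⟩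
      (fun x hx => by simp [hgdef, hx])
      (fun s => a s.1 s.2) (fun s => a s.1 s.2 + c * (e s.1 - b s.1)) (fun s => κ s.1 s.2)
      ?_ ?_
    · intro y hy y' hy' hyy
      obtain ⟨i, j, x, hj, hx, rfl⟩ := hcoord y hy
      obtain ⟨i', j', x', hj', hx', rfl⟩ := hcoord y' hy'
      rw [hgx i j x hj hx, hgx i' j' x' hj' hx'] at hyy
      obtain ⟨rfl, rfl⟩ := dom_inj α c θ m1 m2 p q h0 h1 hc e1 e2 hdet x x' j j'
        (hdom i j x hj hx) (hdom i' j' x' hj' hx') hyy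
      rw [hIuniq i i' x hx hx']
    · intro y hy
      obtain ⟨x, j, hD, hxy⟩ := dom_surj α c θ m1 m2 p q hm1 hm2 h0 h1 hc e1 e2 y hy
      obtain ⟨i, hj, hx⟩ := hdom' j x hD
      exact ⟨a i j + c * (x - b i), hsub i j hj (hlevmem i j x hx), by
        rw [hgx i j x hj hx, hxy]⟩
    · intro y hy
      obtain ⟨i, j, hj, h⟩ := hcov y hy
      exact ⟨⟨i, j, hj⟩, h⟩
    · rintro ⟨i, j⟩ y hy -
      exact hg i j j.2 y hy
  refine ⟨g, hgI, ?_⟩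
  funext y
  simp only [Function.comp]
  by_cases hy : y ∈ unitI
  · have hRg : R (g y) = Int.fract (g y + θ) := by simp only [hR, hmaps y hy, if_true]
    rw [hRg]
    obtain ⟨i, j, x, hj, hx, rfl⟩ := hcoord y hy
    have hfr : Int.fract (Int.fract (c * x + j * θ) + θ) = Int.fract (c * x + (j + 1) * θ) := by
      rw [Int.fract_eq_fract]
      exact ⟨-⌊c * x + j * θ⌋, by rw [Int.fract]; push_cast; ring⟩
    rw [hgx i j x hj hx, hfr]
    by_cases hj1 : j + 1 < n i
    · rw [hup i j hj1 x hx, hgx i (j + 1) x hj1 hx]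
      push_cast
      rfl
    · have hjn : j = n i - 1 := by omega
      have hjr : (j : ℝ) + 1 = n i := by
        have : j + 1 = n i := by omega
        exact_mod_cast this
      have hxU : x ∈ unitI := by
        rcases hdom i j x hj hx with h | h <;> constructor <;> linarith [h.1, h.2.1]
      have hSU : S x ∈ unitI := hSI.1.mapsTo hxU
      obtain ⟨i', hi'⟩ : ∃ i', S x ∈ Set.Ico (b i') (e i') := by
        rcases lt_or_ge (S x) (1 - α) with h | h
        · exact ⟨0, by rw [hb0, he0]; exact ⟨hSU.1, h⟩⟩
        · exact ⟨1, by rw [hb1, he1]; exact ⟨h, hSU.2⟩⟩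
      have hT' := htop i x hx i' hi'
      rw [← hjn] at hT'
      rw [hT', hgx i' 0 (S x) (hn i') hi', hjr, hSα x hxU, Int.fract_eq_fract]
      fin_cases i
      · simp only [Fin.zero_eta, hb0, he0] at hx
        refine ⟨-p, ?_⟩
        rw [Int.fract_eq_self.2 ⟨by linarith [hx.1], by linarith [hx.2]⟩]
        simp only [Fin.zero_eta, hn0]
        push_cast
        linear_combination -e1
      · simp only [Fin.mk_one, hb1, he1] at hx
        refine ⟨-q, ?_⟩
        have hf : Int.fract (x + α) = x + α - 1 := by
          rw [← Int.fract_sub_one]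
          exact Int.fract_eq_self.2 ⟨by linarith [hx.1], by linarith [hx.2]⟩
        rw [hf]
        simp only [Fin.mk_one, hn1]
        push_cast
        linear_combination -e2
  · have hTy : T y = y := hTI.2.1 y hy
    rw [hTy]
    simp [hgdef, hR, hy]

end IETRoots
end

section
/- Let T be a minimal interval exchange transformation with precisely m−1 points of discontinuity. If there exist an interval exchange transformation S and an integer n ≥ 2 such that T = S^n, then the number of maximal S-chains is at most ⌊m/2⌋. -/
open Set

namespace IETRoots

/-- Left germ relation: `S (x⁻) = y⁻`, with `S` a translation to the left of `x`. -/
def LGerm (S : ℝ → ℝ) (x y : ℝ) : Prop :=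
  ∃ ε > 0, ∀ t, 0 < t → t < ε → S (x - t) = y - t

lemma LGerm.comp {S S' : ℝ → ℝ} {x y z : ℝ} (h : LGerm S x y) (h' : LGerm S' y z) :
    LGerm (S' ∘ S) x z := by
  obtain ⟨e, he, h⟩ := h
  obtain ⟨e', he', h'⟩ := h'
  refine ⟨min e e', lt_min he he', fun t ht ht' => ?_⟩
  have := lt_min_iff.1 ht'
  simp only [Function.comp]
  rw [h t ht this.1, h' t ht this.2]

lemma LGerm.unique {S : ℝ → ℝ} {x y z : ℝ} (h : LGerm S x y) (h' : LGerm S x z) : y = z := by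
  obtain ⟨e, he, h⟩ := h
  obtain ⟨e', he', h'⟩ := h'
  have hm : 0 < min e e' := lt_min he he'
  have h1 := h (min e e' / 2) (by linarith) (by linarith [min_le_left e e'])
  have h2 := h' (min e e' / 2) (by linarith) (by linarith [min_le_right e e'])
  linarith

lemma LGerm.inj {S : ℝ → ℝ} (hS : InjOn S unitI) {x x' y : ℝ} (hx : x ∈ Ioc (0 : ℝ) 1)
    (hx' : x' ∈ Ioc (0 : ℝ) 1) (h : LGerm S x y) (h' : LGerm S x' y) : x = x' := by
  obtain ⟨e, he, h⟩ := h
  obtain ⟨e', he', h'⟩ := h'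
  obtain ⟨t, ht0, ht⟩ : ∃ t > 0, t < e ∧ t < e' ∧ t < x ∧ t < x' := by
    have hm : 0 < min (min e e') (min x x') :=
      lt_min (lt_min he he') (lt_min hx.1 hx'.1)
    obtain ⟨t, h0, h1⟩ := exists_between hm
    simp only [lt_min_iff] at h1
    exact ⟨t, h0, h1.1.1, h1.1.2, h1.2.1, h1.2.2⟩
  have h1 := h t ht0 ht.1
  have h2 := h' t ht0 ht.2.1
  have := hS (x₁ := x - t) (x₂ := x' - t)
    ⟨by linarith, by linarith [hx.2]⟩ ⟨by linarith, by linarith [hx'.2]⟩ (h1.trans h2.symm)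
  linarith

lemma LGerm.mem {S : ℝ → ℝ} (hS : MapsTo S unitI unitI) {x y : ℝ} (hx : x ∈ Ioc (0 : ℝ) 1)
    (h : LGerm S x y) : y ∈ Ioc (0 : ℝ) 1 := by
  obtain ⟨e, he, h⟩ := h
  have key : ∀ t, 0 < t → t < e → t < x → 0 ≤ y - t ∧ y - t < 1 := by
    intro t h0 h1 h2
    have := hS (x := x - t) ⟨by linarith, by linarith [hx.2]⟩
    rw [h t h0 h1] at this
    exact this
  have hm : 0 < min e x := lt_min he hx.1
  constructor
  · obtain ⟨t, h0, h1⟩ := exists_between hm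
    rw [lt_min_iff] at h1
    have := key t h0 h1.1 h1.2
    linarith
  · by_contra hy
    push Not at hy
    obtain ⟨t, h0, h1⟩ := exists_between (lt_min hm (sub_pos.2 hy))
    simp only [lt_min_iff] at h1
    have := key t h0 h1.1.1 h1.1.2
    linarith

lemma exists_piece_left : ∀ (k : ℕ) (β : Fin (k + 1) → ℝ) (x : ℝ), β 0 < x → x ≤ β (Fin.last k) →
    ∃ i : Fin k, β i.castSucc < x ∧ x ≤ β i.succ := by
  intro k
  induction k with
  | zero => intro β x h h'; exact absurd (h.trans_le h') (lt_irrefl _)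
  | succ k ih =>
    intro β x h h'
    by_cases hc : x ≤ β (Fin.last k).castSucc
    · obtain ⟨i, hi⟩ := ih (fun j => β j.castSucc) x h hc
      exact ⟨i.castSucc, hi⟩
    · exact ⟨Fin.last k, not_le.1 hc, h'⟩

lemma exists_piece_right : ∀ (k : ℕ) (β : Fin (k + 1) → ℝ) (x : ℝ), β 0 ≤ x → x < β (Fin.last k) →
    ∃ i : Fin k, β i.castSucc ≤ x ∧ x < β i.succ := by
  intro k
  induction k with
  | zero => intro β x h h'; exact absurd (h.trans_lt h') (lt_irrefl _)
  | succ k ih =>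
    intro β x h h'
    by_cases hc : x < β (Fin.last k).castSucc
    · obtain ⟨i, hi⟩ := ih (fun j => β j.castSucc) x h hc
      exact ⟨i.castSucc, hi⟩
    · exact ⟨Fin.last k, not_lt.1 hc, h'⟩

lemma IsIET.exists_lgerm {S : ℝ → ℝ} (hS : IsIET S) {x : ℝ} (hx : x ∈ Ioc (0 : ℝ) 1) :
    ∃ y ∈ Ioc (0 : ℝ) 1, LGerm S x y := by
  obtain ⟨hb, -, k, β, -, h0, h1, hc⟩ := id hS
  obtain ⟨i, hi, hi'⟩ := exists_piece_left k β x (h0 ▸ hx.1) (h1 ▸ hx.2)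
  obtain ⟨c, hc⟩ := hc i
  have h : LGerm S x (x + c) := by
    refine ⟨x - β i.castSucc, by linarith, fun t ht ht' => ?_⟩
    rw [hc (x - t) ⟨by linarith, by linarith⟩]
    ring
  exact ⟨_, h.mem hb.mapsTo hx, h⟩

lemma IsIET.exists_lgerm_iterate {S : ℝ → ℝ} (hS : IsIET S) (n : ℕ) :
    ∀ {x : ℝ}, x ∈ Ioc (0 : ℝ) 1 → ∃ y ∈ Ioc (0 : ℝ) 1, LGerm S^[n] x y := by
  induction n with
  | zero => intro x hx; exact ⟨x, hx, 1, one_pos, fun t _ _ => rfl⟩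
  | succ n ih =>
    intro x hx
    obtain ⟨y, hy, h⟩ := hS.exists_lgerm hx
    obtain ⟨z, hz, hyz⟩ := ih hy
    exact ⟨z, hz, by rw [Function.iterate_succ]; exact h.comp hyz⟩

/-- Continuity plus existence of a left germ pins the left germ. -/
lemma lgerm_of_cont {S : ℝ → ℝ} {x y : ℝ} (hx : x ∈ unitI) (hx0 : x ≠ 0) (h : LGerm S x y)
    (hc : ContinuousWithinAt S unitI x) : y = S x := by
  obtain ⟨e, he, h⟩ := h
  have hx1 : 0 < x := lt_of_le_of_ne hx.1 (Ne.symm hx0)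
  by_contra hne
  have hd : 0 < |y - S x| := abs_pos.2 (sub_ne_zero.2 hne)
  obtain ⟨d, hd0, hdd⟩ := Metric.continuousWithinAt_iff.1 hc (|y - S x| / 2) (by linarith)
  obtain ⟨t, ht0, ht⟩ := exists_between
    (lt_min (lt_min he hx1) (lt_min hd0 (show 0 < |y - S x| / 2 by linarith)))
  simp only [lt_min_iff] at ht
  have h1 := hdd (x := x - t) ⟨by linarith, by linarith [hx.2]⟩
    (by rw [Real.dist_eq, abs_lt]; constructor <;> linarith)
  rw [h t ht0 ht.1.1, Real.dist_eq] at h1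
  have h2 : |y - S x| ≤ |y - t - S x| + |t| := by
    calc |y - S x| = |(y - t - S x) + t| := by ring_nf
      _ ≤ _ := abs_add_le _ _
  rw [abs_of_pos ht0] at h2
  linarith

lemma IsIET.cont_of_lgerm {S : ℝ → ℝ} (hS : IsIET S) {x : ℝ} (hx : x ∈ unitI)
    (h : LGerm S x (S x)) : ContinuousWithinAt S unitI x := by
  obtain ⟨hb, -, k, β, -, h0, h1, hc⟩ := hS
  obtain ⟨i, hi, hi'⟩ := exists_piece_right k β x (h0 ▸ hx.1) (h1 ▸ hx.2)
  obtain ⟨c, hc⟩ := hc i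
  obtain ⟨e, he, h⟩ := h
  rw [Metric.continuousWithinAt_iff]
  intro r hr
  refine ⟨min r (min e (β i.succ - x)), lt_min hr (lt_min he (by linarith)), ?_⟩
  intro u _ hu
  rw [Real.dist_eq] at hu ⊢
  simp only [lt_min_iff] at hu
  obtain ⟨hu1, hu2, hu3⟩ := hu
  suffices S u - S x = u - x by rwa [this]
  rw [abs_lt] at hu2 hu3
  rcases lt_or_ge u x with hlt | hge
  · have := h (x - u) (by linarith) (by linarith)
    rw [sub_sub_cancel] at this
    rw [this]; ring
  · rw [hc u ⟨by linarith, by linarith⟩, hc x ⟨hi, hi'⟩]; ring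

/-- `D(S) ∪ {0}`. -/
def D0 (S : ℝ → ℝ) : Set ℝ := insert 0 (DiscSet S)

lemma D0_sub (S : ℝ → ℝ) : D0 S ⊆ unitI := by
  rintro x (rfl | h)
  · exact ⟨le_refl _, one_pos⟩
  · exact h.1

lemma lgerm_of_not_D0 {S : ℝ → ℝ} (hS : IsIET S) {x : ℝ} (hx : x ∈ unitI) (h : x ∉ D0 S) :
    LGerm S x (S x) := by
  have hx0 : x ≠ 0 := fun h0 => h (Or.inl h0)
  have hx1 : 0 < x := lt_of_le_of_ne hx.1 (Ne.symm hx0)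
  obtain ⟨y, hy, hl⟩ := hS.exists_lgerm ⟨hx1, hx.2.le⟩
  have hc : ContinuousWithinAt S unitI x := by
    by_contra hc
    exact h (Or.inr ⟨hx, hc⟩)
  rwa [← lgerm_of_cont hx hx0 hl hc]

lemma mem_iter {S : ℝ → ℝ} (hS : IsIET S) {x : ℝ} (hx : x ∈ unitI) (i : ℕ) :
    S^[i] x ∈ unitI := hS.1.mapsTo.iterate i hx

lemma lgerm_iterate {S : ℝ → ℝ} (hS : IsIET S) (k : ℕ) : ∀ {x : ℝ}, x ∈ unitI →
    (∀ i < k, S^[i] x ∉ D0 S) → LGerm S^[k] x (S^[k] x) := by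
  induction k with
  | zero => intro x _ _; exact ⟨1, one_pos, fun t _ _ => rfl⟩
  | succ k ih =>
    intro x hx h
    have h1 := lgerm_of_not_D0 hS hx (h 0 (Nat.succ_pos _))
    have h2 := ih (hS.1.mapsTo hx) (fun i hi => by
      have := h (i + 1) (by omega)
      rwa [Function.iterate_succ_apply] at this)
    rw [Function.iterate_succ]
    exact h1.comp h2

/-- Last points of chains are in `D(T) ∪ {0}`. -/
lemma last_mem {S : ℝ → ℝ} (hS : IsIET S) {n : ℕ} (hn : 2 ≤ n) {b : ℝ} (hb : b ∈ D0 S)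
    (h : ∀ j, 1 ≤ j → S^[j] b ∉ D0 S) : b ∈ D0 S^[n] := by
  by_cases hb0 : b = 0
  · exact Or.inl hb0
  refine Or.inr ⟨D0_sub S hb, fun hc => ?_⟩
  have hbI := D0_sub S hb
  have hb1 : b ∈ Ioc (0 : ℝ) 1 := ⟨lt_of_le_of_ne hbI.1 (Ne.symm hb0), hbI.2.le⟩
  have hd : b ∈ DiscSet S := hb.resolve_left hb0
  obtain ⟨k, rfl⟩ : ∃ k, n = k + 1 := ⟨n - 1, by omega⟩
  obtain ⟨y, hy, hl⟩ := hS.exists_lgerm hb1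
  obtain ⟨z, hz, hl'⟩ := hS.exists_lgerm_iterate k hy
  have hl2 : LGerm S^[k + 1] b z := by rw [Function.iterate_succ]; exact hl.comp hl'
  have hz' := lgerm_of_cont hbI hb0 hl2 hc
  have hsI : S b ∈ unitI := hS.1.mapsTo hbI
  have h3 := lgerm_iterate hS k hsI (fun i _ => by
    have := h (i + 1) (by omega)
    rwa [Function.iterate_succ_apply] at this)
  rw [Function.iterate_succ_apply] at hz'
  rw [← hz'] at h3
  have hs0 : S b ≠ 0 := fun h0 => h 1 le_rfl (Or.inl h0)
  have := LGerm.inj (hS.1.iterate k).injOn hy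
    ⟨lt_of_le_of_ne hsI.1 (Ne.symm hs0), hsI.2.le⟩ hl' h3
  rw [this] at hl
  exact hd.2 (hS.cont_of_lgerm hbI hl)

/-- `S^{-(n-1)}` of first points of chains are in `D(T) ∪ {0}`. -/
lemma first_mem {S : ℝ → ℝ} (hS : IsIET S) {n : ℕ} (hn : 2 ≤ n) {a y : ℝ} (ha : a ∈ D0 S)
    (hy : y ∈ unitI) (hya : S^[n - 1] y = a)
    (h : ∀ j, 1 ≤ j → ∀ u ∈ unitI, S^[j] u = a → u ∉ D0 S) : y ∈ D0 S^[n] := by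
  obtain ⟨k, rfl⟩ : ∃ k, n = k + 1 := ⟨n - 1, by omega⟩
  rw [Nat.add_sub_cancel] at hya
  have hyD : y ∉ D0 S := h k (by omega) y hy hya
  have hy0 : y ≠ 0 := fun h0 => hyD (Or.inl h0)
  have hl := lgerm_iterate hS k hy (fun i hi => h (k - i) (by omega) _ (mem_iter hS hy i) (by
    rw [← Function.iterate_add_apply, Nat.sub_add_cancel hi.le, hya]))
  rw [hya] at hl
  have ha1 := hl.mem (hS.1.iterate k).mapsTo ⟨lt_of_le_of_ne hy.1 (Ne.symm hy0), hy.2.le⟩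
  have hd : a ∈ DiscSet S := ha.resolve_left ha1.1.ne'
  refine Or.inr ⟨hy, fun hc => hd.2 ?_⟩
  obtain ⟨z, hz, hl'⟩ := hS.exists_lgerm ha1
  have hl2 : LGerm S^[k + 1] y z := by rw [Function.iterate_succ']; exact hl.comp hl'
  have hz' := lgerm_of_cont hy hy0 hl2 hc
  rw [Function.iterate_succ_apply', hya] at hz'
  rw [hz'] at hl'
  exact hS.cont_of_lgerm hd.1 hl'

/-- Set of a chain with first point `a` and length `k + 1`. -/
def chainSet (S : ℝ → ℝ) (a : ℝ) (k : ℕ) : Set ℝ := {z | ∃ i ≤ k, S^[i] a = z}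

lemma isSChain_iff (S : ℝ → ℝ) (C : Set ℝ) :
    IsSChain S C ↔ ∃ a k, a ∈ D0 S ∧ S^[k] a ∈ D0 S ∧ C = chainSet S a k := by
  constructor
  · rintro ⟨k, x, ⟨h0, h1, h2⟩, rfl⟩
    have key : ∀ i (hi : i < k + 1), x ⟨i, hi⟩ = S^[i] (x 0) := by
      intro i
      induction i with
      | zero => intro _; rfl
      | succ i ih =>
        intro hi
        rw [Function.iterate_succ_apply', ← ih (by omega)]
        exact (h2 ⟨i, by omega⟩).symm
    refine ⟨x 0, k, h0, ?_, ?_⟩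
    · rw [← key k (by omega)]; exact h1
    · ext z
      constructor
      · rintro ⟨i, rfl⟩
        exact ⟨i, by omega, (key i i.2).symm⟩
      · rintro ⟨i, hi, rfl⟩
        exact ⟨⟨i, by omega⟩, key i _⟩
  · rintro ⟨a, k, h0, h1, rfl⟩
    refine ⟨k, fun i => S^[i] a, ⟨h0, h1, fun i => ?_⟩, ?_⟩
    · simp [Function.iterate_succ_apply', -Function.iterate_succ]
    · ext z
      constructor
      · rintro ⟨i, hi, rfl⟩
        exact ⟨⟨i, by omega⟩, rfl⟩
      · rintro ⟨i, rfl⟩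
        exact ⟨i, by omega, rfl⟩

/-- Minimality of a power gives aperiodicity. -/
lemma aperiodic {S : ℝ → ℝ} (hS : IsIET S) {n : ℕ} (hmin : IsMinimal S^[n])
    {x : ℝ} (hx : x ∈ unitI) {p : ℕ} (hp : 1 ≤ p) : S^[p] x ≠ x := by
  intro hper
  have hper' : ∀ q, S^[p * q] x = x := by
    intro q
    rw [Function.iterate_mul]
    exact Function.iterate_fixed hper q
  have hsub : orbitZ S^[n] x ∩ unitI ⊆ (fun i => S^[i] x) '' (Finset.range p : Set ℕ) := by
    have red : ∀ N, S^[N] x ∈ (fun i => S^[i] x) '' (Finset.range p : Set ℕ) := by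
      intro N
      refine ⟨N % p, by simpa using Nat.mod_lt _ hp, ?_⟩
      conv_rhs => rw [← Nat.mod_add_div N p, Function.iterate_add_apply, hper']
    rintro y ⟨⟨N, h | h⟩, hy⟩
    · rw [← Function.iterate_mul] at h
      rw [← h]; exact red _
    · rw [← Function.iterate_mul] at h
      set M := n * N
      -- `y = S^{pM - M} x`
      have h1 : S^[M] (S^[p * M - M] x) = x := by
        rw [← Function.iterate_add_apply,
          Nat.add_sub_cancel' (Nat.le_mul_of_pos_left M hp), hper']
      have := (hS.1.iterate M).injOn hy (mem_iter hS hx _) (h.trans h1.symm)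
      rw [this]; exact red _
  have hfin : (orbitZ S^[n] x ∩ unitI).Finite := (Set.Finite.image _ (Finset.finite_toSet _)).subset hsub
  -- a finite set is closed, so `(0,1)` would be finite
  have hio : Ioo (0 : ℝ) 1 ⊆ orbitZ S^[n] x ∩ unitI := by
    intro u hu
    have hcl : u ∈ closure (orbitZ S^[n] x) := hmin x hx ⟨hu.1.le, hu.2⟩
    have h2 : u ∈ closure (orbitZ S^[n] x ∩ unitI) := by
      have := (isOpen_Ioo (a := (0:ℝ)) (b := 1)).inter_closure (t := orbitZ S^[n] x) ⟨hu, hcl⟩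
      refine closure_mono ?_ this
      rintro v ⟨hv, hv'⟩
      exact ⟨hv', hv.1.le, hv.2⟩
    rwa [hfin.isClosed.closure_eq] at h2
  exact (Set.Ioo_infinite (show (0:ℝ) < 1 by norm_num)) (hfin.subset hio)

lemma maximal_data {S : ℝ → ℝ} (hS : IsIET S) {n : ℕ} (hmin : IsMinimal S^[n])
    {C : Set ℝ} (hC : IsMaximalSChain S C) :
    ∃ a k, a ∈ D0 S ∧ S^[k] a ∈ D0 S ∧ C = chainSet S a k ∧
      (∀ j, 1 ≤ j → ∀ u ∈ unitI, S^[j] u = a → u ∉ D0 S) ∧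
      (∀ j, 1 ≤ j → S^[j] (S^[k] a) ∉ D0 S) := by
  obtain ⟨hch, hmax⟩ := hC
  obtain ⟨a, k, ha, hb, rfl⟩ := (isSChain_iff S C).1 hch
  refine ⟨a, k, ha, hb, rfl, ?_, ?_⟩
  · rintro j hj u hu rfl hD
    have h1 : IsSChain S (chainSet S u (k + j)) :=
      (isSChain_iff _ _).2 ⟨u, k + j, hD, by rwa [Function.iterate_add_apply], rfl⟩
    have h2 := hmax _ h1 (by
      rintro z ⟨i, hi, rfl⟩
      exact ⟨i + j, by omega, by rw [Function.iterate_add_apply]⟩)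
    have h3 : u ∈ chainSet S (S^[j] u) k := by
      rw [h2]; exact ⟨0, Nat.zero_le _, rfl⟩
    obtain ⟨i, hi, h4⟩ := h3
    rw [← Function.iterate_add_apply] at h4
    exact aperiodic hS hmin hu (by omega) h4
  · intro j hj hD
    have h1 : IsSChain S (chainSet S a (j + k)) :=
      (isSChain_iff _ _).2 ⟨a, j + k, ha, by rwa [Function.iterate_add_apply], rfl⟩
    have h2 := hmax _ h1 (by
      rintro z ⟨i, hi, rfl⟩
      exact ⟨i, by omega, rfl⟩)
    have h3 : S^[j + k] a ∈ chainSet S a k := by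
      rw [h2]; exact ⟨j + k, le_rfl, rfl⟩
    obtain ⟨i, hi, h4⟩ := h3
    have haI := D0_sub S ha
    have h5 : S^[j + k - i] (S^[i] a) = S^[i] a := by
      rw [← Function.iterate_add_apply, Nat.sub_add_cancel (by omega), h4]
    exact aperiodic hS hmin (mem_iter hS haI i) (by omega) h5

theorem stmt15 (T S : ℝ → ℝ) (hT : IsIET T) (hmin : IsMinimal T)
    (m : ℕ) (hm : 1 ≤ m) (hfin : (DiscSet T).Finite) (hcard : (DiscSet T).ncard = m - 1)
    (hS : IsIET S) (n : ℕ) (hn : 2 ≤ n) (hpow : S^[n] = T) :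
    {C : Set ℝ | IsMaximalSChain S C}.Finite ∧
    {C : Set ℝ | IsMaximalSChain S C}.ncard ≤ m / 2 := by
  subst hpow
  have hdata : ∀ C : {C : Set ℝ // IsMaximalSChain S C}, _ :=
    fun C => maximal_data hS hmin C.2
  choose a k ha hb hC hpre hpost using hdata
  have hsurj : ∀ C, ∃ y ∈ unitI, S^[n - 1] y = a C := fun C =>
    (hS.1.iterate (n - 1)).surjOn (D0_sub S (ha C))
  choose y hyI hy using hsurj
  have hD0fin : (D0 S^[n]).Finite := hfin.insert 0
  have hD0card : (D0 S^[n]).ncard ≤ m := by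
    have := Set.ncard_insert_le (0 : ℝ) (DiscSet S^[n])
    unfold D0
    omega
  let F : {C : Set ℝ // IsMaximalSChain S C} ⊕ {C : Set ℝ // IsMaximalSChain S C} → D0 S^[n] :=
    Sum.elim (fun C => ⟨y C, first_mem hS hn (ha C) (hyI C) (hy C) (hpre C)⟩)
      (fun C => ⟨S^[k C] (a C), last_mem hS hn (hb C) (hpost C)⟩)
  have hne : ∀ C C', y C ≠ S^[k C'] (a C') := fun C C' h =>
    hpre C (n - 1) (by omega) (y C) (hyI C) (hy C) (h ▸ hb C')
  have inj1 : ∀ C C', y C = y C' → C = C' := by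
    intro C C' h
    have hac : a C = a C' := by rw [← hy, ← hy, h]
    apply Subtype.ext
    rcases le_total (k C) (k C') with hk | hk
    · refine C.2.2 _ C'.2.1 ?_
      rw [hC C, hC C']
      rintro z ⟨i, hi, rfl⟩
      exact ⟨i, hi.trans hk, by rw [hac]⟩
    · refine (C'.2.2 _ C.2.1 ?_).symm
      rw [hC C, hC C']
      rintro z ⟨i, hi, rfl⟩
      exact ⟨i, hi.trans hk, by rw [hac]⟩
  have aux : ∀ C C', S^[k C] (a C) = S^[k C'] (a C') → k C ≤ k C' → C.1 = C'.1 := by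
    intro C C' h hk
    refine C.2.2 _ C'.2.1 ?_
    have hac : a C = S^[k C' - k C] (a C') := by
      refine (hS.1.iterate (k C)).injOn (D0_sub S (ha C))
        (mem_iter hS (D0_sub S (ha C')) _) ?_
      rw [h, ← Function.iterate_add_apply, Nat.add_sub_cancel' hk]
    rw [hC C, hC C']
    rintro z ⟨i, hi, rfl⟩
    exact ⟨i + (k C' - k C), by omega, by rw [Function.iterate_add_apply, ← hac]⟩
  have inj2 : ∀ C C', S^[k C] (a C) = S^[k C'] (a C') → C = C' := by
    intro C C' h
    apply Subtype.ext
    rcases le_total (k C) (k C') with hk | hk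
    · exact aux C C' h hk
    · exact (aux C' C h.symm hk).symm
  have hF : Function.Injective F := by
    rintro (C | C) (C' | C') h
    · exact congrArg Sum.inl (inj1 C C' (congrArg Subtype.val h))
    · exact absurd (congrArg Subtype.val h) (hne C C')
    · exact absurd (congrArg Subtype.val h).symm (hne C' C)
    · exact congrArg Sum.inr (inj2 C C' (congrArg Subtype.val h))
  have : Finite (D0 S^[n]) := hD0fin
  have hfs : Finite ({C : Set ℝ // IsMaximalSChain S C} ⊕ {C : Set ℝ // IsMaximalSChain S C}) :=
    Finite.of_injective F hF
  have hf1 : Finite {C : Set ℝ // IsMaximalSChain S C} :=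
    Finite.of_injective (Sum.inl (β := {C : Set ℝ // IsMaximalSChain S C})) Sum.inl_injective
  refine ⟨Set.finite_coe_iff.1 hf1, ?_⟩
  have hle := Nat.card_le_card_of_injective F hF
  rw [Nat.card_sum, Nat.card_coe_set_eq] at hle
  have e : {C : Set ℝ | IsMaximalSChain S C}.ncard =
      Nat.card {C : Set ℝ // IsMaximalSChain S C} := (Nat.card_coe_set_eq _).symm
  rw [e]
  omega

end IETRoots
end
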